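/- Let s > 1, R = R_s, Λ = R ⊗_K R^{op}, and let ⋯ → Q_t → ⋯ → Q_0 → R → 0 be the minimal projective resolution of R as a left Λ-module. For t ∈ ℕ write t = 11ℓ + r with 0 ≤ r ≤ 10, set n = 6 and m = ⌊r/2⌋, and read all congruences mod s. Then: if r = 0, dim_K Hom_Λ(Q_t, R) = 6s when (ℓn+m≡0 or ℓn+m≡1) and ℓ is even, = 2s when (ℓn+m≡0 or ℓn+m≡1) and ℓ is odd, and = 0 otherwise; if r = 1, it is 7s when ℓn+m≡0 and ℓ even, 5s when ℓn+m≡0 and ℓ odd, else 0; if r ∈ {2,8}, it is 3s when ℓn+m≡0 and ℓ even, s when ℓn+m≡0 and ℓ odd, s when ℓn+m≡1 and ℓ even, 3s when ℓn+m≡1 and ℓ odd, else 0; if r ∈ {3,5,7}, it is 8s when ℓn+m≡0, else 0; if r = 4, it is 2s when ℓn+m≡0 and ℓ even, 6s when ℓn+m≡0 and ℓ odd, 5s when ℓn+m≡1 and ℓ even, 7s when ℓn+m≡1 and ℓ odd, else 0; if r = 6, it is 7s when ℓn+m≡0 and ℓ even, 5s when ℓn+m≡0 and ℓ odd, 6s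 when ℓn+m≡1 and ℓ even, 2s when ℓn+m≡1 and ℓ odd, else 0; if r = 9, it is 5s when ℓn+m≡0 and ℓ even, 7s when ℓn+m≡0 and ℓ odd, else 0; if r = 10, it is 2s when (ℓn+m≡0 or ≡1) and ℓ even, 6s when (ℓn+m≡0 or ≡1) and ℓ odd, else 0. -/

import Mathlib

open scoped TensorProduct

set_option synthInstance.maxHeartbeats 1000000
set_option maxHeartbeats 2000000

universe u v

namespace E6

/-- Generators of the presentation of the path algebra of the quiver `𝒬ₛ`:
trivial paths `e i`, arrows `a i` (the `αᵢ`), `b i` (the `βᵢ`) and `g i` (the `γᵢ`). -/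
inductive Gen (s : ℕ) : Type
  | e (i : ZMod (6 * s))
  | a (i : ZMod (3 * s))
  | b (i : ZMod (3 * s))
  | g (i : ZMod s)

variable (K : Type u) [Field K] (s : ℕ)

/-- The free algebra on the generators. -/
abbrev F : Type u := FreeAlgebra K (Gen s)

/-- Trivial path generators. -/
noncomputable def E (i : ZMod (6 * s)) : F K s := FreeAlgebra.ι K (Gen.e i)
/-- `α` arrow generators. -/
noncomputable def A (i : ZMod (3 * s)) : F K s := FreeAlgebra.ι K (Gen.a i)
/-- `β` arrow generators. -/
noncomputable def B (i : ZMod (3 * s)) : F K s := FreeAlgebra.ι K (Gen.b i)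
/-- `γ` arrow generators. -/
noncomputable def G (i : ZMod s) : F K s := FreeAlgebra.ι K (Gen.g i)

/-- Source vertex of the arrow `αᵢ` : writing `i = 3t + j` with `j < 3`,
`α_{3t} : 6t → 6t+1`, `α_{3t+1} : 6t+1 → 6t+2`, `α_{3t+2} : 6t+2 → 6t+5`. -/
def aSrc (i : ZMod (3 * s)) : ZMod (6 * s) := ((2 * i.val - i.val % 3 : ℕ) : ZMod (6 * s))

/-- Target vertex of the arrow `αᵢ`. -/
def aTgt (i : ZMod (3 * s)) : ZMod (6 * s) :=
  if i.val % 3 = 1 then ((2 * i.val : ℕ) : ZMod (6 * s)) else ((2 * i.val + 1 : ℕ) : ZMod (6 * s))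

/-- Source vertex of the arrow `βᵢ` : `β_{3t} : 6t → 6t+3`, `β_{3t+1} : 6t+3 → 6t+4`,
`β_{3t+2} : 6t+4 → 6t+5`. -/
def bSrc (i : ZMod (3 * s)) : ZMod (6 * s) :=
  if i.val % 3 = 1 then ((2 * i.val + 1 : ℕ) : ZMod (6 * s)) else ((2 * i.val : ℕ) : ZMod (6 * s))

/-- Target vertex of the arrow `βᵢ`. -/
def bTgt (i : ZMod (3 * s)) : ZMod (6 * s) := ((2 * i.val + 3 - i.val % 3 : ℕ) : ZMod (6 * s))

/-- Source vertex of the arrow `γₜ : 6t+5 → 6t+6`. -/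
def gSrc (i : ZMod s) : ZMod (6 * s) := ((6 * i.val + 5 : ℕ) : ZMod (6 * s))

/-- Target vertex of the arrow `γₜ`. -/
def gTgt (i : ZMod s) : ZMod (6 * s) := ((6 * i.val + 6 : ℕ) : ZMod (6 * s))

/-- The set of arrow generators inside the free algebra. -/
noncomputable def arrows : Set (F K s) :=
  Set.range (A K s) ∪ Set.range (B K s) ∪ Set.range (G K s)

/-- The relations presenting `R_s = K[𝒬ₛ]/I₀` as a quotient of the free algebra on the
trivial paths and the arrows.  The first eight families of relations present the path
algebra `K[𝒬ₛ]` (the trivial paths are orthogonal idempotents summing to `1`, and each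
arrow is fixed by multiplication with the trivial paths at its target, resp. source);
the remaining relations generate the ideal `I₀`: all paths of length `5` vanish
(equivalently, all products of five arrows), `α_{3t+2}α_{3t+1}α_{3t} = β_{3t+2}β_{3t+1}β_{3t}`,
and `α_{3t+3}γ_tβ_{3t+2} = 0 = β_{3t+3}γ_tα_{3t+2}`. -/
inductive Rel : F K s → F K s → Prop
  | idem (i j : ZMod (6 * s)) :
      Rel (E K s i * E K s j) (if i = j then E K s i else 0)
  | sum_one :
      Rel (∑ i ∈ Finset.range (6 * s), E K s (i : ZMod (6 * s))) 1
  | a_tgt (i : ZMod (3 * s)) : Rel (E K s (aTgt s i) * A K s i) (A K s i)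
  | a_src (i : ZMod (3 * s)) : Rel (A K s i * E K s (aSrc s i)) (A K s i)
  | b_tgt (i : ZMod (3 * s)) : Rel (E K s (bTgt s i) * B K s i) (B K s i)
  | b_src (i : ZMod (3 * s)) : Rel (B K s i * E K s (bSrc s i)) (B K s i)
  | g_tgt (i : ZMod s) : Rel (E K s (gTgt s i) * G K s i) (G K s i)
  | g_src (i : ZMod s) : Rel (G K s i * E K s (gSrc s i)) (G K s i)
  | len5 (x₁ x₂ x₃ x₄ x₅ : F K s) (h₁ : x₁ ∈ arrows K s) (h₂ : x₂ ∈ arrows K s)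
      (h₃ : x₃ ∈ arrows K s) (h₄ : x₄ ∈ arrows K s) (h₅ : x₅ ∈ arrows K s) :
      Rel (x₁ * x₂ * x₃ * x₄ * x₅) 0
  | comm (t : Fin s) :
      Rel (A K s ((3 * (t : ℕ) + 2 : ℕ) : ZMod (3 * s)) *
             A K s ((3 * (t : ℕ) + 1 : ℕ) : ZMod (3 * s)) *
             A K s ((3 * (t : ℕ) : ℕ) : ZMod (3 * s)))
          (B K s ((3 * (t : ℕ) + 2 : ℕ) : ZMod (3 * s)) *
             B K s ((3 * (t : ℕ) + 1 : ℕ) : ZMod (3 * s)) *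
             B K s ((3 * (t : ℕ) : ℕ) : ZMod (3 * s)))
  | zero_agb (t : Fin s) :
      Rel (A K s ((3 * (t : ℕ) + 3 : ℕ) : ZMod (3 * s)) * G K s (((t : ℕ) : ℕ) : ZMod s) *
             B K s ((3 * (t : ℕ) + 2 : ℕ) : ZMod (3 * s))) 0
  | zero_bga (t : Fin s) :
      Rel (B K s ((3 * (t : ℕ) + 3 : ℕ) : ZMod (3 * s)) * G K s (((t : ℕ) : ℕ) : ZMod s) *
             A K s ((3 * (t : ℕ) + 2 : ℕ) : ZMod (3 * s))) 0

/-- The self-injective algebra `R_s` of tree class `E₆`, i.e. the quotient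
`K[𝒬ₛ]/I₀` of the path algebra of `𝒬ₛ`, presented by generators and relations. -/
abbrev Alg : Type u := RingQuot (Rel K s)

/-- A canonical `Semiring` instance on `R_s`, routed through the `Ring` structure
(this keeps instance paths on `R_s` coherent). -/
noncomputable instance (priority := 1100) : Semiring (Alg K s) :=
  Ring.toSemiring

/-- The images `e_i` in `R_s` of the trivial paths. -/
noncomputable def ee (i : ZMod (6 * s)) : Alg K s :=
  RingQuot.mkAlgHom K (Rel K s) (E K s i)

/-- The images `α_i` in `R_s` of the arrows `α`. -/
noncomputable def aa (i : ZMod (3 * s)) : Alg K s :=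
  RingQuot.mkAlgHom K (Rel K s) (A K s i)

/-- The images `β_i` in `R_s` of the arrows `β`. -/
noncomputable def bb (i : ZMod (3 * s)) : Alg K s :=
  RingQuot.mkAlgHom K (Rel K s) (B K s i)

/-- The images `γ_i` in `R_s` of the arrows `γ`. -/
noncomputable def gg (i : ZMod s) : Alg K s :=
  RingQuot.mkAlgHom K (Rel K s) (G K s i)

/-! ### The enveloping algebra `Λ = R ⊗ₖ Rᵐᵒᵖ` and the outer bimodule structure on `R` -/

/-- The enveloping algebra `Λ = R_s ⊗[K] R_sᵐᵒᵖ`. -/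
abbrev Env : Type u := Alg K s ⊗[K] (Alg K s)ᵐᵒᵖ

/-- A canonical `Semiring` instance on `Λ`, routed through the `Ring` structure
(this keeps instance paths on `Λ` coherent). -/
noncomputable instance (priority := 1100) : Semiring (Env K s) :=
  Ring.toSemiring

/-- `R_s` is a left `Λ`-module via the outer action `(a ⊗ b) • r = a * r * b.unop`. -/
noncomputable instance : Module (Env K s) (Alg K s) :=
  TensorProduct.Algebra.module


instance : SMulCommClass (Env K s) K (Alg K s) where
  smul_comm l k r := by
    induction l using TensorProduct.induction_on with
    | zero => simp
    | tmul a b =>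
        show a • b • (k • r) = k • (a • b • r)
        rw [smul_comm b k r, smul_comm a k (b • r)]
    | add x y hx hy =>
        rw [add_smul, add_smul, smul_add, hx, hy]

instance : IsScalarTower K (Env K s) (Alg K s) where
  smul_assoc k l r := by
    induction l using TensorProduct.induction_on with
    | zero => simp
    | tmul a b =>
        show ((k • a) ⊗ₜ[K] b) • r = k • (a ⊗ₜ[K] b) • r
        show (k • a) • b • r = k • (a • (b • r))
        rw [smul_assoc]
    | add x y hx hy =>
        rw [smul_add, add_smul, add_smul, hx, hy, smul_add]

/-! ### Projective and simple modules -/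

/-- The quotient of a module by a submodule (as a type). -/
def modQuot {R : Type v} [Ring R] {M : Type*} [AddCommGroup M] [Module R M]
    (p : Submodule R M) : Type _ := M ⧸ p

noncomputable instance {R : Type v} [Ring R] {M : Type*} [AddCommGroup M] [Module R M]
    (p : Submodule R M) : AddCommGroup (modQuot p) :=
  inferInstanceAs (AddCommGroup (M ⧸ p))

noncomputable instance {R : Type v} [Ring R] {M : Type*} [AddCommGroup M] [Module R M]
    (p : Submodule R M) : Module R (modQuot p) :=
  inferInstanceAs (Module R (M ⧸ p))

/-- Right multiplication by a fixed element, as an endomorphism of the left regular module. -/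
def rmul (Λ : Type v) [Ring Λ] (x : Λ) : Λ →ₗ[Λ] Λ where
  toFun y := y * x
  map_add' a b := add_mul a b x
  map_smul' r a := mul_assoc r a x

/-- The Jacobson radical of the ring `Λ` times the `Λ`-module `M`, i.e. the submodule
`rad(Λ)·M` generated by all products `r • x` with `r` in the Jacobson radical of `Λ`
(the Jacobson radical being the intersection of all maximal left ideals). -/
def radSMul (Λ : Type v) [Ring Λ] (M : Type w) [AddCommGroup M] [Module Λ M] :
    Submodule Λ M :=
  Submodule.span Λ {z | ∃ r ∈ (⊥ : Ideal Λ).jacobson, ∃ x : M, z = r • x}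

/-- The indecomposable projective left `R_s`-module `P_i = R_s·e_i`. -/
noncomputable def P (i : ZMod (6 * s)) : Submodule (Alg K s) (Alg K s) :=
  LinearMap.range (rmul (Alg K s) (ee K s i))

/-- The simple left `R_s`-module `S_i = P_i / rad(P_i)` at the vertex `i`. -/
noncomputable def S (i : ZMod (6 * s)) : Type u :=
  modQuot (radSMul (Alg K s) ↥(P K s i))

noncomputable instance (i : ZMod (6 * s)) : AddCommGroup (S K s i) :=
  inferInstanceAs (AddCommGroup (modQuot (radSMul (Alg K s) ↥(P K s i))))

noncomputable instance (i : ZMod (6 * s)) : Module (Alg K s) (S K s i) :=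
  inferInstanceAs (Module (Alg K s) (modQuot (radSMul (Alg K s) ↥(P K s i))))

/-- The canonical projection `P_i → S_i`. -/
noncomputable def toS (i : ZMod (6 * s)) : ↥(P K s i) →ₗ[Alg K s] S K s i :=
  (radSMul (Alg K s) ↥(P K s i)).mkQ

/-- Corestriction of right multiplication by `e_i` to `P_i`. -/
noncomputable def toP (i : ZMod (6 * s)) : Alg K s →ₗ[Alg K s] ↥(P K s i) :=
  LinearMap.codRestrict (P K s i) (rmul (Alg K s) (ee K s i))
    (fun c => LinearMap.mem_range_self _ c)

/-- The homomorphism `P_j → P_i` given by right multiplication with (the class of)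
a path `w` from vertex `i` to vertex `j`; concretely it is `x ↦ x * w * e_i`, which
for an actual path `w` from `i` to `j` (so that `w * e_i = w` holds in `R_s`) is just
right multiplication `x ↦ x * w`. -/
noncomputable def pmul (i j : ZMod (6 * s)) (w : Alg K s) :
    ↥(P K s j) →ₗ[Alg K s] ↥(P K s i) :=
  (toP K s i).comp ((rmul (Alg K s) w).comp (P K s j).subtype)

/-- `α`-arrows of `R_s`, indexed by natural numbers. -/
noncomputable def aN (k : ℕ) : Alg K s := aa K s ((k : ℕ) : ZMod (3 * s))

/-- `β`-arrows of `R_s`, indexed by natural numbers. -/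
noncomputable def bN (k : ℕ) : Alg K s := bb K s ((k : ℕ) : ZMod (3 * s))

/-- `γ`-arrows of `R_s`, indexed by natural numbers. -/
noncomputable def gN (k : ℕ) : Alg K s := gg K s ((k : ℕ) : ZMod s)

/-- The homomorphism `P_j → P_i` (vertices given by natural numbers, taken mod `6s`)
induced by right multiplication with `w`. -/
noncomputable def pmulN (i j : ℕ) (w : Alg K s) :
    ↥(P K s ((j : ℕ) : ZMod (6 * s))) →ₗ[Alg K s] ↥(P K s ((i : ℕ) : ZMod (6 * s))) :=
  pmul K s ((i : ℕ) : ZMod (6 * s)) ((j : ℕ) : ZMod (6 * s)) w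

/-- The canonical projection `P_i → S_i` (vertex given by a natural number). -/
noncomputable def toSN (i : ℕ) :
    ↥(P K s ((i : ℕ) : ZMod (6 * s))) →ₗ[Alg K s] S K s ((i : ℕ) : ZMod (6 * s)) :=
  toS K s ((i : ℕ) : ZMod (6 * s))

/-- The simple module `S_i`, for a vertex given by a natural number. -/
noncomputable def SN (i : ℕ) : Type u := S K s ((i : ℕ) : ZMod (6 * s))

noncomputable instance (i : ℕ) : AddCommGroup (SN K s i) :=
  inferInstanceAs (AddCommGroup (S K s ((i : ℕ) : ZMod (6 * s))))

noncomputable instance (i : ℕ) : Module (Alg K s) (SN K s i) :=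
  inferInstanceAs (Module (Alg K s) (S K s ((i : ℕ) : ZMod (6 * s))))

/-! ### Projective resolutions, minimality and syzygies -/

/-- A projective resolution `⋯ → Q 1 → Q 0 → M → 0` of a module `M` over a ring `Λ`. -/
structure ProjRes (Λ : Type v) [Ring Λ] (M : Type w) [AddCommGroup M] [Module Λ M] where
  /-- The terms of the resolution. -/
  Q : ℕ → Type v
  [acg : ∀ n, AddCommGroup (Q n)]
  [mod : ∀ n, Module Λ (Q n)]
  proj : ∀ n, Module.Projective Λ (Q n)
  /-- The differentials. -/
  d : ∀ n, Q (n + 1) →ₗ[Λ] Q n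
  /-- The augmentation. -/
  ε : Q 0 →ₗ[Λ] M
  surj : Function.Surjective ε
  exact₀ : LinearMap.range (d 0) = LinearMap.ker ε
  exact : ∀ n, LinearMap.range (d (n + 1)) = LinearMap.ker (d n)

attribute [instance] ProjRes.acg ProjRes.mod

/-- A projective resolution is minimal if the image of every differential lies in
`rad(Λ)` times the target. -/
def ProjRes.Minimal {Λ : Type v} [Ring Λ] {M : Type w} [AddCommGroup M]
    [Module Λ M] (res : ProjRes Λ M) : Prop :=
  ∀ n, LinearMap.range (res.d n) ≤ radSMul Λ (res.Q n)

/-- `Ω^p(M) ≅ N` : the `p`-th syzygy of `M` with respect to the projective resolution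
`res` is isomorphic to `N` (stated for `p ≥ 1`; here `Ω¹ = ker ε` and
`Ω^p = ker (d (p-2))` for `p ≥ 2`). -/
def ProjRes.SyzygyIso {Λ : Type v} [Ring Λ] {M : Type w} [AddCommGroup M]
    [Module Λ M] (res : ProjRes Λ M) (p : ℕ) (N : Type*) [AddCommGroup N]
    [Module Λ N] : Prop :=
  (p = 1 ∧ Nonempty (↥(LinearMap.ker res.ε) ≃ₗ[Λ] N)) ∨
  (2 ≤ p ∧ Nonempty (↥(LinearMap.ker (res.d (p - 2))) ≃ₗ[Λ] N))

/-! ### The automorphisms `σ` and `τ`, and twisted bimodules -/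

/-- The defining property of the algebra automorphism `σ` of `R_s` :
`σ(e_i) = e_{i+36}` for `i ≡ 0,5 (mod 6)`, `σ(e_i) = e_{i+38}` for `i ≡ 1,2 (mod 6)`,
`σ(e_i) = e_{i+34}` for `i ≡ 3,4 (mod 6)`; `σ(γ_i) = -γ_{i+6}`;
`σ(α_i) = -β_{i+18}` for `i ≡ 0,1 (mod 3)` and `σ(α_i) = β_{i+18}` for `i ≡ 2 (mod 3)`;
`σ(β_i) = -α_{i+18}` for `i ≡ 1,2 (mod 3)` and `σ(β_i) = α_{i+18}` for `i ≡ 0 (mod 3)`. -/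
noncomputable def IsSigma (σ : Alg K s ≃ₐ[K] Alg K s) : Prop :=
  (∀ i : ZMod (6 * s), σ (ee K s i) =
      if i.val % 6 = 0 ∨ i.val % 6 = 5 then ee K s (i + 36)
      else if i.val % 6 = 1 ∨ i.val % 6 = 2 then ee K s (i + 38)
      else ee K s (i + 34)) ∧
  (∀ i : ZMod s, σ (gg K s i) = -gg K s (i + 6)) ∧
  (∀ i : ZMod (3 * s), σ (aa K s i) =
      if i.val % 3 = 2 then bb K s (i + 18) else -bb K s (i + 18)) ∧
  (∀ i : ZMod (3 * s), σ (bb K s i) =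
      if i.val % 3 = 0 then aa K s (i + 18) else -aa K s (i + 18))

/-- The underlying type of the twisted bimodule `₁R_σ` : the linear space `R_s` with
the ordinary left action of `R_s` and the right action twisted by `σ`. -/
def Twisted (_σ : Alg K s ≃ₐ[K] Alg K s) : Type u := Alg K s

variable {K s} in
/-- The identity map `R_s → ₁R_σ`. -/
def Twisted.mk (σ : Alg K s ≃ₐ[K] Alg K s) (x : Alg K s) : Twisted K s σ := x

variable {K s} in
/-- The identity map `₁R_σ → R_s`. -/
def Twisted.un (σ : Alg K s ≃ₐ[K] Alg K s) (x : Twisted K s σ) : Alg K s := x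

section TwistedInstances

variable (σ : Alg K s ≃ₐ[K] Alg K s)

noncomputable instance : AddCommGroup (Twisted K s σ) :=
  inferInstanceAs (AddCommGroup (Alg K s))

noncomputable instance : Module K (Twisted K s σ) :=
  inferInstanceAs (Module K (Alg K s))

noncomputable instance : Module (Alg K s) (Twisted K s σ) :=
  inferInstanceAs (Module (Alg K s) (Alg K s))

/-- The right action on `₁R_σ` : `(op b) • m = m * σ(b)`. -/
noncomputable instance : Module (Alg K s)ᵐᵒᵖ (Twisted K s σ) :=
  Module.compHom (Alg K s) (RingHom.op (σ : Alg K s →+* Alg K s))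

variable {K s σ} in
theorem Twisted.op_smul_def (b : (Alg K s)ᵐᵒᵖ) (m : Twisted K s σ) :
    b • m = Twisted.mk σ (Twisted.un σ m * σ b.unop) :=
  rfl

noncomputable instance : IsScalarTower K (Alg K s) (Twisted K s σ) :=
  inferInstanceAs (IsScalarTower K (Alg K s) (Alg K s))

noncomputable instance : IsScalarTower K (Alg K s)ᵐᵒᵖ (Twisted K s σ) where
  smul_assoc k b m := by
    rw [Twisted.op_smul_def, Twisted.op_smul_def, MulOpposite.unop_smul, map_smul]
    show Twisted.un σ m * k • σ b.unop = k • (Twisted.un σ m * σ b.unop)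
    rw [mul_smul_comm]

noncomputable instance : SMulCommClass (Alg K s) (Alg K s)ᵐᵒᵖ (Twisted K s σ) where
  smul_comm a b m := by
    rw [Twisted.op_smul_def]
    show Twisted.mk σ (a * (Twisted.un σ m * σ b.unop)) =
      b • Twisted.mk σ (a * Twisted.un σ m)
    rw [Twisted.op_smul_def]
    show Twisted.mk σ (a * (Twisted.un σ m * σ b.unop)) =
      Twisted.mk σ ((a * Twisted.un σ m) * σ b.unop)
    rw [mul_assoc]

/-- The twisted bimodule `₁R_σ` as a module over the enveloping algebra `Λ`. -/
noncomputable instance : Module (Env K s) (Twisted K s σ) :=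
  TensorProduct.Algebra.module

end TwistedInstances

/-- The defining property of the automorphism `τ` of `R_s` : `τ` fixes all `e_i`
and all `γ_i`, and `τ(α_i) = -α_i`, `τ(β_i) = -β_i` for `i ≡ 0,2 (mod 3)` while
`τ(α_i) = α_i`, `τ(β_i) = β_i` for `i ≡ 1 (mod 3)`. -/
noncomputable def IsTau (τ : Alg K s ≃ₐ[K] Alg K s) : Prop :=
  (∀ i : ZMod (6 * s), τ (ee K s i) = ee K s i) ∧
  (∀ i : ZMod s, τ (gg K s i) = gg K s i) ∧
  (∀ i : ZMod (3 * s), τ (aa K s i) =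
      if i.val % 3 = 1 then aa K s i else -aa K s i) ∧
  (∀ i : ZMod (3 * s), τ (bb K s i) =
      if i.val % 3 = 1 then bb K s i else -bb K s i)


/-- The dimensions of the groups `Hom_Λ(Q_t, R_s)` (`s > 1`), as stated. -/
def homDim (s t : ℕ) : ℕ :=
  let L := t / 11
  let r := t % 11
  let m := r / 2
  let c0 : Bool := (6 * L + m) % s == 0 % s
  let c1 : Bool := (6 * L + m) % s == 1 % s
  let ev : Bool := L % 2 == 0
  if r == 0 then (if (c0 || c1) && ev then 6*s else if (c0 || c1) && !ev then 2*s else 0)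
  else if r == 1 then (if c0 && ev then 7*s else if c0 && !ev then 5*s else 0)
  else if r == 2 || r == 8 then
    (if c0 && ev then 3*s else if c0 && !ev then s
     else if c1 && ev then s else if c1 && !ev then 3*s else 0)
  else if r == 3 || r == 5 || r == 7 then (if c0 then 8*s else 0)
  else if r == 4 then
    (if c0 && ev then 2*s else if c0 && !ev then 6*s
     else if c1 && ev then 5*s else if c1 && !ev then 7*s else 0)
  else if r == 6 then
    (if c0 && ev then 7*s else if c0 && !ev then 5*s
     else if c1 && ev then 6*s else if c1 && !ev then 2*s else 0)
  else if r == 9 then (if c0 && ev then 5*s else if c0 && !ev then 7*s else 0)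
  else (if (c0 || c1) && ev then 2*s else if (c0 || c1) && !ev then 6*s else 0)

section Cohomology

variable {k : Type*} [Field k] {Λ : Type v} [Ring Λ] [Algebra k Λ]
  {N : Type*} [AddCommGroup N] [Module Λ N]

section Post

variable (k) {Q : Type*} [AddCommGroup Q] [Module Λ Q]
  {M M' M'' : Type*} [AddCommGroup M] [Module Λ M] [Module k M] [IsScalarTower k Λ M]
  [AddCommGroup M'] [Module Λ M'] [Module k M'] [IsScalarTower k Λ M']
  [AddCommGroup M''] [Module Λ M''] [Module k M''] [IsScalarTower k Λ M'']

/-- Postcomposition with a `Λ`-linear map, as a `k`-linear map. -/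
def postComp (Q : Type*) [AddCommGroup Q] [Module Λ Q] (g : M →ₗ[Λ] M'') :
    (Q →ₗ[Λ] M) →ₗ[k] (Q →ₗ[Λ] M'') where
  toFun f := g ∘ₗ f
  map_add' f f' := by ext x; simp
  map_smul' c f := by ext x; exact g.map_smul_of_tower c (f x)

theorem postComp_injective {i : M' →ₗ[Λ] M} (hi : Function.Injective i) :
    Function.Injective (postComp k Q i) := fun f f' h => by
  ext x
  exact hi (LinearMap.congr_fun h x)

theorem postComp_surjective [Module.Projective Λ Q] {π : M →ₗ[Λ] M''}
    (hπ : Function.Surjective π) : Function.Surjective (postComp k Q π) := fun f => by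
  obtain ⟨g, hg⟩ := Module.projective_lifting_property π f hπ
  exact ⟨g, hg⟩

/-- A map into the middle term killed by the second map of a short exact sequence factors
through the first one. -/
theorem exists_factor {i : M' →ₗ[Λ] M} {π : M →ₗ[Λ] M''} (hi : Function.Injective i)
    (hex : ∀ x, π x = 0 → ∃ y, i y = x) (f : Q →ₗ[Λ] M) (hf : π ∘ₗ f = 0) :
    ∃ g : Q →ₗ[Λ] M', i ∘ₗ g = f := by
  have hr : ∀ x, f x ∈ LinearMap.range i := fun x => hex _ (LinearMap.congr_fun hf x)
  refine ⟨(LinearEquiv.ofInjective i hi).symm.toLinearMap ∘ₗ f.codRestrict _ hr, ?_⟩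
  ext x
  have h := (LinearEquiv.ofInjective i hi).apply_symm_apply (f.codRestrict _ hr x)
  simpa using congrArg Subtype.val h

/-- Additivity of `dim Hom(Q, -)` for projective `Q`. -/
theorem finrank_hom_add [Module.Projective Λ Q] {i : M' →ₗ[Λ] M} {π : M →ₗ[Λ] M''}
    (hi : Function.Injective i) (hπ : Function.Surjective π) (h0 : ∀ y, π (i y) = 0)
    (hex : ∀ x, π x = 0 → ∃ y, i y = x) [Module.Finite k (Q →ₗ[Λ] M')]
    [Module.Finite k (Q →ₗ[Λ] M'')] :
    Module.Finite k (Q →ₗ[Λ] M) ∧ Module.finrank k (Q →ₗ[Λ] M) =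
      Module.finrank k (Q →ₗ[Λ] M') + Module.finrank k (Q →ₗ[Λ] M'') := by
  have hker : LinearMap.ker (postComp k Q π) = LinearMap.range (postComp k Q i) := by
    ext f
    constructor
    · intro hf
      obtain ⟨g, hg⟩ := exists_factor hi hex f hf
      exact ⟨g, hg⟩
    · rintro ⟨g, rfl⟩
      refine LinearMap.mem_ker.mpr ?_
      ext x
      exact h0 _
  have e1 := LinearEquiv.ofInjective _ (postComp_injective k (Q := Q) hi)
  have e2 := (postComp k Q π).quotKerEquivOfSurjective (postComp_surjective k hπ)
  have f1 : Module.Finite k (LinearMap.ker (postComp k Q π)) := by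
    rw [hker]; exact Module.Finite.equiv e1
  have f2 : Module.Finite k ((Q →ₗ[Λ] M) ⧸ LinearMap.ker (postComp k Q π)) :=
    Module.Finite.equiv e2.symm
  have f3 : Module.Finite k (Q →ₗ[Λ] M) :=
    Module.Finite.of_submodule_quotient (LinearMap.ker (postComp k Q π))
  refine ⟨f3, ?_⟩
  rw [← Submodule.finrank_quotient_add_finrank (LinearMap.ker (postComp k Q π)), e2.finrank_eq,
    hker, ← e1.finrank_eq, add_comm]

end Post

variable (k) (res : ProjRes Λ N) (M : Type*) [AddCommGroup M] [Module Λ M] [Module k M]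
  [IsScalarTower k Λ M]

/-- The differential of the complex `Hom(Q, M)`. -/
def ProjRes.pre (p : ℕ) : (res.Q p →ₗ[Λ] M) →ₗ[k] (res.Q (p + 1) →ₗ[Λ] M) where
  toFun f := f ∘ₗ res.d p
  map_add' _ _ := rfl
  map_smul' _ _ := rfl

/-- Cocycles of `Hom(Q, M)`. -/
def ProjRes.cocycles (p : ℕ) : Submodule k (res.Q p →ₗ[Λ] M) := LinearMap.ker (res.pre k M p)

/-- Coboundaries of `Hom(Q, M)`. -/
def ProjRes.coboundaries : (p : ℕ) → Submodule k (res.Q p →ₗ[Λ] M)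
  | 0 => ⊥
  | p + 1 => LinearMap.range (res.pre k M p)

/-- The cohomology of `Hom(Q, M)`. -/
abbrev ProjRes.ext (p : ℕ) : Type _ :=
  ↥(res.cocycles k M p) ⧸ (res.coboundaries k M p).submoduleOf (res.cocycles k M p)

theorem ProjRes.mem_cocycles {p : ℕ} {f : res.Q p →ₗ[Λ] M} :
    f ∈ res.cocycles k M p ↔ ∀ x, f (res.d p x) = 0 :=
  ⟨fun h x => LinearMap.congr_fun (LinearMap.mem_ker.mp h) x,
    fun h => LinearMap.mem_ker.mpr (LinearMap.ext h)⟩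

theorem ProjRes.d_comp (p : ℕ) (x : res.Q (p + 2)) : res.d p (res.d (p + 1) x) = 0 := by
  have h : res.d (p + 1) x ∈ LinearMap.ker (res.d p) := res.exact p ▸ LinearMap.mem_range_self _ x
  exact h

theorem ProjRes.coboundaries_le (p : ℕ) : res.coboundaries k M p ≤ res.cocycles k M p := by
  cases p with
  | zero => exact bot_le
  | succ p =>
    rintro _ ⟨g, rfl⟩
    rw [ProjRes.mem_cocycles]
    intro x
    change g (res.d p (res.d (p + 1) x)) = 0
    rw [res.d_comp, map_zero]

/-- The zeroth cohomology is the space of cocycles. -/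
noncomputable def ProjRes.extZero : res.ext k M 0 ≃ₗ[k] ↥(res.cocycles k M 0) :=
  Submodule.quotEquivOfEqBot _ (by
    rw [eq_bot_iff]
    intro x hx
    have : (x : res.Q 0 →ₗ[Λ] M) ∈ (⊥ : Submodule k _) := hx
    simpa using this)

/-- If the differentials of `Hom(Q, M)` vanish, its cohomology is `Hom(Q, M)`. -/
theorem ProjRes.nonempty_ext_equiv (h : ∀ p, res.pre k M p = 0) (p : ℕ) :
    Nonempty (res.ext k M p ≃ₗ[k] (res.Q p →ₗ[Λ] M)) := by
  have hb : res.coboundaries k M p = ⊥ := by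
    cases p with
    | zero => rfl
    | succ p => change LinearMap.range (res.pre k M p) = ⊥; rw [h, LinearMap.range_zero]
  have hc : res.cocycles k M p = ⊤ := by rw [ProjRes.cocycles, h, LinearMap.ker_zero]
  refine ⟨(Submodule.quotEquivOfEqBot _ ?_).trans ((LinearEquiv.ofEq _ _ hc).trans
    Submodule.topEquiv)⟩
  rw [hb, eq_bot_iff]
  intro x hx
  have : (x : res.Q p →ₗ[Λ] M) ∈ (⊥ : Submodule k _) := hx
  simpa using this

section Shift

variable {M' M'' : Type*} [AddCommGroup M'] [Module Λ M'] [Module k M'] [IsScalarTower k Λ M']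
  [AddCommGroup M''] [Module Λ M''] [Module k M''] [IsScalarTower k Λ M'']

/-- Dimension shift: for a short exact sequence `0 → M' → M → M'' → 0` whose middle term is
acyclic in the relevant degrees, the connecting map is an isomorphism. -/
theorem ProjRes.nonempty_shift {i : M' →ₗ[Λ] M} {π : M →ₗ[Λ] M''}
    (hi : Function.Injective i) (hπ : Function.Surjective π) (h0 : ∀ y, π (i y) = 0)
    (hex : ∀ x, π x = 0 → ∃ y, i y = x) (p : ℕ)
    (hac : res.cocycles k M (p + 1) ≤ res.coboundaries k M (p + 1))
    (hp : ∀ f ∈ res.cocycles k M p, ∃ g ∈ res.coboundaries k M p, π ∘ₗ f = π ∘ₗ g) :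
    Nonempty (res.ext k M' (p + 1) ≃ₗ[k] res.ext k M'' p) := by
  have := res.proj
  -- the maps `f : Q p → M` whose image in `M''` is a cocycle
  let W : Submodule k (res.Q p →ₗ[Λ] M) :=
    (res.cocycles k M'' p).comap (postComp k (res.Q p) π)
  have hWd : ∀ f : W, ∀ x, π ((f : res.Q p →ₗ[Λ] M) (res.d p x)) = 0 := fun f x =>
    (res.mem_cocycles k M'').1 f.2 x
  choose lft hlft using fun f : W => exists_factor hi hex
    ((f : res.Q p →ₗ[Λ] M) ∘ₗ res.d p) (LinearMap.ext (hWd f))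
  have hlft' : ∀ f x, i (lft f x) = (f : res.Q p →ₗ[Λ] M) (res.d p x) := fun f x =>
    LinearMap.congr_fun (hlft f) x
  let a : W →ₗ[k] res.cocycles k M' (p + 1) :=
    { toFun := fun f => ⟨lft f, (res.mem_cocycles k M').2 fun x => hi (by
        rw [hlft', res.d_comp, map_zero, map_zero])⟩
      map_add' := fun f g => Subtype.ext (LinearMap.ext fun x => hi (by
        change i (lft (f + g) x) = i (lft f x + lft g x)
        rw [map_add, hlft', hlft', hlft']; rfl))
      map_smul' := fun c f => Subtype.ext (LinearMap.ext fun x => hi (by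
        change i (lft (c • f) x) = i (c • lft f x)
        rw [i.map_smul_of_tower, hlft', hlft']; rfl)) }
  let b : W →ₗ[k] res.cocycles k M'' p :=
    { toFun := fun f => ⟨π ∘ₗ (f : res.Q p →ₗ[Λ] M), f.2⟩
      map_add' := fun f g => Subtype.ext ((postComp k (res.Q p) π).map_add _ _)
      map_smul' := fun c f => Subtype.ext ((postComp k (res.Q p) π).map_smul c _) }
  let A := ((res.coboundaries k M' (p + 1)).submoduleOf _).mkQ ∘ₗ a
  let B := ((res.coboundaries k M'' p).submoduleOf _).mkQ ∘ₗ b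
  have hA : Function.Surjective A := by
    refine (Submodule.mkQ_surjective _).comp fun z => ?_
    have hz : i ∘ₗ z.1 ∈ res.cocycles k M (p + 1) := (res.mem_cocycles k M).2 fun x => by
      rw [LinearMap.comp_apply, (res.mem_cocycles k M').1 z.2 x, map_zero]
    obtain ⟨f, hf⟩ := hac hz
    have hf' : ∀ x, f (res.d p x) = i (z.1 x) := fun x => LinearMap.congr_fun hf x
    refine ⟨⟨f, (res.mem_cocycles k M'').2 fun x => ?_⟩, Subtype.ext (LinearMap.ext fun x => hi ?_)⟩
    · change π (f (res.d p x)) = 0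
      rw [hf', h0]
    · change i (lft _ x) = _
      rw [hlft', hf']
  have hB : Function.Surjective B := by
    refine (Submodule.mkQ_surjective _).comp fun z => ?_
    obtain ⟨f, hf⟩ := postComp_surjective k hπ z.1
    have hfW : postComp k (res.Q p) π f ∈ res.cocycles k M'' p := by rw [hf]; exact z.2
    exact ⟨⟨f, hfW⟩, Subtype.ext hf⟩
  have hAB : LinearMap.ker A = LinearMap.ker B := by
    ext f
    have eA : A f = 0 ↔ lft f ∈ res.coboundaries k M' (p + 1) := by
      change Submodule.mkQ _ _ = 0 ↔ _
      rw [Submodule.mkQ_apply, Submodule.Quotient.mk_eq_zero]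
      rfl
    have eB : B f = 0 ↔ π ∘ₗ f.1 ∈ res.coboundaries k M'' p := by
      change Submodule.mkQ _ _ = 0 ↔ _
      rw [Submodule.mkQ_apply, Submodule.Quotient.mk_eq_zero]
      rfl
    rw [LinearMap.mem_ker, LinearMap.mem_ker, eA, eB]
    constructor
    · rintro ⟨h, hh⟩
      have hh' : ∀ x, h (res.d p x) = lft f x := fun x => LinearMap.congr_fun hh x
      have hc : f.1 - i ∘ₗ h ∈ res.cocycles k M p := (res.mem_cocycles k M).2 fun x => by
        rw [LinearMap.sub_apply, LinearMap.comp_apply, hh', hlft', sub_self]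
      obtain ⟨g, hg, hfg⟩ := hp _ hc
      have e : π ∘ₗ f.1 = π ∘ₗ g := by
        rw [← hfg]
        ext x
        simp [h0]
      rw [e]
      cases p with
      | zero =>
        have : g = 0 := hg
        rw [this, LinearMap.comp_zero]
        exact Submodule.zero_mem _
      | succ p =>
        obtain ⟨g', rfl⟩ := hg
        exact ⟨π ∘ₗ g', rfl⟩
    · intro hf
      have : ∃ g ∈ res.coboundaries k M p, π ∘ₗ f.1 = π ∘ₗ g := by
        cases p with
        | zero =>
          have h : π ∘ₗ f.1 = 0 := hf
          exact ⟨0, Submodule.zero_mem _, by rw [h, LinearMap.comp_zero]⟩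
        | succ p =>
          obtain ⟨g', hg'⟩ := hf
          obtain ⟨g, rfl⟩ := postComp_surjective k hπ g'
          exact ⟨_, ⟨g, rfl⟩, hg'.symm⟩
      obtain ⟨g, hg, hfg⟩ := this
      obtain ⟨h, hh⟩ := exists_factor hi hex (f.1 - g) (by rw [LinearMap.comp_sub, hfg, sub_self])
      refine ⟨h, LinearMap.ext fun x => hi ?_⟩
      have e := LinearMap.congr_fun hh (res.d p x)
      have hgx := (res.mem_cocycles k M).1 (res.coboundaries_le k M p hg) x
      change i (h (res.d p x)) = i (lft f x)
      rw [hlft', ← sub_zero (f.1 (res.d p x)), ← hgx]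
      exact e
  exact ⟨(A.quotKerEquivOfSurjective hA).symm.trans ((Submodule.quotEquivOfEq _ _ hAB).trans
    (B.quotKerEquivOfSurjective hB))⟩

end Shift

end Cohomology

section DualBimodule

variable {K : Type u} [Field K] {R : Type u} [Ring R] [Algebra K R]

/-- The `K`-dual of a left module, with left action through the character `χ` and right action
by transposition. -/
def CharDual (_χ : R →ₐ[K] K) (X : Type*) [AddCommGroup X] [Module K X] : Type _ := X →ₗ[K] K

namespace CharDual

variable (χ : R →ₐ[K] K) (X : Type*) [AddCommGroup X] [Module K X]

noncomputable instance : AddCommGroup (CharDual χ X) := inferInstanceAs (AddCommGroup (X →ₗ[K] K))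

noncomputable instance : Module K (CharDual χ X) := inferInstanceAs (Module K (X →ₗ[K] K))

variable {χ X} in
/-- The underlying functional. -/
def un (ψ : CharDual χ X) : X →ₗ[K] K := ψ

variable {X} in
/-- A functional as an element of the dual bimodule. -/
def mk (ψ : X →ₗ[K] K) : CharDual χ X := ψ

noncomputable instance : Module R (CharDual χ X) := Module.compHom _ χ.toRingHom

variable [Module R X] [IsScalarTower K R X]

noncomputable instance : Module Rᵐᵒᵖ (CharDual χ X) where
  smul b ψ := mk χ (ψ.un ∘ₗ Algebra.lsmul K K X b.unop)
  one_smul ψ := LinearMap.ext fun x => by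
    change ψ.un ((1 : R) • x) = ψ.un x
    rw [one_smul]
  mul_smul a b ψ := LinearMap.ext fun x => by
    change ψ.un ((b.unop * a.unop) • x) = ψ.un (b.unop • a.unop • x)
    rw [mul_smul]
  smul_zero _ := rfl
  smul_add _ _ _ := rfl
  add_smul a b ψ := LinearMap.ext fun x => by
    change ψ.un ((a.unop + b.unop) • x) = ψ.un (a.unop • x) + ψ.un (b.unop • x)
    rw [add_smul, map_add]
  zero_smul ψ := LinearMap.ext fun x => by
    change ψ.un ((0 : R) • x) = 0
    rw [zero_smul, map_zero]

instance : SMulCommClass R Rᵐᵒᵖ (CharDual χ X) where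
  smul_comm _ _ _ := rfl

instance : IsScalarTower K R (CharDual χ X) where
  smul_assoc c a ψ := by
    change (χ (c • a)) • ψ = c • χ a • ψ
    rw [map_smul, smul_assoc]

instance : IsScalarTower K Rᵐᵒᵖ (CharDual χ X) where
  smul_assoc c a ψ := LinearMap.ext fun x => by
    change ψ.un ((c • a.unop) • x) = c • ψ.un (a.unop • x)
    rw [smul_assoc, map_smul]

noncomputable instance : Module (R ⊗[K] Rᵐᵒᵖ) (CharDual χ X) := TensorProduct.Algebra.module

variable {χ X}

theorem tmul_smul_apply (a : R) (b : Rᵐᵒᵖ) (ψ : CharDual χ X) (x : X) :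
    ((a ⊗ₜ[K] b) • ψ).un x = χ a * ψ.un (b.unop • x) := rfl

instance : IsScalarTower K (R ⊗[K] Rᵐᵒᵖ) (CharDual χ X) where
  smul_assoc c l ψ := by
    induction l using TensorProduct.induction_on with
    | zero =>
      have h : (0 : R ⊗[K] Rᵐᵒᵖ) • ψ = 0 := zero_smul (R ⊗[K] Rᵐᵒᵖ) ψ
      rw [smul_zero]
      exact h.trans ((smul_zero c).symm.trans (congrArg (c • ·) h.symm))
    | tmul a b =>
      refine LinearMap.ext fun x => ?_
      change χ (c • a) * ψ.un (b.unop • x) = c • (χ a * ψ.un (b.unop • x))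
      rw [map_smul, smul_mul_assoc]
    | add x y hx hy => rw [smul_add, add_smul, add_smul, hx, hy, smul_add]

/-- Two additive maps commuting with the pure tensors are linear over the enveloping algebra. -/
theorem smul_of_tmul {M N : Type*} [AddCommGroup M] [Module (R ⊗[K] Rᵐᵒᵖ) M] [AddCommGroup N]
    [Module (R ⊗[K] Rᵐᵒᵖ) N] (f : M →+ N)
    (h : ∀ (a : R) (b : Rᵐᵒᵖ) m, f ((a ⊗ₜ[K] b) • m) = (a ⊗ₜ[K] b) • f m)
    (l : R ⊗[K] Rᵐᵒᵖ) (m : M) : f (l • m) = l • f m := by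
  induction l using TensorProduct.induction_on with
  | zero =>
    have h1 : (0 : R ⊗[K] Rᵐᵒᵖ) • m = 0 := zero_smul (R ⊗[K] Rᵐᵒᵖ) m
    have h2 : (0 : R ⊗[K] Rᵐᵒᵖ) • f m = 0 := zero_smul (R ⊗[K] Rᵐᵒᵖ) (f m)
    exact (congrArg f h1).trans ((map_zero f).trans h2.symm)
  | tmul a b => exact h a b m
  | add x y hx hy => rw [add_smul, map_add, hx, hy, add_smul]

variable {Y : Type*} [AddCommGroup Y] [Module K Y] [Module R Y] [IsScalarTower K R Y]

variable (χ) in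
/-- The dual bimodule is contravariant in the module. -/
def map (f : X →ₗ[R] Y) : CharDual χ Y →ₗ[R ⊗[K] Rᵐᵒᵖ] CharDual χ X where
  toFun ψ := mk χ (ψ.un ∘ₗ f.restrictScalars K)
  map_add' _ _ := rfl
  map_smul' l ψ := smul_of_tmul (M := CharDual χ Y) (N := CharDual χ X)
    (⟨⟨fun ψ => mk χ (ψ.un ∘ₗ f.restrictScalars K), rfl⟩, fun _ _ => rfl⟩) (fun a b ψ =>
      LinearMap.ext fun x => by
        change χ a * ψ.un (b.unop • f x) = χ a * ψ.un (f (b.unop • x))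
        rw [f.map_smul]) l ψ

theorem map_injective {f : X →ₗ[R] Y} (hf : Function.Surjective f) :
    Function.Injective (map χ f) := fun ψ φ h => LinearMap.ext fun y => by
  obtain ⟨x, rfl⟩ := hf y
  exact LinearMap.congr_fun h x

theorem map_surjective {f : X →ₗ[R] Y} (hf : Function.Injective f) :
    Function.Surjective (map χ f) := fun ψ => by
  obtain ⟨g, hg⟩ := LinearMap.exists_leftInverse_of_injective (f.restrictScalars K)
    (LinearMap.ker_eq_bot.mpr hf)
  refine ⟨mk χ (ψ.un ∘ₗ g), LinearMap.ext fun x => ?_⟩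
  change ψ.un (g (f x)) = ψ.un x
  exact congrArg ψ.un (LinearMap.congr_fun hg x)

theorem map_exact {Z : Type*} [AddCommGroup Z] [Module K Z] [Module R Z] [IsScalarTower K R Z]
    {f : X →ₗ[R] Y} {g : Y →ₗ[R] Z} (hg : Function.Surjective g)
    (h : ∀ y, g y = 0 → ∃ x, f x = y) (ψ : CharDual χ Y) (hψ : map χ f ψ = 0) :
    ∃ φ, map χ g φ = ψ := by
  obtain ⟨σ, hσ⟩ := LinearMap.exists_rightInverse_of_surjective (g.restrictScalars K)
    (LinearMap.range_eq_top.mpr hg)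
  refine ⟨mk χ (ψ.un ∘ₗ σ), LinearMap.ext fun y => ?_⟩
  change ψ.un (σ (g y)) = ψ.un y
  have e : g (σ (g y)) = g y := LinearMap.congr_fun hσ (g y)
  obtain ⟨x, hx⟩ := h (σ (g y) - y) (by rw [map_sub, e, sub_self])
  have e2 : ψ.un (f x) = 0 := LinearMap.congr_fun hψ x
  rw [← sub_eq_zero, ← map_sub, ← hx, e2]

end CharDual

/-- Semilinear functionals for the character `χ`. -/
def charHom (χ : R →ₐ[K] K) (X : Type*) [AddCommGroup X] [Module K X] [Module R X] :
    Submodule K (X →ₗ[K] K) where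
  carrier := {ψ | ∀ (a : R) x, ψ (a • x) = χ a * ψ x}
  add_mem' {ψ φ} h h' a x := by
    change ψ (a • x) + φ (a • x) = χ a * (ψ x + φ x)
    rw [h, h', mul_add]
  zero_mem' a x := by
    change (0 : K) = χ a * 0
    rw [mul_zero]
  smul_mem' c ψ h a x := by
    change c * ψ (a • x) = χ a * (c * ψ x)
    rw [h, mul_left_comm]

end DualBimodule

section Contraction

variable {K : Type u} [Field K] {R : Type u} [Ring R] [Algebra K R]

/-- Restriction of a bimodule to a left module. -/
@[reducible] def leftMod (R : Type u) [Ring R] [Algebra K R] (M : Type*) [AddCommGroup M]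
    [Module (R ⊗[K] Rᵐᵒᵖ) M] : Module R M :=
  Module.compHom M (Algebra.TensorProduct.includeLeftRingHom : R →+* R ⊗[K] Rᵐᵒᵖ)

theorem projective_left (M : Type u) [AddCommGroup M] [Module (R ⊗[K] Rᵐᵒᵖ) M]
    [Module.Projective (R ⊗[K] Rᵐᵒᵖ) M] :
    letI := leftMod (K := K) R M
    Module.Projective R M := by
  let := leftMod (K := K) R M
  obtain ⟨σ, hσ⟩ := Module.projective_def'.1
    (inferInstance : Module.Projective (R ⊗[K] Rᵐᵒᵖ) M)
  have ht : ∀ (a : R) (l : R ⊗[K] Rᵐᵒᵖ), (a ⊗ₜ[K] (1 : Rᵐᵒᵖ)) * l = a • l := fun a l => by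
    induction l using TensorProduct.induction_on with
    | zero => simp
    | tmul x y => simp [TensorProduct.smul_tmul']
    | add x y hx hy => rw [mul_add, hx, hy, smul_add]
  refine Module.Projective.of_split (M := M →₀ R ⊗[K] Rᵐᵒᵖ)
    { toFun := σ
      map_add' := σ.map_add
      map_smul' := fun a x => ?_ }
    { toFun := Finsupp.linearCombination (R ⊗[K] Rᵐᵒᵖ) id
      map_add' := map_add _
      map_smul' := fun a x => ?_ } ?_
  · change σ ((a ⊗ₜ[K] (1 : Rᵐᵒᵖ)) • x) = a • σ x
    rw [map_smul]
    ext y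
    exact ht a _
  · change _ = (a ⊗ₜ[K] (1 : Rᵐᵒᵖ)) • (Finsupp.linearCombination (R ⊗[K] Rᵐᵒᵖ) (id : M → M) x)
    rw [← map_smul]
    congr 1
    ext y
    exact (ht a _).symm
  · ext x
    exact LinearMap.congr_fun hσ x

variable [Module (R ⊗[K] Rᵐᵒᵖ) R] (res : ProjRes (R ⊗[K] Rᵐᵒᵖ) R)

/-- A bimodule resolution of `R` is contractible as a complex of left modules. -/
theorem exists_contraction (hR : ∀ (a b r : R), (a ⊗ₜ[K] MulOpposite.op b) • r = a * r * b)
    (p : ℕ) : ∃ σ : res.Q p →+ res.Q (p + 1),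
      (∀ (a : R) q, σ ((a ⊗ₜ[K] (1 : Rᵐᵒᵖ)) • q) = (a ⊗ₜ[K] (1 : Rᵐᵒᵖ)) • σ q) ∧
      ∀ q, res.d p (σ (res.d p q)) = res.d p q := by
  have := res.proj
  let : ∀ n, Module R (res.Q n) := fun n => leftMod (K := K) R (res.Q n)
  have hp : ∀ n, Module.Projective R (res.Q n) := fun n => projective_left (K := K) (res.Q n)
  let dR : ∀ n, res.Q (n + 1) →ₗ[R] res.Q n := fun n =>
    { toFun := res.d n, map_add' := map_add _, map_smul' := fun a x => (res.d n).map_smul _ x }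
  -- a left linear idempotent-like map onto the kernel gives the next contraction
  have key : ∀ n (π : res.Q n →ₗ[R] res.Q n), (∀ q, ∃ y, res.d n y = π q) →
      (∀ y, π (res.d n y) = res.d n y) → ∃ σ : res.Q n →ₗ[R] res.Q (n + 1),
        ∀ q, res.d n (σ (res.d n q)) = res.d n q := by
    intro n π h1 h2
    obtain ⟨σ, hσ⟩ := Module.projective_lifting_property
      ((dR n).rangeRestrict) (π.codRestrict (LinearMap.range (dR n)) h1)
      (LinearMap.surjective_rangeRestrict _)
    refine ⟨σ, fun q => ?_⟩
    have := congrArg Subtype.val (LinearMap.congr_fun hσ (res.d n q))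
    exact this.trans (h2 q)
  have main : ∃ σ : res.Q p →ₗ[R] res.Q (p + 1), ∀ q, res.d p (σ (res.d p q)) = res.d p q := by
    induction p with
    | zero =>
      obtain ⟨q0, hq0⟩ := res.surj 1
      have hε : ∀ (a : R) q, res.ε ((a ⊗ₜ[K] (1 : Rᵐᵒᵖ)) • q) = a * res.ε q := fun a q => by
        rw [map_smul]
        exact (hR a 1 _).trans (mul_one _)
      let π : res.Q 0 →ₗ[R] res.Q 0 :=
        { toFun := fun q => (res.ε q ⊗ₜ[K] (1 : Rᵐᵒᵖ)) • q0
          map_add' := fun x y => by rw [map_add, TensorProduct.add_tmul, add_smul]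
          map_smul' := fun a x => by
            change (res.ε ((a ⊗ₜ[K] (1 : Rᵐᵒᵖ)) • x) ⊗ₜ[K] (1 : Rᵐᵒᵖ)) • q0 =
              (a ⊗ₜ[K] (1 : Rᵐᵒᵖ)) • (res.ε x ⊗ₜ[K] (1 : Rᵐᵒᵖ)) • q0
            rw [hε, smul_smul, Algebra.TensorProduct.tmul_mul_tmul, one_mul] }
      refine key 0 (LinearMap.id - π) (fun q => ?_) fun y => ?_
      · have : q - (res.ε q ⊗ₜ[K] (1 : Rᵐᵒᵖ)) • q0 ∈ LinearMap.ker res.ε := by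
          rw [LinearMap.mem_ker, map_sub, hε, hq0, mul_one, sub_self]
        rw [← res.exact₀] at this
        exact this
      · have : res.d 0 y ∈ LinearMap.ker res.ε := res.exact₀ ▸ LinearMap.mem_range_self _ y
        rw [LinearMap.mem_ker] at this
        change res.d 0 y - (res.ε (res.d 0 y) ⊗ₜ[K] (1 : Rᵐᵒᵖ)) • q0 = _
        rw [this, TensorProduct.zero_tmul]
        exact (congrArg (res.d 0 y - ·) (zero_smul (R ⊗[K] Rᵐᵒᵖ) q0)).trans (sub_zero _)
    | succ n ih =>
      obtain ⟨σ, hσ⟩ := ih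
      refine key (n + 1) (LinearMap.id - σ ∘ₗ dR n) (fun q => ?_) fun y => ?_
      · have : q - σ (res.d n q) ∈ LinearMap.ker (res.d n) := by
          rw [LinearMap.mem_ker, map_sub, hσ, sub_self]
        rw [← res.exact n] at this
        exact this
      · change res.d (n + 1) y - σ (res.d n (res.d (n + 1) y)) = _
        rw [res.d_comp, map_zero, sub_zero]
  obtain ⟨σ, hσ⟩ := main
  exact ⟨σ.toAddMonoidHom, fun a q => σ.map_smul a q, hσ⟩

variable (χ : R →ₐ[K] K) (X : Type*) [AddCommGroup X] [Module K X] [Module R X]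
  [IsScalarTower K R X]

/-- Dual bimodules of projective modules are acyclic. -/
theorem cocycles_le_coboundaries_of_projective [Module.Projective R X]
    (hR : ∀ (a b r : R), (a ⊗ₜ[K] MulOpposite.op b) • r = a * r * b) (p : ℕ) :
    res.cocycles K (CharDual χ X) (p + 1) ≤ res.coboundaries K (CharDual χ X) (p + 1) := by
  intro f hf
  rw [ProjRes.mem_cocycles] at hf
  obtain ⟨σ, hσa, hσ⟩ := exists_contraction res hR p
  obtain ⟨sec, hsec⟩ := Module.projective_def'.1 (inferInstance : Module.Projective R X)
  have hsec' : ∀ x, ((sec x).sum fun u r => r • u) = x := fun x => LinearMap.congr_fun hsec x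
  -- `f` is unchanged by the contraction
  have hfσ : ∀ q, f (σ (res.d p q)) = f q := fun q => by
    have : σ (res.d p q) - q ∈ LinearMap.ker (res.d p) := by
      rw [LinearMap.mem_ker, map_sub, hσ, sub_self]
    rw [← res.exact p] at this
    obtain ⟨y, hy⟩ := this
    rw [← sub_eq_zero, ← map_sub, ← hy, hf]
  let w : res.Q p → X → R →+ K := fun q u =>
    { toFun := fun r => (f (σ (((1 : R) ⊗ₜ[K] MulOpposite.op r) • q))).un u
      map_zero' := by
        rw [MulOpposite.op_zero, TensorProduct.tmul_zero]
        refine (congrArg (fun z => (f (σ z)).un u) (zero_smul (R ⊗[K] Rᵐᵒᵖ) q)).trans ?_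
        rw [map_zero, map_zero]; rfl
      map_add' := fun a b => by
        rw [MulOpposite.op_add, TensorProduct.tmul_add, add_smul, map_add, map_add]; rfl }
  have hwk : ∀ q u (c : K) r, w q u (c • r) = c • w q u r := fun q u c r => by
    change (f (σ (((1 : R) ⊗ₜ[K] MulOpposite.op (c • r)) • q))).un u = _
    have e : ((1 : R) ⊗ₜ[K] MulOpposite.op (c • r)) =
        (algebraMap K R c ⊗ₜ[K] (1 : Rᵐᵒᵖ)) * ((1 : R) ⊗ₜ[K] MulOpposite.op r) := by
      rw [Algebra.TensorProduct.tmul_mul_tmul, mul_one, one_mul, MulOpposite.op_smul,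
        TensorProduct.tmul_smul, TensorProduct.smul_tmul', Algebra.algebraMap_eq_smul_one]
    rw [e, mul_smul, hσa, map_smul, CharDual.tmul_smul_apply, AlgHom.commutes]
    change c * _ = c * _
    rw [MulOpposite.unop_one, one_smul]
    rfl
  have hwa : ∀ q q' u r, w (q + q') u r = w q u r + w q' u r := fun q q' u r => by
    change (f (σ (((1 : R) ⊗ₜ[K] MulOpposite.op r) • (q + q')))).un u = _
    rw [smul_add, map_add, map_add]; rfl
  have hwl : ∀ (a : R) (b : Rᵐᵒᵖ) q u r, w ((a ⊗ₜ[K] b) • q) u r = χ a * w q u (b.unop * r) :=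
    fun a b q u r => by
      change (f (σ (((1 : R) ⊗ₜ[K] MulOpposite.op r) • (a ⊗ₜ[K] b) • q))).un u = _
      have e : ((1 : R) ⊗ₜ[K] MulOpposite.op r) * (a ⊗ₜ[K] b) =
          (a ⊗ₜ[K] (1 : Rᵐᵒᵖ)) * ((1 : R) ⊗ₜ[K] MulOpposite.op (b.unop * r)) := by
        simp
      rw [smul_smul, e, mul_smul, hσa, map_smul, CharDual.tmul_smul_apply, MulOpposite.unop_one,
        one_smul]
      rfl
  have hsk : ∀ (c : K) x, sec (c • x) = c • sec x := fun c x => sec.map_smul_of_tower c x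
  let φ : res.Q p →+ CharDual χ X :=
    { toFun := fun q => CharDual.mk χ
        { toFun := fun x => (sec x).sum fun u r => w q u r
          map_add' := fun x y => by
            rw [map_add, Finsupp.sum_add_index' (fun u => map_zero _) (fun u => map_add _)]
          map_smul' := fun c x => by
            rw [hsk, Finsupp.sum_smul_index' (fun u => map_zero _), RingHom.id_apply,
              Finsupp.smul_sum]
            simp only [hwk] }
      map_zero' := LinearMap.ext fun x => by
        change ((sec x).sum fun u r => w 0 u r) = 0
        refine Finset.sum_eq_zero fun u _ => ?_
        have := hwa 0 0 u (sec x u)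
        rw [add_zero] at this
        exact left_eq_add.1 this
      map_add' := fun q q' => LinearMap.ext fun x => by
        change ((sec x).sum fun u r => w (q + q') u r) =
          ((sec x).sum fun u r => w q u r) + ((sec x).sum fun u r => w q' u r)
        simp only [hwa, Finsupp.sum_add] }
  let g : res.Q p →ₗ[R ⊗[K] Rᵐᵒᵖ] CharDual χ X :=
    { toFun := φ
      map_add' := map_add φ
      map_smul' := fun l q => CharDual.smul_of_tmul φ (fun a b q => LinearMap.ext fun x => by
        change ((sec x).sum fun u r => w ((a ⊗ₜ[K] b) • q) u r) =
          χ a * ((sec (b.unop • x)).sum fun u r => w q u r)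
        rw [map_smul, Finsupp.sum_smul_index' (fun u => map_zero _), Finsupp.mul_sum]
        simp only [hwl, smul_eq_mul]) l q }
  refine ⟨g, LinearMap.ext fun q => LinearMap.ext fun x => ?_⟩
  change ((sec x).sum fun u r => (f (σ (((1 : R) ⊗ₜ[K] MulOpposite.op r) • res.d p q))).un u) =
    (f q).un x
  have e : ∀ u (r : R), (f (σ (((1 : R) ⊗ₜ[K] MulOpposite.op r) • res.d p q))).un u =
      (f q).un (r • u) := fun u r => by
    rw [← map_smul, hfσ, map_smul, CharDual.tmul_smul_apply, map_one, one_mul,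
      MulOpposite.unop_op]
  simp only [e]
  rw [Finsupp.sum, ← map_sum]
  exact congrArg _ (hsec' x)

end Contraction

section LeftResolution

variable {K : Type u} [Field K] {R : Type u} [Ring R] [Algebra K R]
  (χ : R →ₐ[K] K)

theorem mem_charHom {X : Type*} [AddCommGroup X] [Module K X] [Module R X] {ψ : X →ₗ[K] K} :
    ψ ∈ charHom χ X ↔ ∀ (a : R) x, ψ (a • x) = χ a * ψ x := Iff.rfl

variable [Module (R ⊗[K] Rᵐᵒᵖ) R] (res : ProjRes (R ⊗[K] Rᵐᵒᵖ) R)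

/-- The degree zero cocycle attached to a semilinear functional. -/
noncomputable def cocycleOf (hR : ∀ (a b r : R), (a ⊗ₜ[K] MulOpposite.op b) • r = a * r * b)
    (X : Type*) [AddCommGroup X] [Module K X] [Module R X] [IsScalarTower K R X] :
    charHom χ X →ₗ[K] res.Q 0 →ₗ[R ⊗[K] Rᵐᵒᵖ] CharDual χ X where
  toFun ψ :=
    let φ : res.Q 0 →+ CharDual χ X :=
      { toFun := fun q => CharDual.mk χ (ψ.1 ∘ₗ Algebra.lsmul K K X (res.ε q))
        map_zero' := LinearMap.ext fun x => by
          change ψ.1 (res.ε 0 • x) = 0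
          rw [map_zero, zero_smul, map_zero]
        map_add' := fun q q' => LinearMap.ext fun x => by
          change ψ.1 (res.ε (q + q') • x) = ψ.1 (res.ε q • x) + ψ.1 (res.ε q' • x)
          rw [map_add, add_smul, map_add] }
    { toFun := φ
      map_add' := map_add φ
      map_smul' := fun l q => CharDual.smul_of_tmul φ (fun a b q => LinearMap.ext fun x => by
        change ψ.1 (res.ε ((a ⊗ₜ[K] b) • q) • x) = χ a * ψ.1 (res.ε q • b.unop • x)
        have e : (a ⊗ₜ[K] b) • res.ε q = a * res.ε q * b.unop := hR a b.unop _
        rw [res.ε.map_smul, e, mul_assoc, mul_smul, (mem_charHom χ).1 ψ.2, mul_smul]) l q }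
  map_add' _ _ := rfl
  map_smul' _ _ := rfl

variable (hR : ∀ (a b r : R), (a ⊗ₜ[K] MulOpposite.op b) • r = a * r * b)
  {X : Type u} [AddCommGroup X] [Module K X] [Module R X] [IsScalarTower K R X]

theorem cocycleOf_apply (ψ : charHom χ X) (q : res.Q 0) (x : X) :
    (cocycleOf χ res hR X ψ q).un x = ψ.1 (res.ε q • x) := rfl

theorem exists_cocycleOf {f : res.Q 0 →ₗ[R ⊗[K] Rᵐᵒᵖ] CharDual χ X}
    (hf : f ∈ res.cocycles K (CharDual χ X) 0) : ∃ ψ, cocycleOf χ res hR X ψ = f := by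
  rw [ProjRes.mem_cocycles] at hf
  obtain ⟨q0, hq0⟩ := res.surj 1
  have h1 : ∀ q q', res.ε q = res.ε q' → f q = f q' := fun q q' h => by
    have : q - q' ∈ LinearMap.ker res.ε := by rw [LinearMap.mem_ker, map_sub, h, sub_self]
    rw [← res.exact₀] at this
    obtain ⟨y, hy⟩ := this
    rw [← sub_eq_zero, ← map_sub, ← hy, hf]
  have h2 : ∀ (r : R) q x, res.ε q = r → (f q).un x = (f q0).un (r • x) := fun r q x h => by
    rw [h1 q (((1 : R) ⊗ₜ[K] MulOpposite.op r) • q0) (by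
      rw [h, map_smul, hq0, hR, one_mul, one_mul]), map_smul, CharDual.tmul_smul_apply, map_one,
      one_mul, MulOpposite.unop_op]
  refine ⟨⟨(f q0).un, fun a x => ?_⟩, ?_⟩
  · obtain ⟨q, hq⟩ := res.surj a
    rw [← h2 a q x hq, h1 q ((a ⊗ₜ[K] MulOpposite.op (1 : R)) • q0) (by
      rw [hq, map_smul, hq0, hR, mul_one, mul_one]), map_smul, CharDual.tmul_smul_apply,
      MulOpposite.unop_op, one_smul]
  · refine LinearMap.ext fun q => LinearMap.ext fun x => ?_
    exact (h2 _ q x rfl).symm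

theorem cocycleOf_mem (ψ : charHom χ X) :
    cocycleOf χ res hR X ψ ∈ res.cocycles K (CharDual χ X) 0 := by
  rw [ProjRes.mem_cocycles]
  intro y
  have : res.d 0 y ∈ LinearMap.ker res.ε := res.exact₀ ▸ LinearMap.mem_range_self _ y
  rw [LinearMap.mem_ker] at this
  refine LinearMap.ext fun x => ?_
  change ψ.1 (res.ε (res.d 0 y) • x) = 0
  rw [this, zero_smul, map_zero]

theorem cocycleOf_injective : Function.Injective (cocycleOf χ res hR X) := fun ψ φ h => by
  obtain ⟨q0, hq0⟩ := res.surj 1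
  refine Subtype.ext (LinearMap.ext fun x => ?_)
  have := congrArg (fun f : res.Q 0 →ₗ[R ⊗[K] Rᵐᵒᵖ] CharDual χ X => (f q0).un x) h
  simpa only [cocycleOf_apply, hq0, one_smul] using this

/-- The zeroth cohomology with coefficients in a dual bimodule. -/
theorem nonempty_ext_zero (hR : ∀ (a b r : R), (a ⊗ₜ[K] MulOpposite.op b) • r = a * r * b) :
    Nonempty (res.ext K (CharDual χ X) 0 ≃ₗ[K] charHom χ X) := by
  refine ⟨(res.extZero K _).trans (LinearEquiv.ofBijective
    ((cocycleOf χ res hR X).codRestrict _ (cocycleOf_mem χ res hR)) ⟨fun ψ φ h => ?_, ?_⟩).symm⟩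
  · exact cocycleOf_injective χ res hR (congrArg Subtype.val h)
  · rintro ⟨f, hf⟩
    obtain ⟨ψ, rfl⟩ := exists_cocycleOf χ res hR hf
    exact ⟨ψ, rfl⟩

/-- The resolution of the first syzygy. -/
def ProjRes.shift (P : ProjRes R X) : ProjRes R (LinearMap.ker P.ε) where
  Q n := P.Q (n + 1)
  proj n := P.proj (n + 1)
  d n := P.d (n + 1)
  ε := (P.d 0).codRestrict _ fun y => P.exact₀ ▸ LinearMap.mem_range_self _ y
  surj := by
    rintro ⟨x, hx⟩
    have hx' : x ∈ LinearMap.range (P.d 0) := P.exact₀ ▸ hx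
    obtain ⟨y, hy⟩ := hx'
    exact ⟨y, Subtype.ext hy⟩
  exact₀ := by rw [LinearMap.ker_codRestrict]; exact P.exact 0
  exact n := P.exact (n + 1)

include hR in
/-- Cohomology with coefficients in the dual bimodule of `X`, computed from a projective
resolution of `X` whose differentials are killed by the functor `charHom χ`. -/
theorem nonempty_ext_equiv_charHom (t : ℕ) : ∀ (X : Type u) [AddCommGroup X] [Module K X]
    [Module R X] [IsScalarTower K R X] (P : ProjRes R X) [∀ n, Module K (P.Q n)]
    [∀ n, IsScalarTower K R (P.Q n)],
    (∀ n, ∀ ψ ∈ charHom χ (P.Q n), ∀ y, ψ (P.d n y) = 0) →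
    Nonempty (res.ext K (CharDual χ X) t ≃ₗ[K] charHom χ (P.Q t)) := by
  induction t with
  | zero =>
    intro X _ _ _ _ P _ _ hP
    obtain ⟨e⟩ := nonempty_ext_zero χ res (X := X) hR
    let f : charHom χ X →ₗ[K] charHom χ (P.Q 0) :=
      { toFun := fun ψ => ⟨ψ.1 ∘ₗ P.ε.restrictScalars K, fun a x => by
          change ψ.1 (P.ε (a • x)) = χ a * ψ.1 (P.ε x)
          rw [map_smul]
          exact ψ.2 _ _⟩
        map_add' := fun _ _ => rfl
        map_smul' := fun _ _ => rfl }
    have hf : ∀ ψ x, (f ψ).1 x = ψ.1 (P.ε x) := fun _ _ => rfl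
    refine ⟨e.trans (LinearEquiv.ofBijective f ⟨fun ψ φ h => ?_, fun ψ => ?_⟩)⟩
    · refine Subtype.ext (LinearMap.ext fun x => ?_)
      obtain ⟨y, rfl⟩ := P.surj x
      rw [← hf, h, hf]
    · have h1 : CharDual.map χ (P.d 0) (CharDual.mk χ ψ.1) = 0 :=
        LinearMap.ext fun y => hP 0 ψ.1 ψ.2 y
      obtain ⟨φ, hφ⟩ := CharDual.map_exact (f := P.d 0) (g := P.ε) P.surj (fun y hy => by
        have : y ∈ LinearMap.ker P.ε := hy
        rw [← P.exact₀] at this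
        exact this) _ h1
      have h2 : ∀ y, φ.un (P.ε y) = ψ.1 y := fun y => LinearMap.congr_fun hφ y
      refine ⟨⟨φ.un, fun a x => ?_⟩, Subtype.ext (LinearMap.ext h2)⟩
      obtain ⟨y, rfl⟩ := P.surj x
      rw [← map_smul, h2, h2]
      exact ψ.2 a y
  | succ t ih =>
    intro X _ _ _ _ P iK iT hP
    obtain ⟨e⟩ := @ih (LinearMap.ker P.ε) _ _ _ _ P.shift (fun n => iK (n + 1))
      (fun n => iT (n + 1)) (fun n => hP (n + 1))
    have := P.proj 0
    obtain ⟨e'⟩ := res.nonempty_shift K (CharDual χ (P.Q 0)) (M' := CharDual χ X)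
      (M'' := CharDual χ (LinearMap.ker P.ε))
      (i := CharDual.map χ P.ε) (π := CharDual.map χ (LinearMap.ker P.ε).subtype)
      (CharDual.map_injective P.surj) (CharDual.map_surjective Subtype.val_injective)
      (fun ψ => LinearMap.ext fun x => by
        change ψ.un (P.ε x.1) = 0
        rw [LinearMap.mem_ker.1 x.2, map_zero])
      (CharDual.map_exact P.surj fun y hy => ⟨⟨y, hy⟩, rfl⟩) t
      (cocycles_le_coboundaries_of_projective res χ _ hR t) (fun f hf => by
        cases t with
        | zero =>
          refine ⟨0, Submodule.zero_mem _, ?_⟩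
          obtain ⟨ψ, rfl⟩ := exists_cocycleOf χ res hR hf
          refine LinearMap.ext fun q => LinearMap.ext fun x => ?_
          have hx : x.1 ∈ LinearMap.range (P.d 0) := by rw [P.exact₀]; exact x.2
          obtain ⟨y, hy⟩ := hx
          change ψ.1 (res.ε q • x.1) = 0
          rw [← hy, ← map_smul]
          exact hP 0 ψ.1 ψ.2 _
        | succ p =>
          exact ⟨f, cocycles_le_coboundaries_of_projective res χ _ hR p hf, rfl⟩)
    exact ⟨e'.trans e⟩

end LeftResolution

section SimpleBimodule

variable {K : Type u} [Field K] {R : Type u} [Ring R] [Algebra K R]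

/-- The one-dimensional left module given by a character. -/
def CharMod (_χ : R →ₐ[K] K) : Type u := K

namespace CharMod

variable (χ : R →ₐ[K] K)

noncomputable instance : AddCommGroup (CharMod χ) := inferInstanceAs (AddCommGroup K)

noncomputable instance : Module K (CharMod χ) := inferInstanceAs (Module K K)

noncomputable instance : Module R (CharMod χ) := Module.compHom K χ.toRingHom

/-- The generator. -/
def one : CharMod χ := (1 : K)

theorem smul_def (a : R) (x : CharMod χ) : a • x = χ a • x := rfl

theorem smul_one (x : CharMod χ) : (show K from x) • one χ = x := mul_one (show K from x)

instance : IsScalarTower K R (CharMod χ) where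
  smul_assoc c a x := by
    rw [smul_def, smul_def, map_smul, smul_assoc]

end CharMod

variable (χ χ' : R →ₐ[K] K)

/-- The one-dimensional bimodule attached to a pair of characters. -/
abbrev Simp : Type u := CharDual χ (CharMod χ')

/-- Evaluation at the generator. -/
noncomputable def Simp.eval : Simp χ χ' ≃ₗ[K] K where
  toFun ψ := ψ.un (CharMod.one χ')
  map_add' _ _ := rfl
  map_smul' _ _ := rfl
  invFun c := CharDual.mk χ (LinearMap.toSpanSingleton K K c)
  left_inv ψ := LinearMap.ext fun x => by
    change (show K from x) * ψ.un (CharMod.one χ') = ψ.un x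
    rw [← smul_eq_mul, ← map_smul, CharMod.smul_one]
  right_inv c := one_mul c

variable {χ χ'}

theorem Simp.eval_tmul_smul (a : R) (b : Rᵐᵒᵖ) (ψ : Simp χ χ') :
    Simp.eval χ χ' ((a ⊗ₜ[K] b) • ψ) = χ a * χ' b.unop * Simp.eval χ χ' ψ := by
  change χ a * ψ.un (b.unop • CharMod.one χ') = _
  rw [CharMod.smul_def, map_smul, smul_eq_mul, mul_assoc]
  rfl

theorem finrank_simp : Module.finrank K (Simp χ χ') = 1 := by
  rw [(Simp.eval χ χ').finrank_eq, Module.finrank_self]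

/-- The Jacobson radical kills one-dimensional bimodules. -/
theorem jacobson_smul_simp (l : R ⊗[K] Rᵐᵒᵖ)
    (hl : l ∈ (⊥ : Ideal (R ⊗[K] Rᵐᵒᵖ)).jacobson) (ψ : Simp χ χ') : l • ψ = 0 := by
  by_cases hψ : ψ = 0
  · rw [hψ, smul_zero]
  let I : Ideal (R ⊗[K] Rᵐᵒᵖ) := LinearMap.ker (LinearMap.toSpanSingleton (R ⊗[K] Rᵐᵒᵖ) _ ψ)
  have hI : ∀ x, x ∈ I ↔ x • ψ = 0 := fun x => Iff.rfl
  have hmax : I.IsMaximal := by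
    rw [Ideal.isMaximal_iff]
    refine ⟨fun h => hψ (by rw [hI, one_smul] at h; exact h), fun J x hIJ hxI hxJ => ?_⟩
    rw [hI] at hxI
    -- `x` acts on `ψ` by a nonzero scalar
    have hev : Simp.eval χ χ' (x • ψ) ≠ 0 := fun h => hxI ((Simp.eval χ χ').map_eq_zero_iff.1 h)
    set c := Simp.eval χ χ' ψ * (Simp.eval χ χ' (x • ψ))⁻¹ with hc
    have h1 : (1 : R ⊗[K] Rᵐᵒᵖ) - c • x ∈ I := by
      rw [hI, sub_smul, one_smul, smul_assoc]
      apply (Simp.eval χ χ').injective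
      rw [map_sub, map_smul, map_zero, hc, smul_eq_mul, mul_assoc, inv_mul_cancel₀ hev, mul_one,
        sub_self]
    have h2 : c • x ∈ J := by
      rw [← one_mul x, ← smul_mul_assoc]
      exact J.mul_mem_left _ hxJ
    have := J.add_mem (hIJ h1) h2
    rwa [sub_add_cancel] at this
  have : l ∈ I := (Ideal.mem_sInf.1 hl) ⟨bot_le, hmax⟩
  exact (hI l).1 this

variable [Module (R ⊗[K] Rᵐᵒᵖ) R] (res : ProjRes (R ⊗[K] Rᵐᵒᵖ) R)

theorem pre_simp_eq_zero (hmin : res.Minimal) (p : ℕ) : res.pre K (Simp χ χ') p = 0 := by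
  refine LinearMap.ext fun f => LinearMap.ext fun q => ?_
  change f (res.d p q) = 0
  have h : radSMul (R ⊗[K] Rᵐᵒᵖ) (res.Q p) ≤ LinearMap.ker f := by
    refine Submodule.span_le.2 ?_
    rintro _ ⟨r, hr, x, rfl⟩
    change f (r • x) = 0
    rw [map_smul, jacobson_smul_simp r hr]
  exact h (hmin p (LinearMap.mem_range_self _ q))

/-- Homomorphisms from the terms of the minimal resolution to the one-dimensional bimodules,
computed from a resolution of a one-dimensional left module. -/
theorem nonempty_hom_simp_equiv (hmin : res.Minimal)
    (hR : ∀ (a b r : R), (a ⊗ₜ[K] MulOpposite.op b) • r = a * r * b)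
    (P : ProjRes R (CharMod χ')) [∀ n, Module K (P.Q n)] [∀ n, IsScalarTower K R (P.Q n)]
    (hP : ∀ n, ∀ ψ ∈ charHom χ (P.Q n), ∀ y, ψ (P.d n y) = 0) (t : ℕ) :
    Nonempty ((res.Q t →ₗ[R ⊗[K] Rᵐᵒᵖ] Simp χ χ') ≃ₗ[K] charHom χ (P.Q t)) := by
  obtain ⟨e⟩ := res.nonempty_ext_equiv K (Simp χ χ') (pre_simp_eq_zero res hmin) t
  obtain ⟨e'⟩ := nonempty_ext_equiv_charHom χ res hR t (CharMod χ') P hP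
  exact ⟨e.symm.trans e'⟩

end SimpleBimodule

section Composition

variable {K : Type u} [Field K] {R : Type u} [Ring R] [Algebra K R]

/-- The part of a bimodule fixed by a pair of elements. -/
def fixed (K : Type u) [Field K] {R : Type u} [Ring R] [Algebra K R] (a b : R) (M : Type*)
    [AddCommGroup M] [Module K M] [Module (R ⊗[K] Rᵐᵒᵖ) M] [IsScalarTower K (R ⊗[K] Rᵐᵒᵖ) M] :
    Submodule K M where
  carrier := {m | (a ⊗ₜ[K] MulOpposite.op b) • m = m}
  add_mem' {x y} hx hy := by
    change (a ⊗ₜ[K] MulOpposite.op b) • (x + y) = x + y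
    exact (smul_add _ x y).trans (congrArg₂ _ hx hy)
  zero_mem' := smul_zero _
  smul_mem' c x hx := by
    change (a ⊗ₜ[K] MulOpposite.op b) • (c • x) = c • x
    have hx' : (a ⊗ₜ[K] MulOpposite.op b) • x = x := hx
    rw [smul_comm, hx']

variable {M : Type u} [AddCommGroup M] [Module K M] [Module (R ⊗[K] Rᵐᵒᵖ) M]
  [IsScalarTower K (R ⊗[K] Rᵐᵒᵖ) M]

theorem mem_fixed {a b : R} {m : M} :
    m ∈ fixed K a b M ↔ (a ⊗ₜ[K] MulOpposite.op b) • m = m := Iff.rfl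

theorem finrank_fixed_add {M' M'' : Type u} [AddCommGroup M'] [Module K M']
    [Module (R ⊗[K] Rᵐᵒᵖ) M'] [IsScalarTower K (R ⊗[K] Rᵐᵒᵖ) M'] [AddCommGroup M'']
    [Module K M''] [Module (R ⊗[K] Rᵐᵒᵖ) M''] [IsScalarTower K (R ⊗[K] Rᵐᵒᵖ) M'']
    [Module.Finite K M] {i : M' →ₗ[R ⊗[K] Rᵐᵒᵖ] M} {π : M →ₗ[R ⊗[K] Rᵐᵒᵖ] M''}
    (hi : Function.Injective i) (hπ : Function.Surjective π) (h0 : ∀ y, π (i y) = 0)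
    (hex : ∀ x, π x = 0 → ∃ y, i y = x) {a b : R} (ha : a * a = a) (hb : b * b = b) :
    Module.finrank K (fixed K a b M) =
      Module.finrank K (fixed K a b M') + Module.finrank K (fixed K a b M'') := by
  have hid : (a ⊗ₜ[K] MulOpposite.op b) * (a ⊗ₜ[K] MulOpposite.op b) =
      a ⊗ₜ[K] MulOpposite.op b := by
    rw [Algebra.TensorProduct.tmul_mul_tmul, ha, ← MulOpposite.op_mul, hb]
  let f : fixed K a b M →ₗ[K] fixed K a b M'' :=
    (π.restrictScalars K).restrict fun x hx => by
      change (a ⊗ₜ[K] MulOpposite.op b) • π x = π x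
      rw [← map_smul, mem_fixed.1 hx]
  have hf : Function.Surjective f := by
    rintro ⟨z, hz⟩
    obtain ⟨x, rfl⟩ := hπ z
    refine ⟨⟨(a ⊗ₜ[K] MulOpposite.op b) • x, ?_⟩, Subtype.ext ?_⟩
    · rw [mem_fixed, smul_smul, hid]
    · change π ((a ⊗ₜ[K] MulOpposite.op b) • x) = π x
      rw [map_smul]
      exact hz
  let g : fixed K a b M' →ₗ[K] fixed K a b M :=
    (i.restrictScalars K).restrict fun x hx => by
      change (a ⊗ₜ[K] MulOpposite.op b) • i x = i x
      rw [← map_smul, mem_fixed.1 hx]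
  have hg : Function.Injective g := fun x y h => Subtype.ext (hi (congrArg Subtype.val h))
  have hgf : LinearMap.range g = LinearMap.ker f := by
    ext ⟨x, hx⟩
    constructor
    · rintro ⟨y, hy⟩
      rw [← hy]
      exact Subtype.ext (h0 y.1)
    · intro h
      obtain ⟨y, rfl⟩ := hex x (congrArg Subtype.val h)
      refine ⟨⟨y, hi ?_⟩, rfl⟩
      rw [map_smul]
      exact hx
  rw [← f.finrank_range_add_finrank_ker, LinearMap.range_eq_top.2 hf, finrank_top, ← hgf,
    LinearMap.finrank_range_of_inj hg, add_comm]

variable {ι : Type*} (χ : ι → R →ₐ[K] K) (e : ι → R)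

theorem finrank_fixed_simp [DecidableEq ι]
    (he : ∀ i j, χ i (e j) = if i = j then 1 else 0) (i j i' j' : ι) :
    Module.finrank K (fixed K (e i) (e j) (Simp (χ i') (χ j'))) =
      if i' = i ∧ j' = j then 1 else 0 := by
  have key : ∀ ψ : Simp (χ i') (χ j'), ψ ∈ fixed K (e i) (e j) (Simp (χ i') (χ j')) ↔
      (if i' = i ∧ j' = j then (1 : K) else 0) * Simp.eval _ _ ψ = Simp.eval _ _ ψ := by
    intro ψ
    rw [mem_fixed, ← (Simp.eval (χ i') (χ j')).injective.eq_iff, Simp.eval_tmul_smul, he,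
      MulOpposite.unop_op, he]
    split_ifs <;> simp_all
  split_ifs with h
  · have : fixed K (e i) (e j) (Simp (χ i') (χ j')) = ⊤ := by
      rw [eq_top_iff]
      intro ψ _
      rw [key, if_pos h, one_mul]
    rw [this, finrank_top, finrank_simp]
  · have : fixed K (e i) (e j) (Simp (χ i') (χ j')) = ⊥ := by
      rw [eq_bot_iff]
      intro ψ hψ
      rw [key, if_neg h, zero_mul] at hψ
      exact (Simp.eval _ _).map_eq_zero_iff.1 hψ.symm
    rw [this, finrank_bot]

/-- A common eigenvector of a bimodule spans a one-dimensional subbimodule. -/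
noncomputable def simpToOfEigen {χ χ' : R →ₐ[K] K} {w : M}
    (hw : ∀ a b : R, (a ⊗ₜ[K] MulOpposite.op b) • w = (χ a * χ' b) • w) :
    Simp χ χ' →ₗ[R ⊗[K] Rᵐᵒᵖ] M :=
  let φ : Simp χ χ' →+ M := (LinearMap.toSpanSingleton K M w ∘ₗ
    (Simp.eval χ χ').toLinearMap).toAddMonoidHom
  { toFun := φ
    map_add' := map_add φ
    map_smul' := fun l ψ => CharDual.smul_of_tmul φ (fun a b ψ => by
      change Simp.eval χ χ' ((a ⊗ₜ[K] b) • ψ) • w = (a ⊗ₜ[K] b) • (Simp.eval χ χ' ψ • w)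
      rw [Simp.eval_tmul_smul, smul_comm, ← MulOpposite.op_unop b, hw, smul_smul, mul_comm]
      rfl) l ψ }

theorem simpToOfEigen_injective {χ χ' : R →ₐ[K] K} {w : M} (hw0 : w ≠ 0)
    (hw : ∀ a b : R, (a ⊗ₜ[K] MulOpposite.op b) • w = (χ a * χ' b) • w) :
    Function.Injective (simpToOfEigen hw) := by
  intro x y h
  have h' : Simp.eval χ χ' x • w = Simp.eval χ χ' y • w := h
  rw [← sub_eq_zero, ← sub_smul, smul_eq_zero, or_iff_left hw0, sub_eq_zero] at h'
  exact (Simp.eval χ χ').injective h'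

/-- Left and right modules have common eigenvectors. -/
structure HasEigenvectors : Prop where
  left : ∀ (V : Type u) [AddCommGroup V] [Module K V] [Nontrivial V]
    (ρ : R →ₐ[K] Module.End K V), ∃ i, ∃ w ≠ 0, ∀ a, ρ a w = χ i a • w
  right : ∀ (V : Type u) [AddCommGroup V] [Module K V] [Nontrivial V]
    (ρ : Rᵐᵒᵖ →ₐ[K] Module.End K V), ∃ i, ∃ w ≠ 0, ∀ a, ρ (MulOpposite.op a) w = χ i a • w

variable {χ} in
/-- Nonzero bimodules have common eigenvectors. -/
theorem HasEigenvectors.bimodule (hχ : HasEigenvectors χ) [Nontrivial M] :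
    ∃ i j, ∃ w : M, w ≠ 0 ∧
      ∀ a b : R, (a ⊗ₜ[K] MulOpposite.op b) • w = (χ i a * χ j b) • w := by
  let ρ : R ⊗[K] Rᵐᵒᵖ →ₐ[K] Module.End K M := Algebra.lsmul K K M
  obtain ⟨i, w0, hw0, h1⟩ := hχ.left M (ρ.comp Algebra.TensorProduct.includeLeft)
  let V : Submodule K M := ⨅ a : R, LinearMap.ker
    (ρ (a ⊗ₜ[K] (1 : Rᵐᵒᵖ)) - χ i a • LinearMap.id)
  have hV : ∀ m, m ∈ V ↔ ∀ a : R, (a ⊗ₜ[K] (1 : Rᵐᵒᵖ)) • m = χ i a • m := fun m => by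
    rw [Submodule.mem_iInf]
    refine forall_congr' fun a => ?_
    rw [LinearMap.mem_ker]
    exact sub_eq_zero
  have hst : ∀ b, ∀ m ∈ V, ρ ((1 : R) ⊗ₜ[K] b) m ∈ V := fun b m hm => by
    rw [hV] at hm ⊢
    intro a
    change (a ⊗ₜ[K] (1 : Rᵐᵒᵖ)) • ((1 : R) ⊗ₜ[K] b) • m = χ i a • ((1 : R) ⊗ₜ[K] b) • m
    rw [smul_comm (χ i a), ← hm a, smul_smul, smul_smul, Algebra.TensorProduct.tmul_mul_tmul,
      Algebra.TensorProduct.tmul_mul_tmul, mul_one, mul_one, one_mul, one_mul]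
  have : Nontrivial V := ⟨⟨⟨w0, (hV w0).2 h1⟩, 0, fun h => hw0 (congrArg Subtype.val h)⟩⟩
  let ρ' : Rᵐᵒᵖ →ₐ[K] Module.End K V := AlgHom.ofLinearMap
    { toFun := fun b => (ρ ((1 : R) ⊗ₜ[K] b)).restrict (hst b)
      map_add' := fun a b => by
        ext x
        change ((1 : R) ⊗ₜ[K] (a + b)) • x.1 = ((1 : R) ⊗ₜ[K] a) • x.1 + ((1 : R) ⊗ₜ[K] b) • x.1
        rw [TensorProduct.tmul_add, add_smul]
      map_smul' := fun c a => by
        ext x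
        change ((1 : R) ⊗ₜ[K] (c • a)) • x.1 = c • ((1 : R) ⊗ₜ[K] a) • x.1
        rw [TensorProduct.tmul_smul, smul_assoc] }
    (by
      ext x
      change ((1 : R) ⊗ₜ[K] (1 : Rᵐᵒᵖ)) • x.1 = x.1
      exact one_smul (R ⊗[K] Rᵐᵒᵖ) x.1)
    (fun a b => by
      ext x
      change ((1 : R) ⊗ₜ[K] (a * b)) • x.1 = ((1 : R) ⊗ₜ[K] a) • ((1 : R) ⊗ₜ[K] b) • x.1
      rw [smul_smul, Algebra.TensorProduct.tmul_mul_tmul, mul_one])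
  obtain ⟨j, w, hw, h2⟩ := hχ.right V ρ'
  refine ⟨i, j, w.1, fun h => hw (Subtype.ext h), fun a b => ?_⟩
  have e : (a ⊗ₜ[K] MulOpposite.op b) =
      (a ⊗ₜ[K] (1 : Rᵐᵒᵖ)) * ((1 : R) ⊗ₜ[K] MulOpposite.op b) := by
    rw [Algebra.TensorProduct.tmul_mul_tmul, mul_one, one_mul]
  have e2 : ((1 : R) ⊗ₜ[K] MulOpposite.op b) • w.1 = χ j b • w.1 := congrArg Subtype.val (h2 b)
  rw [e, mul_smul, e2, smul_comm, (hV _).1 w.2, smul_smul, mul_comm]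

/-- The dimension of `Hom(Q, M)` for projective `Q` in terms of composition factors. -/
theorem finrank_hom_eq_sum [Fintype ι] [DecidableEq ι] (hχ : HasEigenvectors χ)
    (he : ∀ i j, χ i (e j) = if i = j then 1 else 0) (hee : ∀ i, e i * e i = e i)
    (Q : Type u) [AddCommGroup Q] [Module (R ⊗[K] Rᵐᵒᵖ) Q] [Module.Projective (R ⊗[K] Rᵐᵒᵖ) Q]
    (hQ : ∀ i j, Module.Finite K (Q →ₗ[R ⊗[K] Rᵐᵒᵖ] Simp (χ i) (χ j))) (d : ℕ) :
    ∀ (M : Type u) [AddCommGroup M] [Module K M] [Module (R ⊗[K] Rᵐᵒᵖ) M]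
      [IsScalarTower K (R ⊗[K] Rᵐᵒᵖ) M] [Module.Finite K M], Module.finrank K M = d →
      Module.Finite K (Q →ₗ[R ⊗[K] Rᵐᵒᵖ] M) ∧
      Module.finrank K (Q →ₗ[R ⊗[K] Rᵐᵒᵖ] M) =
        ∑ i, ∑ j, Module.finrank K (fixed K (e i) (e j) M) *
          Module.finrank K (Q →ₗ[R ⊗[K] Rᵐᵒᵖ] Simp (χ i) (χ j)) := by
  induction d with
  | zero =>
    intro M _ _ _ _ _ hM
    have := Module.finrank_zero_iff.1 hM
    have h1 : Subsingleton (Q →ₗ[R ⊗[K] Rᵐᵒᵖ] M) :=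
      ⟨fun f g => LinearMap.ext fun x => Subsingleton.elim _ _⟩
    refine ⟨inferInstance, ?_⟩
    rw [Module.finrank_zero_of_subsingleton]
    refine (Finset.sum_eq_zero fun i _ => Finset.sum_eq_zero fun j _ => ?_).symm
    rw [Module.finrank_zero_of_subsingleton, zero_mul]
  | succ d ih =>
    intro M _ _ _ _ _ hM
    have : Nontrivial M := Module.nontrivial_of_finrank_pos (R := K) (by omega)
    obtain ⟨i, j, w, hw0, hw⟩ := hχ.bimodule (M := M)
    have hinj := simpToOfEigen_injective hw0 hw
    let N := LinearMap.range (simpToOfEigen hw)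
    have hfin : Module.finrank K (M ⧸ N) = d := by
      have h1 := Submodule.finrank_quotient_add_finrank (N.restrictScalars K)
      have h2 : Module.finrank K (N.restrictScalars K) = 1 := by
        rw [← finrank_simp (χ := χ i) (χ' := χ j)]
        exact (LinearEquiv.ofInjective ((simpToOfEigen hw).restrictScalars K)
          hinj).finrank_eq.symm
      have h3 : Module.finrank K (M ⧸ N.restrictScalars K) = Module.finrank K (M ⧸ N) := rfl
      omega
    have hfinite : Module.Finite K (M ⧸ N) :=
      inferInstanceAs (Module.Finite K (M ⧸ N.restrictScalars K))
    obtain ⟨f1, f2⟩ := ih (M ⧸ N) hfin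
    have h0 : ∀ y, N.mkQ (simpToOfEigen hw y) = 0 := fun y =>
      (Submodule.Quotient.mk_eq_zero N).2 (LinearMap.mem_range_self _ y)
    have hex : ∀ x, N.mkQ x = 0 → ∃ y, simpToOfEigen hw y = x := fun x hx =>
      (Submodule.Quotient.mk_eq_zero N).1 hx
    have := hQ i j
    obtain ⟨g1, g2⟩ := finrank_hom_add K (Q := Q) hinj N.mkQ_surjective h0 hex
    refine ⟨g1, ?_⟩
    rw [g2, f2]
    have h4 : ∀ i' j', Module.finrank K (fixed K (e i') (e j') M) =
        (if i = i' ∧ j = j' then 1 else 0) + Module.finrank K (fixed K (e i') (e j') (M ⧸ N)) :=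
      fun i' j' => by
        rw [finrank_fixed_add hinj N.mkQ_surjective h0 hex (hee i') (hee j'),
          finrank_fixed_simp χ e he]
    simp only [h4, add_mul, Finset.sum_add_distrib]
    congr 1
    rw [Finset.sum_eq_single i (fun i' _ hi' => by simp [Ne.symm hi']) (by simp),
      Finset.sum_eq_single j (fun j' _ hj' => by simp [Ne.symm hj']) (by simp)]
    simp

end Composition

section Arrows

variable (K : Type u) [Field K] (s : ℕ)

/-- Trivial paths, indexed by natural numbers. -/
noncomputable def eN (n : ℕ) : Alg K s := ee K s (n : ZMod (6 * s))

/-- The three kinds of arrows. -/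
inductive Kind : Type
  | a | b | g

/-- Whether there is an arrow of the given kind starting at `n`. -/
def Kind.IsSrc : Kind → ℕ → Prop
  | .a, n => n % 6 < 3
  | .b, n => n % 6 = 0 ∨ n % 6 = 3 ∨ n % 6 = 4
  | .g, n => n % 6 = 5

/-- The target of the arrow of the given kind starting at `n`. -/
def Kind.next : Kind → ℕ → ℕ
  | .a, n => if n % 6 = 2 then n + 3 else n + 1
  | .b, n => if n % 6 = 0 then n + 3 else n + 1
  | .g, n => n + 1

/-- The arrow of the given kind starting at `n`. -/
noncomputable def ar : Kind → ℕ → Alg K s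
  | .a, n => aN K s (3 * (n / 6) + n % 6)
  | .b, n => bN K s (3 * (n / 6) + (n % 6 - 2))
  | .g, n => gN K s (n / 6)

variable [NeZero s]

theorem natCast_eq_of_mod_mul {c : ℕ} {x y m : ℕ} (h : x = y + c * m) :
    ((x : ℕ) : ZMod c) = (y : ZMod c) := by
  rw [h]; push_cast; simp

omit [NeZero s] in
theorem aSrc_natCast (k : ℕ) : aSrc s (k : ZMod (3 * s)) = ((2 * k - k % 3 : ℕ) : ZMod (6 * s)) := by
  have h := Nat.mod_add_div k (3 * s)
  have h3 : k % (3 * s) % 3 = k % 3 := Nat.mod_mod_of_dvd _ (Dvd.intro _ rfl)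
  rw [aSrc, ZMod.val_natCast, h3]
  refine (natCast_eq_of_mod_mul (m := k / (3 * s)) ?_).symm
  have : k % 3 ≤ k % (3 * s) := h3 ▸ Nat.mod_le _ _
  have e : 6 * s * (k / (3 * s)) = 2 * (3 * s * (k / (3 * s))) := by ring
  omega

omit [NeZero s] in
theorem aTgt_natCast (k : ℕ) : aTgt s (k : ZMod (3 * s)) =
    ((if k % 3 = 1 then 2 * k else 2 * k + 1 : ℕ) : ZMod (6 * s)) := by
  have h := Nat.mod_add_div k (3 * s)
  have h3 : k % (3 * s) % 3 = k % 3 := Nat.mod_mod_of_dvd _ (Dvd.intro _ rfl)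
  rw [aTgt, ZMod.val_natCast, h3]
  have e : 6 * s * (k / (3 * s)) = 2 * (3 * s * (k / (3 * s))) := by ring
  split_ifs <;> refine (natCast_eq_of_mod_mul (m := k / (3 * s)) ?_).symm <;> omega

omit [NeZero s] in
theorem bSrc_natCast (k : ℕ) : bSrc s (k : ZMod (3 * s)) =
    ((if k % 3 = 1 then 2 * k + 1 else 2 * k : ℕ) : ZMod (6 * s)) := by
  have h := Nat.mod_add_div k (3 * s)
  have h3 : k % (3 * s) % 3 = k % 3 := Nat.mod_mod_of_dvd _ (Dvd.intro _ rfl)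
  rw [bSrc, ZMod.val_natCast, h3]
  have e : 6 * s * (k / (3 * s)) = 2 * (3 * s * (k / (3 * s))) := by ring
  split_ifs <;> refine (natCast_eq_of_mod_mul (m := k / (3 * s)) ?_).symm <;> omega

omit [NeZero s] in
theorem bTgt_natCast (k : ℕ) :
    bTgt s (k : ZMod (3 * s)) = ((2 * k + 3 - k % 3 : ℕ) : ZMod (6 * s)) := by
  have h := Nat.mod_add_div k (3 * s)
  have h3 : k % (3 * s) % 3 = k % 3 := Nat.mod_mod_of_dvd _ (Dvd.intro _ rfl)
  rw [bTgt, ZMod.val_natCast, h3]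
  refine (natCast_eq_of_mod_mul (m := k / (3 * s)) ?_).symm
  have e : 6 * s * (k / (3 * s)) = 2 * (3 * s * (k / (3 * s))) := by ring
  omega

omit [NeZero s] in
theorem gSrc_natCast (k : ℕ) : gSrc s (k : ZMod s) = ((6 * k + 5 : ℕ) : ZMod (6 * s)) := by
  have h := Nat.mod_add_div k s
  rw [gSrc, ZMod.val_natCast]
  refine (natCast_eq_of_mod_mul (m := k / s) ?_).symm
  have e : 6 * s * (k / s) = 6 * (s * (k / s)) := by ring
  omega

omit [NeZero s] in
theorem gTgt_natCast (k : ℕ) : gTgt s (k : ZMod s) = ((6 * k + 6 : ℕ) : ZMod (6 * s)) := by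
  have h := Nat.mod_add_div k s
  rw [gTgt, ZMod.val_natCast]
  refine (natCast_eq_of_mod_mul (m := k / s) ?_).symm
  have e : 6 * s * (k / s) = 6 * (s * (k / s)) := by ring
  omega

omit [NeZero s] in
theorem mk_rel {x y : F K s} (h : Rel K s x y) :
    RingQuot.mkAlgHom K (Rel K s) x = RingQuot.mkAlgHom K (Rel K s) y :=
  RingQuot.mkAlgHom_rel K h

omit [NeZero s] in
theorem ee_mul_ee (i j : ZMod (6 * s)) : ee K s i * ee K s j = if i = j then ee K s i else 0 := by
  have h := mk_rel K s (Rel.idem i j)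
  rw [map_mul] at h
  refine h.trans ?_
  split_ifs
  · rfl
  · exact map_zero _

omit [NeZero s] in
theorem aN_src (k : ℕ) : aN K s k * ee K s (aSrc s k) = aN K s k :=
  (map_mul _ _ _).symm.trans (mk_rel K s (Rel.a_src (k : ZMod (3 * s))))

omit [NeZero s] in
theorem aN_tgt (k : ℕ) : ee K s (aTgt s k) * aN K s k = aN K s k :=
  (map_mul _ _ _).symm.trans (mk_rel K s (Rel.a_tgt (k : ZMod (3 * s))))

omit [NeZero s] in
theorem bN_src (k : ℕ) : bN K s k * ee K s (bSrc s k) = bN K s k :=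
  (map_mul _ _ _).symm.trans (mk_rel K s (Rel.b_src (k : ZMod (3 * s))))

omit [NeZero s] in
theorem bN_tgt (k : ℕ) : ee K s (bTgt s k) * bN K s k = bN K s k :=
  (map_mul _ _ _).symm.trans (mk_rel K s (Rel.b_tgt (k : ZMod (3 * s))))

omit [NeZero s] in
theorem gN_src (k : ℕ) : gN K s k * ee K s (gSrc s k) = gN K s k :=
  (map_mul _ _ _).symm.trans (mk_rel K s (Rel.g_src (k : ZMod s)))

omit [NeZero s] in
theorem gN_tgt (k : ℕ) : ee K s (gTgt s k) * gN K s k = gN K s k :=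
  (map_mul _ _ _).symm.trans (mk_rel K s (Rel.g_tgt (k : ZMod s)))

theorem ar_mul_eN {κ : Kind} {n : ℕ} (h : κ.IsSrc n) : ar K s κ n * eN K s n = ar K s κ n := by
  cases κ with
  | a =>
    have h' : n % 6 < 3 := h
    have e := aN_src K s (3 * (n / 6) + n % 6)
    rwa [aSrc_natCast, show 2 * (3 * (n / 6) + n % 6) - (3 * (n / 6) + n % 6) % 3 = n by omega] at e
  | b =>
    have h' : n % 6 = 0 ∨ n % 6 = 3 ∨ n % 6 = 4 := h
    have e := bN_src K s (3 * (n / 6) + (n % 6 - 2))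
    rwa [bSrc_natCast, show (if (3 * (n / 6) + (n % 6 - 2)) % 3 = 1 then
      2 * (3 * (n / 6) + (n % 6 - 2)) + 1 else 2 * (3 * (n / 6) + (n % 6 - 2))) = n by
        split_ifs <;> omega] at e
  | g =>
    have h' : n % 6 = 5 := h
    have e := gN_src K s (n / 6)
    rwa [gSrc_natCast, show 6 * (n / 6) + 5 = n by omega] at e

theorem eN_mul_ar {κ : Kind} {n : ℕ} (h : κ.IsSrc n) :
    eN K s (κ.next n) * ar K s κ n = ar K s κ n := by
  cases κ with
  | a =>
    have h' : n % 6 < 3 := h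
    have e := aN_tgt K s (3 * (n / 6) + n % 6)
    rwa [aTgt_natCast, show (if (3 * (n / 6) + n % 6) % 3 = 1 then 2 * (3 * (n / 6) + n % 6) else
      2 * (3 * (n / 6) + n % 6) + 1) = Kind.a.next n by
        simp only [Kind.next]; split_ifs <;> omega] at e
  | b =>
    have h' : n % 6 = 0 ∨ n % 6 = 3 ∨ n % 6 = 4 := h
    have e := bN_tgt K s (3 * (n / 6) + (n % 6 - 2))
    rwa [bTgt_natCast, show 2 * (3 * (n / 6) + (n % 6 - 2)) + 3 -
      (3 * (n / 6) + (n % 6 - 2)) % 3 = Kind.b.next n by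
        simp only [Kind.next]; split_ifs <;> omega] at e
  | g =>
    have h' : n % 6 = 5 := h
    have e := gN_tgt K s (n / 6)
    rwa [gTgt_natCast, show 6 * (n / 6) + 6 = Kind.g.next n by
        simp only [Kind.next]; omega] at e

omit [NeZero s] in
theorem eN_mul_eN (n m : ℕ) :
    eN K s n * eN K s m = if (n : ZMod (6 * s)) = m then eN K s n else 0 := ee_mul_ee K s _ _

/-- The classes of the arrows in `R_s`. -/
def arrowSet : Set (Alg K s) := RingQuot.mkAlgHom K (Rel K s) '' arrows K s

omit [NeZero s] in
theorem ar_mem_arrowSet (κ : Kind) (n : ℕ) : ar K s κ n ∈ arrowSet K s := by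
  cases κ with
  | a => exact ⟨_, Or.inl (Or.inl ⟨_, rfl⟩), rfl⟩
  | b => exact ⟨_, Or.inl (Or.inr ⟨_, rfl⟩), rfl⟩
  | g => exact ⟨_, Or.inr ⟨_, rfl⟩, rfl⟩

omit [NeZero s] in
theorem mul_arrows_eq_zero {x₁ x₂ x₃ x₄ x₅ : Alg K s} (h₁ : x₁ ∈ arrowSet K s)
    (h₂ : x₂ ∈ arrowSet K s) (h₃ : x₃ ∈ arrowSet K s) (h₄ : x₄ ∈ arrowSet K s)
    (h₅ : x₅ ∈ arrowSet K s) : x₁ * x₂ * x₃ * x₄ * x₅ = 0 := by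
  obtain ⟨y₁, h₁, rfl⟩ := h₁
  obtain ⟨y₂, h₂, rfl⟩ := h₂
  obtain ⟨y₃, h₃, rfl⟩ := h₃
  obtain ⟨y₄, h₄, rfl⟩ := h₄
  obtain ⟨y₅, h₅, rfl⟩ := h₅
  rw [← map_mul, ← map_mul, ← map_mul, ← map_mul, mk_rel K s (Rel.len5 _ _ _ _ _ h₁ h₂ h₃ h₄ h₅),
    map_zero]

omit [NeZero s] in
theorem cast_three (t i : ℕ) :
    ((3 * (t % s) + i : ℕ) : ZMod (3 * s)) = ((3 * t + i : ℕ) : ZMod (3 * s)) := by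
  refine (natCast_eq_of_mod_mul (m := t / s) ?_).symm
  have h := Nat.mod_add_div t s
  have e : 3 * s * (t / s) = 3 * (s * (t / s)) := by ring
  omega

theorem aN_comm (t : ℕ) : aN K s (3 * t + 2) * aN K s (3 * t + 1) * aN K s (3 * t + 0) =
    bN K s (3 * t + 2) * bN K s (3 * t + 1) * bN K s (3 * t + 0) := by
  have h := mk_rel K s (Rel.comm ⟨t % s, Nat.mod_lt _ (NeZero.pos s)⟩)
  simp only [map_mul, cast_three] at h
  have h0 := cast_three s t 0
  rw [add_zero] at h0
  rw [h0] at h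
  exact h

theorem a_g_b_eq_zero (t : ℕ) : aN K s (3 * t + 3) * gN K s t * bN K s (3 * t + 2) = 0 := by
  have h := mk_rel K s (Rel.zero_agb ⟨t % s, Nat.mod_lt _ (NeZero.pos s)⟩)
  simp only [map_mul, cast_three, map_zero, ZMod.natCast_mod] at h
  exact h

theorem b_g_a_eq_zero (t : ℕ) : bN K s (3 * t + 3) * gN K s t * aN K s (3 * t + 2) = 0 := by
  have h := mk_rel K s (Rel.zero_bga ⟨t % s, Nat.mod_lt _ (NeZero.pos s)⟩)
  simp only [map_mul, cast_three, map_zero, ZMod.natCast_mod] at h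
  exact h

theorem sum_ee : ∑ i : ZMod (6 * s), ee K s i = 1 := by
  have h := mk_rel K s Rel.sum_one
  rw [map_sum, map_one] at h
  rw [← h]
  symm
  refine Finset.sum_nbij (fun i => (i : ZMod (6 * s))) (fun _ _ => Finset.mem_univ _)
    (fun i hi j hj hij => ?_) (fun i _ => ?_) (fun _ _ => rfl)
  · have hi' : i < 6 * s := by simpa using hi
    have hj' : j < 6 * s := by simpa using hj
    have := congrArg ZMod.val hij
    rwa [ZMod.val_natCast_of_lt hi', ZMod.val_natCast_of_lt hj'] at this
  · exact ⟨i.val, by simpa using ZMod.val_lt i, ZMod.natCast_zmod_val i⟩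

omit [NeZero s] in
/-- Induction over the generators of `R_s`. -/
theorem alg_induction {P : Alg K s → Prop} (hK : ∀ c, P (algebraMap K _ c))
    (he : ∀ i, P (ee K s i)) (ha : ∀ i, P (aa K s i)) (hb : ∀ i, P (bb K s i))
    (hg : ∀ i, P (gg K s i)) (hadd : ∀ x y, P x → P y → P (x + y))
    (hmul : ∀ x y, P x → P y → P (x * y)) (x : Alg K s) : P x := by
  obtain ⟨y, rfl⟩ := RingQuot.mkAlgHom_surjective K (Rel K s) x
  induction y using FreeAlgebra.induction with
  | grade0 c => rw [AlgHom.commutes]; exact hK c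
  | grade1 i =>
    cases i with
    | e i => exact he i
    | a i => exact ha i
    | b i => exact hb i
    | g i => exact hg i
  | mul x y hx hy => rw [map_mul]; exact hmul _ _ hx hy
  | add x y hx hy => rw [map_add]; exact hadd _ _ hx hy

/-- Induction over trivial paths and arrows of `R_s`, indexed by natural numbers. -/
theorem alg_induction_nat {P : Alg K s → Prop} (hK : ∀ c, P (algebraMap K _ c))
    (he : ∀ n, P (eN K s n)) (har : ∀ (κ : Kind) n, κ.IsSrc n → P (ar K s κ n))
    (hadd : ∀ x y, P x → P y → P (x + y))
    (hmul : ∀ x y, P x → P y → P (x * y)) (x : Alg K s) : P x := by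
  refine alg_induction K s hK (fun i => ?_) (fun i => ?_) (fun i => ?_) (fun i => ?_) hadd hmul x
  · rw [← ZMod.natCast_zmod_val i]
    exact he _
  · rw [← ZMod.natCast_zmod_val i]
    have h := har Kind.a (2 * i.val - i.val % 3) (by simp only [Kind.IsSrc]; omega)
    rwa [ar, show 3 * ((2 * i.val - i.val % 3) / 6) + (2 * i.val - i.val % 3) % 6 = i.val by
      omega] at h
  · rw [← ZMod.natCast_zmod_val i]
    have h := har Kind.b (2 * i.val + (if i.val % 3 = 1 then 1 else 0)) (by
      simp only [Kind.IsSrc]; split_ifs <;> omega)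
    rwa [ar, show 3 * ((2 * i.val + (if i.val % 3 = 1 then 1 else 0)) / 6) +
      ((2 * i.val + (if i.val % 3 = 1 then 1 else 0)) % 6 - 2) = i.val by
        split_ifs <;> omega] at h
  · rw [← ZMod.natCast_zmod_val i]
    have h := har Kind.g (6 * i.val + 5) (by simp only [Kind.IsSrc]; omega)
    rwa [ar, show (6 * i.val + 5) / 6 = i.val by omega] at h

end Arrows

section Paths

/-- `Win n v` holds when there is a nonzero path from `v` to `n` on the universal cover of `𝒬ₛ`
modulo the relations. -/
def Win (n v : ℕ) : Prop :=
  v ≤ n ∧ n ≤ v + 6 ∧ (v % 6 = 1 → n ≠ v + 2 ∧ n ≠ v + 3) ∧ (v % 6 = 2 → n ≠ v + 1 ∧ n ≠ v + 2) ∧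
    (v % 6 = 3 → n ≠ v + 4 ∧ n ≠ v + 5) ∧ (v % 6 = 4 → n ≠ v + 3 ∧ n ≠ v + 4)

/-- A Boolean version of `Win`. -/
def winB (n v : ℕ) : Bool :=
  Nat.ble v n && Nat.ble n (v + 6) && !(Nat.beq (v % 6) 1 && (Nat.beq n (v + 2) || Nat.beq n (v + 3))
    || Nat.beq (v % 6) 2 && (Nat.beq n (v + 1) || Nat.beq n (v + 2))
    || Nat.beq (v % 6) 3 && (Nat.beq n (v + 4) || Nat.beq n (v + 5))
    || Nat.beq (v % 6) 4 && (Nat.beq n (v + 3) || Nat.beq n (v + 4)))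

theorem winB_iff (n v : ℕ) : winB n v = true ↔ Win n v := by
  simp only [winB, Win, Bool.and_eq_true, Bool.not_eq_true', ← Bool.not_eq_true, Bool.or_eq_true,
    Nat.ble_eq, Nat.beq_eq]
  omega

instance (n v : ℕ) : Decidable (Win n v) := decidable_of_iff _ (winB_iff n v)

theorem Win.refl (v : ℕ) : Win v v := by
  unfold Win; omega

theorem win_add_iff (n v a : ℕ) : Win (n + 6 * a) (v + 6 * a) ↔ Win n v := by
  unfold Win; omega

theorem win_convex_check : ((List.range 6).all fun u => (List.range 12).all fun v =>
    (List.range 18).all fun m =>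
    !(winB m v && winB v u && (winB (m + 1) u && !Nat.beq (m % 6) 2 ||
      winB (m + 3) u && (Nat.beq (m % 6) 0 || Nat.beq (m % 6) 2))) || winB m u) = true := by
  decide +kernel

theorem win_convex {u v m : ℕ} (h : Win m v) (h' : Win v u)
    (hm : Win (m + 1) u ∧ m % 6 ≠ 2 ∨ Win (m + 3) u ∧ (m % 6 = 0 ∨ m % 6 = 2)) : Win m u := by
  obtain ⟨q, u, hu, rfl⟩ : ∃ q u', u' < 6 ∧ u = u' + 6 * q :=
    ⟨u / 6, u % 6, Nat.mod_lt _ (by norm_num), (Nat.mod_add_div u 6).symm⟩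
  obtain ⟨v, rfl⟩ : ∃ v', v = v' + 6 * q := ⟨v - 6 * q, by have := h'.1; omega⟩
  obtain ⟨m, rfl⟩ : ∃ m', m = m' + 6 * q := ⟨m - 6 * q, by have := h.1; omega⟩
  rw [add_right_comm, add_right_comm _ _ 3, win_add_iff, win_add_iff] at hm
  rw [win_add_iff] at h h' ⊢
  have key := win_convex_check
  simp only [List.all_eq_true, List.mem_range] at key
  have := key u hu v (by have := h'.2.1; omega) m (by have := h.2.1; have := h'.2.1; omega)
  simp only [Bool.or_eq_true, Bool.not_eq_true', ← Bool.not_eq_true, Bool.and_eq_true, winB_iff,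
    Nat.beq_eq] at this
  refine this.resolve_left (not_not.2 ⟨⟨h, h'⟩, ?_⟩)
  simpa using hm

/-- The height of a vertex: its distance from the vertex `0`. -/
def ht (n : ℕ) : ℕ := 4 * (n / 6) + n % 6 - 2 * (n % 6 / 3)

theorem Kind.next_spec {κ : Kind} {n : ℕ} (h : κ.IsSrc n) :
    (n % 6 = 0 ∧ κ = .b ∨ n % 6 = 2) ∧ κ.next n = n + 3 ∨
      (n % 6 = 0 ∧ κ = .a ∨ n % 6 = 1 ∨ n % 6 = 3 ∨ n % 6 = 4 ∨ n % 6 = 5) ∧ κ.next n = n + 1 := by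
  cases κ <;> simp only [Kind.IsSrc] at h <;> simp only [Kind.next, reduceCtorEq] <;>
    (repeat' split) <;> simp <;> omega

theorem ht_next {κ : Kind} {n : ℕ} (h : κ.IsSrc n) : ht (κ.next n) = ht n + 1 := by
  have := Kind.next_spec h
  unfold ht
  omega

theorem ht_add (n q : ℕ) : ht (n + 6 * q) = ht n + 4 * q := by
  unfold ht
  omega

theorem not_win_next_check : ((List.range 6).all fun v => (List.range 12).all fun n =>
    !winB n v || Nat.beq (ht n) (ht v + 4) ||
    (winB (n + 3) v || Nat.beq (n % 6) 0 && (Nat.beq (v + 5) n || Nat.beq (v + 4) n) ||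
      !(Nat.beq (n % 6) 0 || Nat.beq (n % 6) 2)) &&
    (winB (n + 1) v || Nat.beq (n % 6) 0 && (Nat.beq (v + 3) n || Nat.beq (v + 2) n) ||
      Nat.beq (n % 6) 2)) = true := by
  decide +kernel

theorem not_win_next {κ : Kind} {n v : ℕ} (h : Win n v) (htop : ht n ≠ ht v + 4)
    (hw : ¬ Win (κ.next n) v)
    (hκ : (n % 6 = 0 ∨ n % 6 = 2) ∧ κ.next n = n + 3 ∨ n % 6 ≠ 2 ∧ κ.next n = n + 1) :
    n % 6 = 0 ∧ κ.next n = n + 3 ∧ (v + 5 = n ∨ v + 4 = n) ∨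
      n % 6 = 0 ∧ κ.next n = n + 1 ∧ (v + 3 = n ∨ v + 2 = n) := by
  generalize κ.next n = m at *
  obtain ⟨q, v, hv, rfl⟩ : ∃ q v', v' < 6 ∧ v = v' + 6 * q :=
    ⟨v / 6, v % 6, Nat.mod_lt _ (by norm_num), (Nat.mod_add_div v 6).symm⟩
  obtain ⟨n, rfl⟩ : ∃ n', n = n' + 6 * q := ⟨n - 6 * q, by have := h.1; omega⟩
  rw [win_add_iff] at h
  rw [ht_add, ht_add] at htop
  have key := not_win_next_check
  simp only [List.all_eq_true, List.mem_range] at key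
  have := key v hv n (by have := h.2.1; omega)
  simp only [Bool.or_eq_true, Bool.not_eq_true', ← Bool.not_eq_true, Bool.and_eq_true, winB_iff,
    Nat.beq_eq] at this
  rcases hκ with ⟨h₁, rfl⟩ | ⟨h₁, rfl⟩
  · rw [add_right_comm, win_add_iff] at hw
    simp only [h, hw, not_true_eq_false, false_or] at this
    omega
  · rw [add_right_comm, win_add_iff] at hw
    simp only [h, hw, not_true_eq_false, false_or] at this
    omega

theorem Win.ht_le {n v : ℕ} (h : Win n v) : ht v ≤ ht n ∧ ht n ≤ ht v + 4 := by
  unfold Win at h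
  unfold ht
  omega

/-- The last arrow (its kind and its source) of the chosen path from `v` to `n`. -/
def lastArrow (v n : ℕ) : Kind × ℕ :=
  if n % 6 = 0 then (.g, n - 1) else if n % 6 < 3 then (.a, n - 1)
  else if n % 6 = 3 then (.b, n - 3) else if n % 6 = 4 then (.b, n - 1)
  else if Win (n - 3) v then (.a, n - 3) else (.b, n - 1)

theorem lastArrow_spec {v n : ℕ} (h : Win n v) (hn : n ≠ v) :
    (lastArrow v n).1.IsSrc (lastArrow v n).2 ∧ Win (lastArrow v n).2 v ∧
      (lastArrow v n).1.next (lastArrow v n).2 = n ∧ (lastArrow v n).2 < n := by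
  unfold lastArrow
  split_ifs <;> unfold Win at * <;> simp only [Kind.IsSrc, Kind.next] <;> (repeat' split) <;> omega

variable (K : Type u) [Field K] (s : ℕ)

/-- The class in `R_s` of the paths from `v` to `n`. -/
noncomputable def pth (v n : ℕ) : Alg K s :=
  if _hn : n = v then eN K s v
  else if _h : Win n v then ar K s (lastArrow v n).1 (lastArrow v n).2 * pth v (lastArrow v n).2
  else 0
termination_by n
decreasing_by exact (lastArrow_spec _h _hn).2.2.2

theorem pth_self (v : ℕ) : pth K s v v = eN K s v := by rw [pth, dif_pos rfl]

theorem pth_of_not_win {v n : ℕ} (h : ¬ Win n v) : pth K s v n = 0 := by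
  rw [pth, dif_neg (by rintro rfl; exact h (Win.refl _)), dif_neg h]

theorem pth_lastArrow {v n : ℕ} (h : Win n v) (hn : n ≠ v) :
    pth K s v n = ar K s (lastArrow v n).1 (lastArrow v n).2 * pth K s v (lastArrow v n).2 := by
  conv_lhs => rw [pth, dif_neg hn, dif_pos h]

theorem pth_of_lastArrow {v n m : ℕ} {κ : Kind} (h : Win n v) (hn : n ≠ v)
    (hl : lastArrow v n = (κ, m)) : pth K s v n = ar K s κ m * pth K s v m := by
  rw [pth_lastArrow K s h hn, hl]

theorem pth_cases {v n : ℕ} (h : Win n v) : n = v ∨ ∃ κ : Kind, ∃ m, κ.IsSrc m ∧ Win m v ∧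
    κ.next m = n ∧ m < n ∧ pth K s v n = ar K s κ m * pth K s v m := by
  by_cases hn : n = v
  · exact Or.inl hn
  · obtain ⟨h₁, h₂, h₃, h₄⟩ := lastArrow_spec h hn
    exact Or.inr ⟨_, _, h₁, h₂, h₃, h₄, pth_lastArrow K s h hn⟩

theorem ar_mul_pth_top {v n : ℕ} (h : Win n v) (hn : ht n = ht v + 4) (κ : Kind) (m : ℕ) :
    ar K s κ m * pth K s v n = 0 := by
  have step : ∀ n, Win n v → ∀ k, ht n = ht v + (k + 1) → ∃ x ∈ arrowSet K s, ∃ m, Win m v ∧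
      ht m = ht v + k ∧ pth K s v n = x * pth K s v m := by
    intro n h k hk
    rcases pth_cases K s h with rfl | ⟨κ, m, h₁, h₂, rfl, -, e⟩
    · omega
    · rw [ht_next h₁] at hk
      exact ⟨_, ar_mem_arrowSet K s κ m, m, h₂, by omega, e⟩
  obtain ⟨x₁, hx₁, n₁, h₁, e₁, p₁⟩ := step n h 3 hn
  obtain ⟨x₂, hx₂, n₂, h₂, e₂, p₂⟩ := step n₁ h₁ 2 e₁
  obtain ⟨x₃, hx₃, n₃, h₃, e₃, p₃⟩ := step n₂ h₂ 1 e₂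
  obtain ⟨x₄, hx₄, n₄, -, -, p₄⟩ := step n₃ h₃ 0 e₃
  rw [p₁, p₂, p₃, p₄]
  simp only [← mul_assoc]
  rw [mul_arrows_eq_zero K s (ar_mem_arrowSet K s κ m) hx₁ hx₂ hx₃ hx₄, zero_mul]

theorem pth_mul_eN (v n : ℕ) : pth K s v n * eN K s v = pth K s v n := by
  by_cases h : Win n v
  · induction n using Nat.strong_induction_on with
    | _ n ih =>
      rcases pth_cases K s h with rfl | ⟨κ, m, -, h₂, -, hlt, e⟩
      · rw [pth_self, eN_mul_eN, if_pos rfl]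
      · rw [e, mul_assoc, ih m hlt h₂]
  · rw [pth_of_not_win K s h, zero_mul]

theorem ar_a_eq {n k : ℕ} (h : 3 * (n / 6) + n % 6 = k) : ar K s .a n = aN K s k := by
  rw [← h, ar]

theorem ar_b_eq {n k : ℕ} (h : 3 * (n / 6) + (n % 6 - 2) = k) : ar K s .b n = bN K s k := by
  rw [← h, ar]

theorem ar_g_eq {n k : ℕ} (h : n / 6 = k) : ar K s .g n = gN K s k := by
  rw [← h, ar]

variable [NeZero s]

theorem eN_mul_pth_self (v n : ℕ) : eN K s n * pth K s v n = pth K s v n := by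
  by_cases h : Win n v
  · rcases pth_cases K s h with rfl | ⟨κ, m, h₁, -, rfl, -, e⟩
    · rw [pth_self, eN_mul_eN, if_pos rfl]
    · rw [e, ← mul_assoc, eN_mul_ar K s h₁]
  · rw [pth_of_not_win K s h, mul_zero]

theorem eN_mul_pth (m v n : ℕ) :
    eN K s m * pth K s v n = if (m : ZMod (6 * s)) = n then pth K s v n else 0 := by
  rw [← eN_mul_pth_self K s v n, ← mul_assoc, eN_mul_eN]
  split_ifs with h
  · rw [eN, h, ← eN, eN_mul_pth_self]
  · rw [zero_mul]

theorem ar_mul_pth {v n : ℕ} (h : Win n v) {κ : Kind} (hκ : κ.IsSrc n) :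
    ar K s κ n * pth K s v n = if Win (κ.next n) v then pth K s v (κ.next n) else 0 := by
  have hne : Win (κ.next n) v → κ.next n ≠ v := by
    rintro - e
    have := h.ht_le.1
    rw [← e, ht_next hκ] at this
    omega
  split_ifs with hw
  · by_cases hl : lastArrow v (κ.next n) = (κ, n)
    · rw [pth_of_lastArrow K s hw (hne hw) hl]
    · have hb : ∃ t, κ = .b ∧ n = 6 * t + 4 ∧ (v = 6 * t ∨ v + 1 = 6 * t) := by
        have key : κ = .b ∧ n % 6 = 4 ∧ Win (n - 2) v := by
          cases κ <;> simp only [Kind.IsSrc] at hκ <;> simp only [Kind.next] at hw hl <;>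
            unfold lastArrow at hl <;> (repeat' split at hl) <;> simp_all <;> omega
        obtain ⟨rfl, h₄, hw₂⟩ := key
        refine ⟨n / 6, rfl, by omega, ?_⟩
        clear hl hne hκ hw
        unfold Win at *
        omega
      obtain ⟨t, rfl, rfl, hv⟩ := hb
      have step : ∀ κ x y, x = 6 * t + 1 ∧ κ = .a ∧ y = 6 * t ∨
          x = 6 * t + 2 ∧ κ = .a ∧ y = 6 * t + 1 ∨ x = 6 * t + 3 ∧ κ = .b ∧ y = 6 * t ∨
          x = 6 * t + 4 ∧ κ = .b ∧ y = 6 * t + 3 ∨ x = 6 * t + 5 ∧ κ = .a ∧ y = 6 * t + 2 →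
          pth K s v x = ar K s κ y * pth K s v y := by
        intro κ x y hx
        refine pth_of_lastArrow K s (by unfold Win; omega) (by omega) ?_
        have hw : Win (6 * t + 2) v := by unfold Win; omega
        rcases hx with ⟨rfl, rfl, rfl⟩ | ⟨rfl, rfl, rfl⟩ | ⟨rfl, rfl, rfl⟩ | ⟨rfl, rfl, rfl⟩ |
          ⟨rfl, rfl, rfl⟩ <;> simp [lastArrow, hw, Nat.add_mod]
      have hn : Kind.b.next (6 * t + 4) = 6 * t + 5 := by
        have := Kind.next_spec hκ
        omega
      rw [hn, step .a (6 * t + 5) (6 * t + 2) (by simp), step .a (6 * t + 2) (6 * t + 1) (by simp),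
        step .a (6 * t + 1) (6 * t) (by simp), step .b (6 * t + 4) (6 * t + 3) (by simp),
        step .b (6 * t + 3) (6 * t) (by simp)]
      simp only [← mul_assoc]
      congr 1
      have := aN_comm K s t
      rw [ar_b_eq K s (k := 3 * t + 2) (by omega), ar_b_eq K s (k := 3 * t + 1) (by omega),
        ar_b_eq K s (k := 3 * t + 0) (by omega), ar_a_eq K s (k := 3 * t + 2) (by omega),
        ar_a_eq K s (k := 3 * t + 1) (by omega), ar_a_eq K s (k := 3 * t + 0) (by omega), this]
  · by_cases htop : ht n = ht v + 4
    · exact ar_mul_pth_top K s h htop κ n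
    · have hb : ∃ t, n = 6 * t + 6 ∧ (κ.next n = n + 3 ∧ (v = 6 * t + 1 ∨ v = 6 * t + 2) ∨
          κ.next n = n + 1 ∧ (v = 6 * t + 3 ∨ v = 6 * t + 4)) := by
        have := Kind.next_spec hκ
        refine ⟨n / 6 - 1, ?_⟩
        rcases not_win_next (κ := κ) h htop hw (by omega) with h₁ | h₁ <;> omega
      obtain ⟨t, rfl, h₂⟩ := hb
      replace h₂ : κ = .b ∧ (v = 6 * t + 1 ∨ v = 6 * t + 2) ∨
          κ = .a ∧ (v = 6 * t + 3 ∨ v = 6 * t + 4) := by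
        have := Kind.next_spec hκ
        rcases h₂ with ⟨e, h₂⟩ | ⟨e, h₂⟩
        · refine Or.inl ⟨?_, h₂⟩
          rcases this with ⟨⟨-, h₃⟩ | h₃, -⟩ | ⟨-, h₃⟩
          · exact h₃
          all_goals omega
        · refine Or.inr ⟨?_, h₂⟩
          rcases this with ⟨-, h₃⟩ | ⟨⟨-, h₃⟩ | h₃, -⟩
          · omega
          · exact h₃
          · omega
      have hg : pth K s v (6 * t + 6) = ar K s .g (6 * t + 5) * pth K s v (6 * t + 5) := by
        refine pth_of_lastArrow K s h (by omega) ?_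
        unfold lastArrow
        rw [if_pos (by omega)]
        rfl
      have hw₅ : Win (6 * t + 5) v := by unfold Win; omega
      rcases h₂ with ⟨rfl, hv⟩ | ⟨rfl, hv⟩
      · have hl : pth K s v (6 * t + 5) = ar K s .a (6 * t + 2) * pth K s v (6 * t + 2) := by
          refine pth_of_lastArrow K s hw₅ (by omega) ?_
          have hw : Win (6 * t + 2) v := by unfold Win; omega
          simp [lastArrow, hw, Nat.add_mod]
        rw [hg, hl]
        simp only [← mul_assoc]
        have := b_g_a_eq_zero K s t
        rw [show ar K s .b (6 * t + 6) * ar K s .g (6 * t + 5) * ar K s .a (6 * t + 2) = 0 by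
          rw [← this, ar_b_eq K s (k := 3 * t + 3) (by omega), ar_g_eq K s (k := t) (by omega),
            ar_a_eq K s (k := 3 * t + 2) (by omega)], zero_mul]
      · have hl : pth K s v (6 * t + 5) = ar K s .b (6 * t + 4) * pth K s v (6 * t + 4) := by
          refine pth_of_lastArrow K s hw₅ (by omega) ?_
          have hw : ¬ Win (6 * t + 2) v := by unfold Win; omega
          simp [lastArrow, hw, Nat.add_mod]
        rw [hg, hl]
        simp only [← mul_assoc]
        have := a_g_b_eq_zero K s t
        rw [show ar K s .a (6 * t + 6) * ar K s .g (6 * t + 5) * ar K s .b (6 * t + 4) = 0 by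
          rw [← this, ar_a_eq K s (k := 3 * t + 3) (by omega), ar_g_eq K s (k := t) (by omega),
            ar_b_eq K s (k := 3 * t + 2) (by omega)], zero_mul]

theorem pth_mul_pth {u v n : ℕ} (h : Win n v) (h' : Win v u) :
    pth K s v n * pth K s u v = if Win n u then pth K s u n else 0 := by
  induction n using Nat.strong_induction_on with
  | _ n ih =>
    rcases pth_cases K s h with rfl | ⟨κ, m, h₁, h₂, rfl, hlt, e⟩
    · rw [pth_self, eN_mul_pth_self, if_pos h']
    · rw [e, mul_assoc, ih m hlt h₂]
      by_cases hm : Win m u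
      · rw [if_pos hm, ar_mul_pth K s hm h₁]
      · rw [if_neg hm, mul_zero, if_neg]
        have := Kind.next_spec h₁
        rcases this with ⟨h₃, e⟩ | ⟨h₃, e⟩
        · exact fun hw => hm (win_convex h₂ h' (Or.inr ⟨e ▸ hw, by tauto⟩))
        · exact fun hw => hm (win_convex h₂ h' (Or.inl ⟨e ▸ hw, by omega⟩))

end Paths

section Representation

/-- The partial map on vertices given by an arrow kind, restricted to the window of `v`. -/
def stepIf (v : ℕ) (κ : Kind) (n : ℕ) (p : Prop) [Decidable p] : Option ℕ :=
  if p ∧ Win n v ∧ Win (κ.next n) v then some (κ.next n) else none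

/-- The partial action of the generators on the vertices of the universal cover
which are reachable from `v`. -/
def act (s v : ℕ) : Gen s → ℕ → Option ℕ
  | .e i, n => if (n : ZMod (6 * s)) = i then some n else none
  | .a i, n => stepIf v .a n (n % 6 < 3 ∧ ((3 * (n / 6) + n % 6 : ℕ) : ZMod (3 * s)) = i)
  | .b i, n => stepIf v .b n ((n % 6 = 0 ∨ n % 6 = 3 ∨ n % 6 = 4) ∧
      ((3 * (n / 6) + (n % 6 - 2) : ℕ) : ZMod (3 * s)) = i)
  | .g i, n => stepIf v .g n (n % 6 = 5 ∧ ((n / 6 : ℕ) : ZMod s) = i)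

theorem stepIf_eq_some {v n m : ℕ} {κ : Kind} {p : Prop} [Decidable p] :
    stepIf v κ n p = some m ↔ p ∧ Win n v ∧ Win m v ∧ κ.next n = m := by
  unfold stepIf
  split_ifs with h
  · rw [Option.some_inj]
    constructor
    · rintro rfl
      exact ⟨h.1, h.2.1, h.2.2, rfl⟩
    · exact fun h => h.2.2.2
  · simp only [false_iff]
    rintro ⟨h₁, h₂, h₃, rfl⟩
    exact h ⟨h₁, h₂, h₃⟩

variable (K : Type u) [Field K]

/-- The linear map of `ℕ →₀ K` given by a partial map of `ℕ`. -/
noncomputable def lin (f : ℕ → Option ℕ) : Module.End K (ℕ →₀ K) :=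
  Finsupp.linearCombination K fun n => (f n).elim 0 fun m => Finsupp.single m 1

theorem lin_single (f : ℕ → Option ℕ) (n : ℕ) :
    lin K f (Finsupp.single n 1) = (f n).elim 0 fun m => Finsupp.single m 1 := by
  rw [lin, Finsupp.linearCombination_single, one_smul]

theorem lin_mul (f g : ℕ → Option ℕ) : lin K f * lin K g = lin K fun n => (g n).bind f := by
  refine Finsupp.lhom_ext' fun n => LinearMap.ext_ring ?_
  simp only [LinearMap.comp_apply, Finsupp.lsingle_apply, Module.End.mul_apply, lin_single]
  cases g n <;> simp [lin_single]

theorem lin_none : lin K (fun _ => none) = 0 := by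
  refine Finsupp.lhom_ext' fun n => LinearMap.ext_ring ?_
  simp [lin_single]

variable (s : ℕ)

theorem act_ht {v n m : ℕ} {x : Gen s} (hx : ∀ i, x ≠ .e i) (h : act s v x n = some m) :
    Win n v ∧ Win m v ∧ ht m = ht n + 1 := by
  have key : ∃ κ : Kind, κ.IsSrc n ∧ Win n v ∧ Win m v ∧ κ.next n = m := by
    cases x with
    | e i => exact absurd rfl (hx i)
    | a i => exact ⟨.a, (stepIf_eq_some.1 h).1.1, (stepIf_eq_some.1 h).2⟩
    | b i => exact ⟨.b, (stepIf_eq_some.1 h).1.1, (stepIf_eq_some.1 h).2⟩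
    | g i => exact ⟨.g, (stepIf_eq_some.1 h).1.1, (stepIf_eq_some.1 h).2⟩
  obtain ⟨κ, h₁, h₂, h₃, rfl⟩ := key
  exact ⟨h₂, h₃, ht_next h₁⟩

theorem act_a_eq_some {v n m k : ℕ} : act s v (.a (k : ZMod (3 * s))) n = some m ↔
    (n % 6 < 3 ∧ 3 * (n / 6) + n % 6 ≡ k [MOD 3 * s]) ∧ Win n v ∧ Win m v ∧ Kind.a.next n = m := by
  rw [act, stepIf_eq_some, ZMod.natCast_eq_natCast_iff]

theorem act_b_eq_some {v n m k : ℕ} : act s v (.b (k : ZMod (3 * s))) n = some m ↔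
    ((n % 6 = 0 ∨ n % 6 = 3 ∨ n % 6 = 4) ∧ 3 * (n / 6) + (n % 6 - 2) ≡ k [MOD 3 * s]) ∧
      Win n v ∧ Win m v ∧ Kind.b.next n = m := by
  rw [act, stepIf_eq_some, ZMod.natCast_eq_natCast_iff]

theorem act_g_eq_some {v n m k : ℕ} : act s v (.g (k : ZMod s)) n = some m ↔
    (n % 6 = 5 ∧ n / 6 ≡ k [MOD s]) ∧ Win n v ∧ Win m v ∧ Kind.g.next n = m := by
  rw [act, stepIf_eq_some, ZMod.natCast_eq_natCast_iff]

theorem modEq_three_iff {a t : ℕ} (i : ℕ) : 3 * a + i ≡ 3 * t + i [MOD 3 * s] ↔ a ≡ t [MOD s] :=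
  ⟨fun h => Nat.ModEq.mul_left_cancel' (by norm_num) (Nat.ModEq.add_right_cancel' i h),
    fun h => (h.mul_left' 3).add_right i⟩

theorem modEq_three {a t i j : ℕ} (hi : i < 3) (hj : j < 3) :
    3 * a + i ≡ 3 * t + j [MOD 3 * s] ↔ a ≡ t [MOD s] ∧ i = j := by
  constructor
  · intro h
    have h₃ := h.of_mul_right s
    have : i = j := by
      unfold Nat.ModEq at h₃
      omega
    subst this
    exact ⟨(modEq_three_iff s i).1 h, rfl⟩
  · rintro ⟨h, rfl⟩
    exact (modEq_three_iff s i).2 h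

theorem act_comm (v t n m : ℕ) :
    ((((act s v (.a ((3 * t : ℕ) : ZMod (3 * s))) n).bind
      (act s v (.a ((3 * t + 1 : ℕ) : ZMod (3 * s))))).bind
        (act s v (.a ((3 * t + 2 : ℕ) : ZMod (3 * s))))) = some m) ↔
    n % 6 = 0 ∧ n / 6 ≡ t [MOD s] ∧ m = n + 5 ∧ Win n v ∧ Win m v := by
  simp only [Option.bind_eq_some_iff, act_a_eq_some]
  constructor
  · rintro ⟨b, ⟨a, ⟨⟨h₁, h₂⟩, h₃, h₄, e₁⟩, ⟨h₅, h₆⟩, h₇, h₈, e₂⟩, ⟨h₉, h₁₀⟩, -, h₁₁, e₃⟩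
    have h := (modEq_three s (j := 0) (by omega) (by norm_num)).1 h₂
    simp only [Kind.next] at e₁ e₂ e₃
    split_ifs at e₁ e₂ e₃ <;> first | omega | exact ⟨h.2, h.1, by omega, h₃, h₁₁⟩
  · rintro ⟨h₀, ht, rfl, hn, hm⟩
    have hw : Win (n + 1) v ∧ Win (n + 2) v := by unfold Win at *; omega
    refine ⟨n + 2, ⟨n + 1, ⟨⟨by omega, ?_⟩, hn, hw.1, ?_⟩, ⟨by omega, ?_⟩, hw.1, hw.2, ?_⟩,
      ⟨by omega, ?_⟩, hw.2, hm, ?_⟩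
    · exact (modEq_three s (j := 0) (by omega) (by norm_num)).2 ⟨ht, h₀⟩
    · rw [Kind.next, if_neg (by omega)]
    · rw [modEq_three s (by omega) (by norm_num), show (n + 1) / 6 = n / 6 by omega]
      exact ⟨ht, by omega⟩
    · rw [Kind.next, if_neg (by omega)]
    · rw [modEq_three s (by omega) (by norm_num), show (n + 2) / 6 = n / 6 by omega]
      exact ⟨ht, by omega⟩
    · rw [Kind.next, if_pos (by omega)]

theorem act_comm' (v t n m : ℕ) :
    ((((act s v (.b ((3 * t : ℕ) : ZMod (3 * s))) n).bind
      (act s v (.b ((3 * t + 1 : ℕ) : ZMod (3 * s))))).bind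
        (act s v (.b ((3 * t + 2 : ℕ) : ZMod (3 * s))))) = some m) ↔
    n % 6 = 0 ∧ n / 6 ≡ t [MOD s] ∧ m = n + 5 ∧ Win n v ∧ Win m v := by
  simp only [Option.bind_eq_some_iff, act_b_eq_some]
  constructor
  · rintro ⟨b, ⟨a, ⟨⟨h₁, h₂⟩, h₃, h₄, e₁⟩, ⟨h₅, h₆⟩, h₇, h₈, e₂⟩, ⟨h₉, h₁₀⟩, -, h₁₁, e₃⟩
    have h := (modEq_three s (j := 0) (by omega) (by norm_num)).1 h₂
    simp only [Kind.next] at e₁ e₂ e₃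
    split_ifs at e₁ e₂ e₃ <;> first | omega | exact ⟨by omega, h.1, by omega, h₃, h₁₁⟩
  · rintro ⟨h₀, ht, rfl, hn, hm⟩
    have hw : Win (n + 3) v ∧ Win (n + 4) v := by unfold Win at *; omega
    refine ⟨n + 4, ⟨n + 3, ⟨⟨by omega, ?_⟩, hn, hw.1, ?_⟩, ⟨by omega, ?_⟩, hw.1, hw.2, ?_⟩,
      ⟨by omega, ?_⟩, hw.2, hm, ?_⟩
    · exact (modEq_three s (j := 0) (by omega) (by norm_num)).2 ⟨ht, by omega⟩
    · rw [Kind.next, if_pos (by omega)]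
    · rw [modEq_three s (by omega) (by norm_num), show (n + 3) / 6 = n / 6 by omega]
      exact ⟨ht, by omega⟩
    · rw [Kind.next, if_neg (by omega)]
    · rw [modEq_three s (by omega) (by norm_num), show (n + 4) / 6 = n / 6 by omega]
      exact ⟨ht, by omega⟩
    · rw [Kind.next, if_neg (by omega)]

theorem act_a_g_b (v t n m : ℕ) :
    ((((act s v (.b ((3 * t + 2 : ℕ) : ZMod (3 * s))) n).bind
      (act s v (.g (t : ZMod s)))).bind
        (act s v (.a ((3 * t + 3 : ℕ) : ZMod (3 * s))))) ≠ some m) := by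
  simp only [Ne, Option.bind_eq_some_iff, act_b_eq_some, act_a_eq_some, act_g_eq_some]
  rintro ⟨b, ⟨a, ⟨⟨h₁, h₂⟩, h₃, h₄, e₁⟩, ⟨h₅, h₆⟩, h₇, h₈, e₂⟩, ⟨h₉, h₁₀⟩, -, h₁₁, e₃⟩
  have h := (modEq_three s (by omega) (by norm_num)).1 h₂
  simp only [Kind.next] at e₁ e₂ e₃
  clear h₆ h₁₀ h₂
  split_ifs at e₁ e₂ e₃ <;> first | omega | (unfold Win at h₃ h₁₁; omega)

theorem act_b_g_a (v t n m : ℕ) :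
    ((((act s v (.a ((3 * t + 2 : ℕ) : ZMod (3 * s))) n).bind
      (act s v (.g (t : ZMod s)))).bind
        (act s v (.b ((3 * t + 3 : ℕ) : ZMod (3 * s))))) ≠ some m) := by
  simp only [Ne, Option.bind_eq_some_iff, act_b_eq_some, act_a_eq_some, act_g_eq_some]
  rintro ⟨b, ⟨a, ⟨⟨h₁, h₂⟩, h₃, h₄, e₁⟩, ⟨h₅, h₆⟩, h₇, h₈, e₂⟩, ⟨h₉, h₁₀⟩, -, h₁₁, e₃⟩
  have h := (modEq_three s (by omega) (by norm_num)).1 h₂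
  simp only [Kind.next] at e₁ e₂ e₃
  clear h₆ h₁₀ h₂
  split_ifs at e₁ e₂ e₃ <;> first | omega | (unfold Win at h₃ h₁₁; omega)

end Representation

section Representation

variable (K : Type u) [Field K] (s : ℕ)

/-- The representation of the free algebra on the vertices reachable from `v`. -/
noncomputable def freeRep (v : ℕ) : F K s →ₐ[K] Module.End K (ℕ →₀ K) :=
  FreeAlgebra.lift K fun x => lin K (act s v x)

theorem freeRep_ι (v : ℕ) (x : Gen s) :
    freeRep K s v (FreeAlgebra.ι K x) = lin K (act s v x) := FreeAlgebra.lift_ι_apply _ _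

theorem freeRep_arrow (v : ℕ) {x : F K s} (hx : x ∈ arrows K s) : ∃ y : Gen s, (∀ i, y ≠ .e i) ∧
    freeRep K s v x = lin K (act s v y) := by
  rcases hx with (⟨i, rfl⟩ | ⟨i, rfl⟩) | ⟨i, rfl⟩
  · exact ⟨.a i, by simp, freeRep_ι K s v _⟩
  · exact ⟨.b i, by simp, freeRep_ι K s v _⟩
  · exact ⟨.g i, by simp, freeRep_ι K s v _⟩

theorem lin_act_mul_of_tgt (v : ℕ) {x : Gen s} {i : ZMod (6 * s)}
    (h : ∀ n m, act s v x n = some m → (m : ZMod (6 * s)) = i) :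
    lin K (act s v (.e i)) * lin K (act s v x) = lin K (act s v x) := by
  rw [lin_mul]
  congr 1
  funext n
  cases hx : act s v x n with
  | none => rfl
  | some m => simp [act, h n m hx]

theorem lin_act_mul_of_src (v : ℕ) {x : Gen s} {i : ZMod (6 * s)}
    (h : ∀ n m, act s v x n = some m → (n : ZMod (6 * s)) = i) :
    lin K (act s v x) * lin K (act s v (.e i)) = lin K (act s v x) := by
  rw [lin_mul]
  congr 1
  funext n
  by_cases hn : (n : ZMod (6 * s)) = i
  · simp [act, hn]
  · rw [act, if_neg hn]
    cases hx : act s v x n with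
    | none => rfl
    | some m => exact absurd (h n m hx) hn

variable [NeZero s]

theorem freeRep_rel (v : ℕ) {x y : F K s} (h : Rel K s x y) :
    freeRep K s v x = freeRep K s v y := by
  induction h with
  | idem i j =>
    rw [map_mul, E, E, freeRep_ι, freeRep_ι, lin_mul]
    split_ifs with hij
    · subst hij
      rw [freeRep_ι]
      congr 1
      funext n
      simp only [act]
      split_ifs with hn <;> simp [act, hn]
    · rw [map_zero, ← lin_none]
      congr 1
      funext n
      simp only [act]
      split_ifs with hn
      · simp [act, hn, Ne.symm hij]
      · rfl
  | sum_one =>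
    rw [map_sum, map_one]
    refine Finsupp.lhom_ext' fun n => LinearMap.ext_ring ?_
    simp only [LinearMap.comp_apply, Finsupp.lsingle_apply, LinearMap.sum_apply,
      Module.End.one_apply, E, freeRep_ι, lin_single, act]
    rw [Finset.sum_eq_single (n % (6 * s))]
    · simp
    · intro b hb hne
      rw [if_neg]
      · rfl
      · intro h
        refine hne ?_
        have := (ZMod.natCast_eq_natCast_iff _ _ _).1 h
        rw [Nat.ModEq, Nat.mod_eq_of_lt (by simpa using hb : b < 6 * s)] at this
        exact this.symm
    · intro h
      exact absurd (Finset.mem_range.2 (Nat.mod_lt _ (NeZero.pos _))) h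
  | a_tgt i =>
    rw [map_mul, E, A, freeRep_ι, freeRep_ι]
    refine lin_act_mul_of_tgt K s v fun n m h => ?_
    obtain ⟨⟨h₁, rfl⟩, -, -, rfl⟩ := stepIf_eq_some.1 h
    rw [aTgt_natCast]
    congr 1
    simp only [Kind.next]
    split_ifs <;> omega
  | a_src i =>
    rw [map_mul, E, A, freeRep_ι, freeRep_ι]
    refine lin_act_mul_of_src K s v fun n m h => ?_
    obtain ⟨⟨h₁, rfl⟩, -, -, rfl⟩ := stepIf_eq_some.1 h
    rw [aSrc_natCast]
    congr 1
    omega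
  | b_tgt i =>
    rw [map_mul, E, B, freeRep_ι, freeRep_ι]
    refine lin_act_mul_of_tgt K s v fun n m h => ?_
    obtain ⟨⟨h₁, rfl⟩, -, -, rfl⟩ := stepIf_eq_some.1 h
    rw [bTgt_natCast]
    congr 1
    simp only [Kind.next]
    split_ifs <;> omega
  | b_src i =>
    rw [map_mul, E, B, freeRep_ι, freeRep_ι]
    refine lin_act_mul_of_src K s v fun n m h => ?_
    obtain ⟨⟨h₁, rfl⟩, -, -, rfl⟩ := stepIf_eq_some.1 h
    rw [bSrc_natCast]
    congr 1
    split_ifs <;> omega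
  | g_tgt i =>
    rw [map_mul, E, G, freeRep_ι, freeRep_ι]
    refine lin_act_mul_of_tgt K s v fun n m h => ?_
    obtain ⟨⟨h₁, rfl⟩, -, -, rfl⟩ := stepIf_eq_some.1 h
    rw [gTgt_natCast]
    congr 1
    simp only [Kind.next]
    omega
  | g_src i =>
    rw [map_mul, E, G, freeRep_ι, freeRep_ι]
    refine lin_act_mul_of_src K s v fun n m h => ?_
    obtain ⟨⟨h₁, rfl⟩, -, -, rfl⟩ := stepIf_eq_some.1 h
    rw [gSrc_natCast]
    congr 1
    omega
  | len5 x₁ x₂ x₃ x₄ x₅ h₁ h₂ h₃ h₄ h₅ =>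
    obtain ⟨y₁, h₁, e₁⟩ := freeRep_arrow K s v h₁
    obtain ⟨y₂, h₂, e₂⟩ := freeRep_arrow K s v h₂
    obtain ⟨y₃, h₃, e₃⟩ := freeRep_arrow K s v h₃
    obtain ⟨y₄, h₄, e₄⟩ := freeRep_arrow K s v h₄
    obtain ⟨y₅, h₅, e₅⟩ := freeRep_arrow K s v h₅
    simp only [map_mul, map_zero, e₁, e₂, e₃, e₄, e₅, mul_assoc, lin_mul]
    rw [← lin_none]
    congr 1
    funext n
    rw [Option.eq_none_iff_forall_ne_some]
    intro m h
    simp only [Option.bind_eq_some_iff] at h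
    obtain ⟨n₁, ⟨n₂, ⟨n₃, ⟨n₄, f₅, f₄⟩, f₃⟩, f₂⟩, f₁⟩ := h
    have a₅ := act_ht s h₅ f₅
    have a₄ := (act_ht s h₄ f₄).2.2
    have a₃ := (act_ht s h₃ f₃).2.2
    have a₂ := (act_ht s h₂ f₂).2.2
    have a₁ := act_ht s h₁ f₁
    have := a₅.1.ht_le
    have := a₁.2.1.ht_le
    omega
  | comm t =>
    simp only [map_mul, mul_assoc, A, B, freeRep_ι, lin_mul]
    congr 1
    funext n
    refine Option.ext fun m => ?_
    exact (act_comm s v t n m).trans (act_comm' s v t n m).symm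
  | zero_agb t =>
    simp only [map_mul, mul_assoc, A, B, G, freeRep_ι, lin_mul, map_zero]
    rw [← lin_none]
    congr 1
    funext n
    exact Option.eq_none_iff_forall_ne_some.2 fun m => act_a_g_b s v t n m
  | zero_bga t =>
    simp only [map_mul, mul_assoc, A, B, G, freeRep_ι, lin_mul, map_zero]
    rw [← lin_none]
    congr 1
    funext n
    exact Option.eq_none_iff_forall_ne_some.2 fun m => act_b_g_a s v t n m

/-- The representation of `R_s` on the vertices reachable from `v`. -/
noncomputable def rep (v : ℕ) : Alg K s →ₐ[K] Module.End K (ℕ →₀ K) :=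
  RingQuot.liftAlgHom K ⟨freeRep K s v, fun _ _ h => freeRep_rel K s v h⟩

theorem rep_mk (v : ℕ) (x : Gen s) :
    rep K s v (RingQuot.mkAlgHom K (Rel K s) (FreeAlgebra.ι K x)) = lin K (act s v x) := by
  rw [rep, RingQuot.liftAlgHom_mkAlgHom_apply, freeRep_ι]

theorem rep_eN (v m n : ℕ) : rep K s v (eN K s m) (Finsupp.single n 1) =
    if (m : ZMod (6 * s)) = n then Finsupp.single n 1 else 0 := by
  rw [eN, ee, E, rep_mk, lin_single, act]
  simp only [eq_comm]
  split_ifs <;> rfl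

omit [NeZero s] in
theorem exists_eq_add_of_natCast_eq {m n : ℕ} (h : (m : ZMod (6 * s)) = n) :
    ∃ q, m = n + 6 * s * q ∨ n = m + 6 * s * q := by
  have h := (ZMod.natCast_eq_natCast_iff m n _).1 h
  rcases le_total m n with hle | hle
  · obtain ⟨q, hq⟩ := (Nat.modEq_iff_dvd' hle).1 h
    exact ⟨q, Or.inr (by omega)⟩
  · obtain ⟨q, hq⟩ := (Nat.modEq_iff_dvd' hle).1 h.symm
    exact ⟨q, Or.inl (by omega)⟩

omit [NeZero s] in
theorem isSrc_congr {m n : ℕ} (h : (m : ZMod (6 * s)) = n) (κ : Kind) :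
    κ.IsSrc m ↔ κ.IsSrc n := by
  have : m % 6 = n % 6 := ((ZMod.natCast_eq_natCast_iff m n _).1 h).of_mul_right s
  cases κ <;> simp only [Kind.IsSrc, this]

omit [NeZero s] in
theorem ar_congr {m n : ℕ} (h : (m : ZMod (6 * s)) = n) (κ : Kind) :
    ar K s κ m = ar K s κ n := by
  obtain ⟨q, hq⟩ := exists_eq_add_of_natCast_eq s h
  wlog hq' : m = n + 6 * s * q generalizing m n
  · exact (this h.symm hq.symm (hq.resolve_left hq')).symm
  subst hq'
  have h₁ : (n + 6 * s * q) / 6 = n / 6 + s * q := by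
    rw [mul_assoc, Nat.add_mul_div_left _ _ (by norm_num)]
  have h₂ : (n + 6 * s * q) % 6 = n % 6 := by
    rw [mul_assoc, Nat.add_mul_mod_self_left]
  cases κ with
  | a =>
    rw [ar, ar, aN, aN, h₁, h₂]
    congr 1
    refine natCast_eq_of_mod_mul (m := q) ?_
    ring
  | b =>
    rw [ar, ar, bN, bN, h₁, h₂]
    congr 1
    refine natCast_eq_of_mod_mul (m := q) ?_
    ring
  | g =>
    rw [ar, ar, gN, gN, h₁]
    congr 1
    exact natCast_eq_of_mod_mul (m := q) rfl

theorem rep_ar (v : ℕ) {κ : Kind} {m : ℕ} (hm : κ.IsSrc m) (n : ℕ) :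
    rep K s v (ar K s κ m) (Finsupp.single n 1) =
      if (m : ZMod (6 * s)) = n ∧ Win n v ∧ Win (κ.next n) v then Finsupp.single (κ.next n) 1
      else 0 := by
  have hs : ∀ (p : Prop) [Decidable p], (p ↔ (m : ZMod (6 * s)) = n) →
      ((stepIf v κ n p).elim 0 fun m => Finsupp.single m (1 : K)) =
      if (m : ZMod (6 * s)) = n ∧ Win n v ∧ Win (κ.next n) v then Finsupp.single (κ.next n) 1
      else 0 := by
    intro p _ hp
    unfold stepIf
    simp only [hp]
    split_ifs <;> rfl
  have e₁ : (m : ZMod (6 * s)) = n → n % 6 = m % 6 := fun h =>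
    (((ZMod.natCast_eq_natCast_iff m n _).1 h).of_mul_right s).symm
  cases κ with
  | a =>
    rw [ar, aN, aa, A, rep_mk, lin_single, act]
    refine hs _ ⟨fun h => ?_, fun h => ?_⟩
    · have e := congrArg (aSrc s) h.2
      have h₁ := h.1
      simp only [Kind.IsSrc] at hm
      rw [aSrc_natCast, aSrc_natCast] at e
      convert e.symm using 2 <;> omega
    · have h₁ := e₁ h
      refine ⟨h₁ ▸ hm, ?_⟩
      obtain ⟨q, rfl | rfl⟩ := exists_eq_add_of_natCast_eq s h
      · refine (natCast_eq_of_mod_mul (m := q) ?_).symm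
        rw [← h₁, mul_assoc, Nat.add_mul_div_left _ _ (by norm_num)]
        ring
      · refine natCast_eq_of_mod_mul (m := q) ?_
        rw [h₁, mul_assoc, Nat.add_mul_div_left _ _ (by norm_num)]
        ring
  | b =>
    rw [ar, bN, bb, B, rep_mk, lin_single, act]
    refine hs _ ⟨fun h => ?_, fun h => ?_⟩
    · have e := congrArg (bSrc s) h.2
      have h₁ := h.1
      simp only [Kind.IsSrc] at hm
      rw [bSrc_natCast, bSrc_natCast] at e
      convert e.symm using 2 <;> split_ifs <;> omega
    · have h₁ := e₁ h
      refine ⟨h₁ ▸ hm, ?_⟩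
      obtain ⟨q, rfl | rfl⟩ := exists_eq_add_of_natCast_eq s h
      · refine (natCast_eq_of_mod_mul (m := q) ?_).symm
        rw [← h₁, mul_assoc, Nat.add_mul_div_left _ _ (by norm_num)]
        ring
      · refine natCast_eq_of_mod_mul (m := q) ?_
        rw [h₁, mul_assoc, Nat.add_mul_div_left _ _ (by norm_num)]
        ring
  | g =>
    rw [ar, gN, gg, G, rep_mk, lin_single, act]
    refine hs _ ⟨fun h => ?_, fun h => ?_⟩
    · have e := congrArg (gSrc s) h.2
      have h₁ := h.1
      simp only [Kind.IsSrc] at hm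
      rw [gSrc_natCast, gSrc_natCast] at e
      convert e.symm using 2 <;> omega
    · have h₁ := e₁ h
      refine ⟨h₁ ▸ hm, ?_⟩
      obtain ⟨q, rfl | rfl⟩ := exists_eq_add_of_natCast_eq s h
      · refine (natCast_eq_of_mod_mul (m := q) ?_).symm
        rw [mul_assoc, Nat.add_mul_div_left _ _ (by norm_num)]
      · refine natCast_eq_of_mod_mul (m := q) ?_
        rw [mul_assoc, Nat.add_mul_div_left _ _ (by norm_num)]

end Representation

section Coordinates

variable (K : Type u) [Field K] (s : ℕ)

/-- The linear combination of the paths starting at `v` with given coefficients. -/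
noncomputable def comb (v : ℕ) : (ℕ →₀ K) →ₗ[K] Alg K s :=
  Finsupp.linearCombination K (pth K s v)

theorem comb_single (v n : ℕ) (c : K) : comb K s v (Finsupp.single n c) = c • pth K s v n :=
  Finsupp.linearCombination_single K c n

variable [NeZero s]

theorem mul_comb (v : ℕ) (x : Alg K s) (f : ℕ →₀ K) :
    x * comb K s v f = comb K s v (rep K s v x f) := by
  suffices h : ∀ x : Alg K s, ∀ f, x * comb K s v f = comb K s v (rep K s v x f) from h x f
  have red : ∀ x : Alg K s, (∀ n, x * pth K s v n =
      comb K s v (rep K s v x (Finsupp.single n 1))) →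
      ∀ f, x * comb K s v f = comb K s v (rep K s v x f) := by
    intro x hx f
    have : LinearMap.mulLeft K x ∘ₗ comb K s v = comb K s v ∘ₗ rep K s v x := by
      refine Finsupp.lhom_ext' fun n => LinearMap.ext_ring ?_
      simp only [LinearMap.comp_apply, Finsupp.lsingle_apply, LinearMap.mulLeft_apply, ← hx n,
        comb_single, one_smul]
    exact LinearMap.congr_fun this f
  refine alg_induction_nat K s (fun c f => ?_) (fun m => ?_) (fun κ m hm => ?_)
    (fun x y hx hy f => ?_) (fun x y hx hy f => ?_)
  · rw [AlgHom.commutes, Module.algebraMap_end_apply, map_smul, Algebra.smul_def]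
  · refine red _ fun n => ?_
    rw [eN_mul_pth, rep_eN]
    split_ifs
    · rw [comb_single, one_smul]
    · rw [map_zero]
  · refine red _ fun n => ?_
    rw [rep_ar K s v hm]
    by_cases hw : Win n v
    · by_cases hmn : (m : ZMod (6 * s)) = n
      · rw [ar_congr K s hmn, ar_mul_pth K s hw ((isSrc_congr s hmn κ).1 hm)]
        by_cases hw' : Win (κ.next n) v
        · rw [if_pos hw', if_pos ⟨hmn, hw, hw'⟩, comb_single, one_smul]
        · rw [if_neg hw', if_neg (by simp [hw']), map_zero]
      · rw [if_neg (by simp [hmn]), map_zero, ← ar_mul_eN K s hm, mul_assoc, eN_mul_pth,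
          if_neg hmn, mul_zero]
    · rw [pth_of_not_win K s hw, mul_zero, if_neg (by simp [hw]), map_zero]
  · rw [add_mul, hx, hy, map_add, LinearMap.add_apply, map_add]
  · rw [mul_assoc, hy, hx, map_mul, Module.End.mul_apply]

/-- The coefficients of `x * e_v` with respect to the paths starting at `v`. -/
noncomputable def coeffs (v : ℕ) : Alg K s →ₗ[K] ℕ →₀ K :=
  LinearMap.applyₗ (Finsupp.single v 1) ∘ₗ (rep K s v).toLinearMap

theorem coeffs_apply (v : ℕ) (x : Alg K s) :
    coeffs K s v x = rep K s v x (Finsupp.single v 1) := rfl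

theorem comb_coeffs (v : ℕ) (x : Alg K s) : comb K s v (coeffs K s v x) = x * eN K s v := by
  rw [coeffs_apply, ← mul_comb, comb_single, one_smul, pth_self]

theorem coeffs_pth (v m : ℕ) :
    coeffs K s v (pth K s v m) = if Win m v then Finsupp.single m 1 else 0 := by
  split_ifs with h
  · induction m using Nat.strong_induction_on with
    | _ m ih =>
      rcases pth_cases K s h with rfl | ⟨κ, n, h₁, h₂, rfl, hlt, e⟩
      · rw [pth_self, coeffs_apply, rep_eN, if_pos rfl]
      · rw [e, coeffs_apply, map_mul, Module.End.mul_apply, ← coeffs_apply, ih n hlt h₂,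
          rep_ar K s v h₁, if_pos ⟨rfl, h₂, h⟩]
  · rw [pth_of_not_win K s h, map_zero]

theorem coeffs_mul_eN (v : ℕ) (x : Alg K s) : coeffs K s v (x * eN K s v) = coeffs K s v x := by
  rw [coeffs_apply, map_mul, Module.End.mul_apply, rep_eN, if_pos rfl, coeffs_apply]

/-- The coordinate of `x * e_v` along the path from `v` to `n`. -/
noncomputable def co (v n : ℕ) : Alg K s →ₗ[K] K := Finsupp.lapply n ∘ₗ coeffs K s v

theorem co_apply (v n : ℕ) (x : Alg K s) : co K s v n x = coeffs K s v x n := rfl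

theorem co_pth (v n m : ℕ) :
    co K s v n (pth K s v m) = if Win m v ∧ m = n then 1 else 0 := by
  rw [co_apply, coeffs_pth]
  by_cases h : Win m v <;> simp [h, Finsupp.single_apply]

theorem co_comb (v n : ℕ) (f : ℕ →₀ K) :
    co K s v n (comb K s v f) = if Win n v then f n else 0 := by
  have : co K s v n ∘ₗ comb K s v = if Win n v then Finsupp.lapply n else 0 := by
    refine Finsupp.lhom_ext' fun m => LinearMap.ext_ring ?_
    simp only [LinearMap.comp_apply, Finsupp.lsingle_apply, comb_single, one_smul, co_pth]
    by_cases hmn : m = n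
    · subst hmn
      split_ifs <;> simp_all
    · split_ifs <;> simp_all
  rw [← LinearMap.comp_apply, this]
  split_ifs <;> rfl

theorem co_of_not_win {v n : ℕ} (h : ¬ Win n v) (x : Alg K s) : co K s v n x = 0 := by
  rw [co_apply, ← coeffs_mul_eN, ← co_apply, ← comb_coeffs, co_comb, if_neg h]

/-- The vertices reachable from `v`. -/
def window (v : ℕ) : Finset ℕ := (Finset.range (v + 7)).filter fun n => Win n v

theorem mem_window {v n : ℕ} : n ∈ window v ↔ Win n v := by
  rw [window, Finset.mem_filter, Finset.mem_range]
  refine ⟨fun h => h.2, fun h => ⟨?_, h⟩⟩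
  have := h.2.1
  omega

theorem sum_co_smul_pth (v : ℕ) (x : Alg K s) :
    ∑ n ∈ window v, co K s v n x • pth K s v n = x * eN K s v := by
  rw [← comb_coeffs, comb, Finsupp.linearCombination_apply, Finsupp.sum]
  symm
  refine Finset.sum_subset_zero_on_sdiff (fun n hn => ?_) (fun n hn => ?_) (fun n _ => rfl)
  · rw [mem_window]
    by_contra h
    exact Finsupp.mem_support_iff.1 hn (co_of_not_win K s h x)
  · have := (Finset.mem_sdiff.1 hn).2
    rw [Finsupp.notMem_support_iff] at this
    rw [co_apply, this, zero_smul]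

theorem co_sum {v n : ℕ} (c : ℕ → K) :
    co K s v n (∑ m ∈ window v, c m • pth K s v m) = if Win n v then c n else 0 := by
  rw [map_sum]
  simp only [map_smul, co_pth, smul_eq_mul]
  split_ifs with h
  · rw [Finset.sum_eq_single_of_mem n (mem_window.2 h), if_pos ⟨h, rfl⟩, mul_one]
    intro b _ hb
    rw [if_neg (fun h => hb h.2), mul_zero]
  · refine Finset.sum_eq_zero fun m _ => ?_
    rw [if_neg, mul_zero]
    rintro ⟨h₁, rfl⟩
    exact h h₁

theorem co_mul_pth {k l n : ℕ} (hkl : Win k l) {x : Alg K s} (hx : x * eN K s k = x) :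
    co K s l n (x * pth K s l k) = if Win n l then co K s k n x else 0 := by
  conv_lhs => rw [← hx, ← sum_co_smul_pth, Finset.sum_mul, map_sum]
  have : ∀ m ∈ window k, co K s l n ((co K s k m x • pth K s k m) * pth K s l k) =
      if m = n then (if Win n l then co K s k n x else 0) else 0 := by
    intro m hm
    rw [smul_mul_assoc, map_smul, pth_mul_pth K s (mem_window.1 hm) hkl]
    split_ifs <;> simp_all [co_pth]
  rw [Finset.sum_congr rfl this, Finset.sum_ite_eq']
  split_ifs with h₁ h₂
  · rfl
  · rfl
  · rw [co_of_not_win]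
    rwa [mem_window] at h₁
  · rfl

theorem ext_co {v : ℕ} {x y : Alg K s} (hx : x * eN K s v = x) (hy : y * eN K s v = y)
    (h : ∀ n, Win n v → co K s v n x = co K s v n y) : x = y := by
  rw [← hx, ← hy, ← sum_co_smul_pth, ← sum_co_smul_pth]
  exact Finset.sum_congr rfl fun n hn => by rw [h n (mem_window.1 hn)]

instance : Module.Finite K (Alg K s) := by
  refine ⟨(Submodule.fg_def).2 ⟨⋃ i : ZMod (6 * s), (pth K s i.val) '' (window i.val), ?_, ?_⟩⟩
  · exact Set.finite_iUnion fun i => (Finset.finite_toSet _).image _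
  · rw [eq_top_iff]
    rintro x -
    rw [← mul_one x, ← sum_ee, Finset.mul_sum]
    refine Submodule.sum_mem _ fun i _ => ?_
    have := sum_co_smul_pth K s i.val x
    rw [eN, ZMod.natCast_zmod_val] at this
    rw [← this]
    refine Submodule.sum_mem _ fun n hn => Submodule.smul_mem _ _ (Submodule.subset_span ?_)
    exact Set.mem_iUnion.2 ⟨i, Set.mem_image_of_mem _ hn⟩

theorem finrank_corner (i : ZMod (6 * s)) (v : ℕ) (N : Submodule K (Alg K s))
    (hN : ∀ x, x ∈ N ↔ ee K s i * x * eN K s v = x) :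
    Module.finrank K N = ((window v).filter fun n : ℕ => (n : ZMod (6 * s)) = i).card := by
  set T := (window v).filter fun n : ℕ => (n : ZMod (6 * s)) = i with hT
  have hi : ∀ n, ee K s i * pth K s v n = if i = n then pth K s v n else 0 := by
    intro n
    have := eN_mul_pth K s i.val v n
    rwa [eN, ZMod.natCast_zmod_val] at this
  have hxT : ∀ x ∈ N, ∑ n ∈ T, co K s v n x • pth K s v n = x := by
    intro x hx
    have h₁ := (hN x).1 hx
    rw [mul_assoc, ← sum_co_smul_pth, Finset.mul_sum] at h₁
    conv_rhs => rw [← h₁]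
    rw [hT, Finset.sum_filter]
    refine Finset.sum_congr rfl fun n _ => ?_
    rw [mul_smul_comm, hi]
    simp only [eq_comm]
    split_ifs <;> simp
  have hmem : ∀ n ∈ T, pth K s v n ∈ N := by
    intro n hn
    rw [hN, hi, if_pos (Finset.mem_filter.1 hn).2.symm, pth_mul_eN]
  let e : N ≃ₗ[K] (T → K) :=
    { toFun := fun x n => co K s v n (x : Alg K s)
      map_add' := fun x y => by ext n; simp
      map_smul' := fun c x => by ext n; simp
      invFun := fun f => ⟨∑ n : T, f n • pth K s v n,
        Submodule.sum_mem _ fun n _ => Submodule.smul_mem _ _ (hmem n n.2)⟩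
      left_inv := fun x => by
        refine Subtype.ext ?_
        conv_rhs => rw [← hxT x x.2]
        exact Finset.sum_coe_sort T fun n => co K s v n (x : Alg K s) • pth K s v n
      right_inv := fun f => by
        ext n
        have hw := mem_window.1 (Finset.mem_filter.1 n.2).1
        simp only [map_sum, map_smul, co_pth, smul_eq_mul]
        rw [Finset.sum_eq_single n]
        · rw [if_pos ⟨hw, rfl⟩, mul_one]
        · intro m _ hm
          rw [if_neg, mul_zero]
          exact fun h => hm (Subtype.ext h.2)
        · simp }
  rw [e.finrank_eq, Module.finrank_fintype_fun_eq_card, Fintype.card_coe]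

end Coordinates

section Characters

theorem exists_ne_zero_forall_eq_zero {K : Type*} {V : Type*} [Field K] [AddCommGroup V]
    [Module K V] [Nontrivial V] (T : Set (Module.End K V))
    (hT : ∀ f₁ ∈ T, ∀ f₂ ∈ T, ∀ f₃ ∈ T, ∀ f₄ ∈ T, ∀ f₅ ∈ T, f₁ * f₂ * f₃ * f₄ * f₅ = 0) :
    ∃ w : V, w ≠ 0 ∧ ∀ f ∈ T, f w = 0 := by
  by_contra! h
  obtain ⟨w, hw⟩ := exists_ne (0 : V)
  obtain ⟨f₁, h₁, hw⟩ := h w hw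
  obtain ⟨f₂, h₂, hw⟩ := h _ hw
  obtain ⟨f₃, h₃, hw⟩ := h _ hw
  obtain ⟨f₄, h₄, hw⟩ := h _ hw
  obtain ⟨f₅, h₅, hw⟩ := h _ hw
  exact hw (LinearMap.congr_fun (hT f₅ h₅ f₄ h₄ f₃ h₃ f₂ h₂ f₁ h₁) w)

variable (K : Type u) [Field K] (s : ℕ)

/-- The character of the free algebra which is one on the trivial path at `i` and zero on all
other generators. -/
noncomputable def freeChar (i : ZMod (6 * s)) : F K s →ₐ[K] K :=
  FreeAlgebra.lift K fun x => match x with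
    | .e j => if i = j then 1 else 0
    | _ => 0

theorem freeChar_E (i j : ZMod (6 * s)) : freeChar K s i (E K s j) = if i = j then 1 else 0 :=
  FreeAlgebra.lift_ι_apply _ _

theorem freeChar_arrow (i : ZMod (6 * s)) {x : F K s} (hx : x ∈ arrows K s) :
    freeChar K s i x = 0 := by
  rcases hx with (⟨j, rfl⟩ | ⟨j, rfl⟩) | ⟨j, rfl⟩ <;> exact FreeAlgebra.lift_ι_apply _ _

variable [NeZero s]

theorem freeChar_rel (i : ZMod (6 * s)) {x y : F K s} (h : Rel K s x y) :
    freeChar K s i x = freeChar K s i y := by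
  have ha : ∀ j, freeChar K s i (A K s j) = 0 := fun j =>
    freeChar_arrow K s i (Or.inl (Or.inl ⟨j, rfl⟩))
  have hb : ∀ j, freeChar K s i (B K s j) = 0 := fun j =>
    freeChar_arrow K s i (Or.inl (Or.inr ⟨j, rfl⟩))
  have hg : ∀ j, freeChar K s i (G K s j) = 0 := fun j =>
    freeChar_arrow K s i (Or.inr ⟨j, rfl⟩)
  cases h with
  | idem j k =>
    rw [map_mul]
    by_cases h : j = k
    · subst h
      simp [freeChar_E]
    · simp only [if_neg h, freeChar_E, map_zero, mul_ite, mul_one, mul_zero]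
      split_ifs with h₁ h₂
      · exact absurd (h₂.symm.trans h₁) h
      all_goals rfl
  | sum_one =>
    simp only [map_sum, map_one, freeChar_E]
    rw [Finset.sum_eq_single_of_mem i.val (Finset.mem_range.2 (ZMod.val_lt i))]
    · rw [ZMod.natCast_zmod_val, if_pos rfl]
    · intro n hn hne
      rw [if_neg]
      rintro rfl
      exact hne (ZMod.val_natCast_of_lt (Finset.mem_range.1 hn)).symm
  | len5 x₁ x₂ x₃ x₄ x₅ h₁ => simp [freeChar_arrow K s i h₁]
  | _ => simp [ha, hb, hg]

/-- The character of `R_s` attached to the vertex `i`. -/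
noncomputable def char (i : ZMod (6 * s)) : Alg K s →ₐ[K] K :=
  RingQuot.liftAlgHom K ⟨freeChar K s i, fun _ _ h => freeChar_rel K s i h⟩

theorem char_ee (i j : ZMod (6 * s)) : char K s i (ee K s j) = if i = j then 1 else 0 := by
  rw [char, ee, RingQuot.liftAlgHom_mkAlgHom_apply, freeChar_E]

theorem char_arrow (i : ZMod (6 * s)) {x : Alg K s} (hx : x ∈ arrowSet K s) :
    char K s i x = 0 := by
  obtain ⟨y, hy, rfl⟩ := hx
  rw [char, RingQuot.liftAlgHom_mkAlgHom_apply, freeChar_arrow K s i hy]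

theorem char_pth (i : ZMod (6 * s)) {v n : ℕ} (h : n ≠ v) : char K s i (pth K s v n) = 0 := by
  by_cases hw : Win n v
  · rcases pth_cases K s hw with rfl | ⟨κ, m, -, -, -, -, e⟩
    · exact absurd rfl h
    · rw [e, map_mul, char_arrow K s i (ar_mem_arrowSet K s κ m), zero_mul]
  · rw [pth_of_not_win K s hw, map_zero]

theorem ar_mul_ee {κ : Kind} {n : ℕ} (h : κ.IsSrc n) (j : ZMod (6 * s)) :
    ar K s κ n * ee K s j = if (n : ZMod (6 * s)) = j then ar K s κ n else 0 := by
  rw [← ar_mul_eN K s h, mul_assoc, eN, ee_mul_ee]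
  split_ifs
  · rfl
  · rw [mul_zero]

theorem ee_mul_ar {κ : Kind} {n : ℕ} (h : κ.IsSrc n) (j : ZMod (6 * s)) :
    ee K s j * ar K s κ n = if j = (κ.next n : ZMod (6 * s)) then ar K s κ n else 0 := by
  rw [← eN_mul_ar K s h, ← mul_assoc, eN, ee_mul_ee]
  split_ifs with h
  · rw [h]
  · rw [zero_mul]

theorem hasEigenvectors : HasEigenvectors (char K s) where
  left V _ _ _ ρ := by
    obtain ⟨w, hw, hT⟩ := exists_ne_zero_forall_eq_zero (ρ '' arrowSet K s) (by
      rintro _ ⟨x₁, h₁, rfl⟩ _ ⟨x₂, h₂, rfl⟩ _ ⟨x₃, h₃, rfl⟩ _ ⟨x₄, h₄, rfl⟩ _ ⟨x₅, h₅, rfl⟩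
      rw [← map_mul, ← map_mul, ← map_mul, ← map_mul, mul_arrows_eq_zero K s h₁ h₂ h₃ h₄ h₅,
        map_zero])
    obtain ⟨i, hi⟩ : ∃ i, ρ (ee K s i) w ≠ 0 := by
      by_contra! h
      refine hw ?_
      have : ρ (∑ i, ee K s i) w = 0 := by
        rw [map_sum, LinearMap.sum_apply]
        exact Finset.sum_eq_zero fun i _ => h i
      rwa [sum_ee, map_one, Module.End.one_apply] at this
    refine ⟨i, _, hi, fun a => ?_⟩
    induction a using alg_induction_nat with
    | hK c => rw [AlgHom.commutes, AlgHom.commutes]; rfl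
    | he n =>
      rw [eN, char_ee, ← Module.End.mul_apply, ← map_mul, ee_mul_ee]
      by_cases h : i = n
      · rw [if_pos h, if_pos h.symm, h, one_smul]
      · rw [if_neg h, if_neg (Ne.symm h), map_zero, zero_smul, LinearMap.zero_apply]
    | har κ n h =>
      have hmem := ar_mem_arrowSet K s κ n
      rw [char_arrow K s i hmem, ← Module.End.mul_apply, ← map_mul, ar_mul_ee K s h, zero_smul]
      split_ifs
      · exact hT _ ⟨_, hmem, rfl⟩
      · rw [map_zero, LinearMap.zero_apply]
    | hadd x y hx hy => rw [map_add, LinearMap.add_apply, hx, hy, map_add, add_smul]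
    | hmul x y hx hy =>
      rw [map_mul, Module.End.mul_apply, hy, map_smul, hx, map_mul, smul_smul, mul_comm]
  right V _ _ _ ρ := by
    obtain ⟨w, hw, hT⟩ := exists_ne_zero_forall_eq_zero
      ((fun x => ρ (MulOpposite.op x)) '' arrowSet K s) (by
      rintro _ ⟨x₁, h₁, rfl⟩ _ ⟨x₂, h₂, rfl⟩ _ ⟨x₃, h₃, rfl⟩ _ ⟨x₄, h₄, rfl⟩ _ ⟨x₅, h₅, rfl⟩
      simp only [← map_mul, ← MulOpposite.op_mul, ← mul_assoc]
      rw [mul_arrows_eq_zero K s h₅ h₄ h₃ h₂ h₁, MulOpposite.op_zero, map_zero])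
    obtain ⟨i, hi⟩ : ∃ i, ρ (MulOpposite.op (ee K s i)) w ≠ 0 := by
      by_contra! h
      refine hw ?_
      have : ρ (MulOpposite.op (∑ i, ee K s i)) w = 0 := by
        rw [Finset.op_sum, map_sum, LinearMap.sum_apply]
        exact Finset.sum_eq_zero fun i _ => h i
      rwa [sum_ee, MulOpposite.op_one, map_one, Module.End.one_apply] at this
    refine ⟨i, _, hi, fun a => ?_⟩
    induction a using alg_induction_nat with
    | hK c =>
      rw [← MulOpposite.algebraMap_apply, AlgHom.commutes, AlgHom.commutes]
      rfl
    | he n =>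
      rw [eN, char_ee, ← Module.End.mul_apply, ← map_mul, ← MulOpposite.op_mul, ee_mul_ee]
      by_cases h : i = n
      · rw [if_pos h, if_pos h, one_smul]
      · rw [if_neg h, if_neg h, MulOpposite.op_zero, map_zero, zero_smul, LinearMap.zero_apply]
    | har κ n h =>
      have hmem := ar_mem_arrowSet K s κ n
      rw [char_arrow K s i hmem, ← Module.End.mul_apply, ← map_mul, ← MulOpposite.op_mul,
        ee_mul_ar K s h, zero_smul]
      split_ifs
      · exact hT _ ⟨_, hmem, rfl⟩
      · rw [MulOpposite.op_zero, map_zero, LinearMap.zero_apply]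
    | hadd x y hx hy =>
      rw [MulOpposite.op_add, map_add, LinearMap.add_apply, hx, hy, map_add, add_smul]
    | hmul x y hx hy =>
      rw [MulOpposite.op_mul, map_mul, Module.End.mul_apply, hx, map_smul, hy, map_mul, smul_smul]

end Characters

section Resolution

/-- A matrix with the entries not visible from the vertex `n` replaced by zero; rows are indexed by
the vertices `g'` and columns by the vertices `g`. -/
def visible (g g' : ℕ → ℕ) (c : ℕ → ℕ → ℤ) (n k l : ℕ) : ℤ :=
  if Win n (g' k) ∧ Win n (g l) then c k l else 0

/-- Combinatorial data of a resolution of the simple module at `v` on the universal cover of `𝒬ₛ`: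
the numbers of generators, their vertices, and the coefficients of the differentials. -/
structure ResData (v : ℕ) where
  /-- The number of generators. -/
  len : ℕ → ℕ
  /-- The vertices of the generators. -/
  g : ℕ → ℕ → ℕ
  /-- The coefficients of the differentials. -/
  c : ℕ → ℕ → ℕ → ℤ
  len_zero : len 0 = 1
  g_zero : g 0 0 = v
  win : ∀ t, ∀ k < len (t + 1), ∀ l < len t, c t k l ≠ 0 →
    Win (g (t + 1) k) (g t l) ∧ g (t + 1) k ≠ g t l
  comp : ∀ t, ∀ m < len (t + 2), ∀ l < len t, Win (g (t + 2) m) (g t l) →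
    ∑ k ∈ Finset.range (len (t + 1)), c (t + 1) m k * c t k l = 0
  exact₀ : ∀ n, n ≠ v → Win n v → ∃ H : ℕ → ℤ,
    ∑ m ∈ Finset.range (len 1), H m * visible (g 0) (g 1) (c 0) n m 0 = 1
  exact : ∀ t n, ∃ H H' : ℕ → ℕ → ℤ, ∀ j < len (t + 1), ∀ k < len (t + 1),
    Win n (g (t + 1) j) → Win n (g (t + 1) k) →
    ∑ m ∈ Finset.range (len (t + 2)),
        H j m * visible (g (t + 1)) (g (t + 2)) (c (t + 1)) n m k +
      ∑ l ∈ Finset.range (len t), visible (g t) (g (t + 1)) (c t) n j l * H' l k =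
      if j = k then 1 else 0

namespace ResData

variable {v : ℕ} (X : ResData v) (K : Type u) [Field K] (s : ℕ)

/-- The projective left modules of the resolution. -/
def term (t : ℕ) : Submodule (Alg K s) (Fin (X.len t) → Alg K s) where
  carrier := {x | ∀ k, x k * eN K s (X.g t k) = x k}
  add_mem' hx hy k := by rw [Pi.add_apply, add_mul, hx k, hy k]
  zero_mem' k := by rw [Pi.zero_apply, zero_mul]
  smul_mem' a x hx k := by rw [Pi.smul_apply, smul_eq_mul, mul_assoc, hx k]

theorem eN_mul_self (n : ℕ) : eN K s n * eN K s n = eN K s n := by rw [eN_mul_eN, if_pos rfl]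

instance (t : ℕ) : Module.Projective (Alg K s) (X.term K s t) := by
  let π : (Fin (X.len t) → Alg K s) →ₗ[Alg K s] X.term K s t :=
    { toFun := fun x => ⟨fun k => x k * eN K s (X.g t k), fun k => by
        rw [mul_assoc, eN_mul_self]⟩
      map_add' := fun x y => Subtype.ext (funext fun k => add_mul _ _ _)
      map_smul' := fun a x => Subtype.ext (funext fun k => mul_assoc _ _ _) }
  exact Module.Projective.of_split (X.term K s t).subtype π
    (LinearMap.ext fun x => Subtype.ext (funext fun k => x.2 k))

/-- The differentials of the resolution. -/
noncomputable def diff (t : ℕ) : X.term K s (t + 1) →ₗ[Alg K s] X.term K s t where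
  toFun x := ⟨fun l => ∑ k : Fin (X.len (t + 1)),
    (X.c t k l : K) • (x.1 k * pth K s (X.g t l) (X.g (t + 1) k)), fun l => by
      simp only [Finset.sum_mul, smul_mul_assoc, mul_assoc, pth_mul_eN]⟩
  map_add' x y := Subtype.ext (funext fun l => by
    simp [add_mul, smul_add, Finset.sum_add_distrib])
  map_smul' a x := Subtype.ext (funext fun l => by
    simp [mul_assoc, Finset.mul_sum])

theorem diff_apply (t : ℕ) (x : X.term K s (t + 1)) (l : Fin (X.len t)) :
    (X.diff K s t x).1 l = ∑ k : Fin (X.len (t + 1)),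
      (X.c t k l : K) • (x.1 k * pth K s (X.g t l) (X.g (t + 1) k)) := rfl

variable [NeZero s]

theorem diff_diff (t : ℕ) (x : X.term K s (t + 2)) :
    X.diff K s t (X.diff K s (t + 1) x) = 0 := by
  refine Subtype.ext (funext fun l => ?_)
  rw [diff_apply]
  simp only [diff_apply, Finset.sum_mul, Finset.smul_sum]
  rw [Finset.sum_comm]
  refine Finset.sum_eq_zero fun m _ => ?_
  have hk : ∀ k : Fin (X.len (t + 1)),
      (X.c t k l : K) • ((X.c (t + 1) m k : K) • (x.1 m * pth K s (X.g (t + 1) k) (X.g (t + 2) m)) *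
        pth K s (X.g t l) (X.g (t + 1) k)) =
      ((X.c (t + 1) m k : K) * X.c t k l) • (x.1 m * if Win (X.g (t + 2) m) (X.g t l) then
        pth K s (X.g t l) (X.g (t + 2) m) else 0) := by
    intro k
    rw [smul_mul_assoc, smul_smul, mul_assoc, mul_comm]
    by_cases h₁ : X.c (t + 1) m k = 0
    · rw [h₁, Int.cast_zero, zero_mul, zero_smul, zero_smul]
    by_cases h₂ : X.c t k l = 0
    · rw [h₂, Int.cast_zero, mul_zero, zero_smul, zero_smul]
    rw [pth_mul_pth K s (X.win (t + 1) m m.2 k k.2 h₁).1 (X.win t k k.2 l l.2 h₂).1]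
  rw [Finset.sum_congr rfl fun k _ => hk k, ← Finset.sum_smul]
  split_ifs with hw
  · have := congrArg (fun z : ℤ => (z : K)) (X.comp t m m.2 l l.2 hw)
    rw [Finset.sum_range] at this
    push_cast at this
    rw [this, zero_smul]
  · rw [mul_zero, smul_zero]

theorem co_diff (t n : ℕ) (x : X.term K s (t + 1)) (l : Fin (X.len t)) :
    co K s (X.g t l) n ((X.diff K s t x).1 l) = ∑ k : Fin (X.len (t + 1)),
      co K s (X.g (t + 1) k) n (x.1 k) *
        ((visible (X.g t) (X.g (t + 1)) (X.c t) n k l : ℤ) : K) := by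
  rw [diff_apply, map_sum]
  refine Finset.sum_congr rfl fun k _ => ?_
  rw [map_smul, visible]
  by_cases hc : X.c t k l = 0
  · simp [hc]
  · rw [co_mul_pth K s (X.win t k k.2 l l.2 hc).1 (x.2 k)]
    by_cases h₁ : Win n (X.g t l)
    · by_cases h₂ : Win n (X.g (t + 1) k)
      · rw [if_pos h₁, if_pos ⟨h₂, h₁⟩, smul_eq_mul, mul_comm]
      · rw [co_of_not_win K s h₂]
        simp
    · simp [h₁]

/-- The element of a term of the resolution with given coordinates. -/
noncomputable def ofCoords (t : ℕ) (y : ℕ → ℕ → K) : X.term K s t :=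
  ⟨fun k => ∑ n ∈ window (X.g t k), y n k • pth K s (X.g t k) n, fun k => by
    simp only [Finset.sum_mul, smul_mul_assoc, pth_mul_eN]⟩

theorem co_ofCoords (t n : ℕ) (y : ℕ → ℕ → K) (k : Fin (X.len t)) :
    co K s (X.g t k) n ((X.ofCoords K s t y).1 k) = if Win n (X.g t k) then y n k else 0 :=
  co_sum K s fun n => y n k

theorem diff_ofCoords (t : ℕ) (y : ℕ → ℕ → K) (x : X.term K s t)
    (h : ∀ n, ∀ l : Fin (X.len t), Win n (X.g t l) → ∑ k ∈ Finset.range (X.len (t + 1)), y n k *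
      ((visible (X.g t) (X.g (t + 1)) (X.c t) n k l : ℤ) : K) = co K s (X.g t l) n (x.1 l)) :
    X.diff K s t (X.ofCoords K s (t + 1) y) = x := by
  refine Subtype.ext (funext fun l => ext_co K s ((X.diff K s t _).2 l) (x.2 l) fun n hn => ?_)
  rw [co_diff, ← h n l hn, Finset.sum_range]
  refine Finset.sum_congr rfl fun k _ => ?_
  rw [co_ofCoords]
  split_ifs with hw
  · rfl
  · simp [visible, hw]

theorem range_diff (t : ℕ) :
    LinearMap.range (X.diff K s (t + 1)) = LinearMap.ker (X.diff K s t) := by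
  refine le_antisymm ?_ fun x hx => ?_
  · rintro _ ⟨x, rfl⟩
    exact X.diff_diff K s t x
  choose H H' hH using X.exact t
  refine ⟨X.ofCoords K s (t + 2) fun n m => ∑ j : Fin (X.len (t + 1)),
    co K s (X.g (t + 1) j) n (x.1 j) * ((H n j m : ℤ) : K), ?_⟩
  refine X.diff_ofCoords K s _ _ _ fun n k hk => ?_
  have hD : ∀ l : Fin (X.len t), ∑ j : Fin (X.len (t + 1)), co K s (X.g (t + 1) j) n (x.1 j) *
      ((visible (X.g t) (X.g (t + 1)) (X.c t) n j l : ℤ) : K) = 0 := by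
    intro l
    rw [← co_diff, LinearMap.mem_ker.1 hx]
    exact map_zero _
  have hδ : ∀ j : Fin (X.len (t + 1)), co K s (X.g (t + 1) j) n (x.1 j) *
      ((∑ m ∈ Finset.range (X.len (t + 2)), H n j m *
          visible (X.g (t + 1)) (X.g (t + 2)) (X.c (t + 1)) n m k +
        ∑ l ∈ Finset.range (X.len t), visible (X.g t) (X.g (t + 1)) (X.c t) n j l * H' n l k :
          ℤ) : K) = if j = k then co K s (X.g (t + 1) k) n (x.1 k) else 0 := by
    intro j
    by_cases hj : Win n (X.g (t + 1) j)
    · rw [hH n j j.2 k k.2 hj hk]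
      by_cases hjk : j = k
      · subst hjk
        simp
      · rw [if_neg hjk, if_neg (fun h => hjk (Fin.ext h)), Int.cast_zero, mul_zero]
    · rw [co_of_not_win K s hj, zero_mul]
      split_ifs with hjk
      · subst hjk
        rw [co_of_not_win K s hj]
      · rfl
  have hsum := Finset.sum_congr rfl fun j (_ : j ∈ Finset.univ) => hδ j
  rw [Finset.sum_ite_eq', if_pos (Finset.mem_univ k)] at hsum
  rw [← hsum]
  push_cast
  simp only [mul_add, Finset.sum_add_distrib, Finset.mul_sum, Finset.sum_mul]
  have h₂ : ∑ j : Fin (X.len (t + 1)), ∑ l ∈ Finset.range (X.len t),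
      co K s (X.g (t + 1) j) n (x.1 j) *
        (((visible (X.g t) (X.g (t + 1)) (X.c t) n j l : ℤ) : K) * ((H' n l k : ℤ) : K)) = 0 := by
    rw [Finset.sum_comm, Finset.sum_range]
    refine Finset.sum_eq_zero fun l _ => ?_
    simp only [← mul_assoc]
    rw [← Finset.sum_mul, hD l, zero_mul]
  rw [h₂, add_zero, Finset.sum_comm]
  simp only [mul_assoc]

/-- The index of the unique generator in degree zero. -/
def zeroIdx : Fin (X.len 0) := ⟨0, by rw [X.len_zero]; exact one_pos⟩

theorem eq_zeroIdx (k : Fin (X.len 0)) : k = X.zeroIdx := by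
  have : (k : ℕ) < 1 := X.len_zero ▸ k.2
  exact Fin.ext (by simp only [zeroIdx]; omega)

/-- The augmentation of the resolution. -/
noncomputable def aug : X.term K s 0 →ₗ[Alg K s] CharMod (char K s (v : ZMod (6 * s))) where
  toFun x := char K s (v : ZMod (6 * s)) (x.1 X.zeroIdx) • CharMod.one _
  map_add' x y := by simp [add_smul]
  map_smul' a x := by
    rw [RingHom.id_apply, CharMod.smul_def, smul_smul, ← map_mul]
    rfl

theorem aug_apply (x : X.term K s 0) : X.aug K s x =
    char K s (v : ZMod (6 * s)) (x.1 X.zeroIdx) • CharMod.one _ := rfl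

theorem char_eq_co (x : Alg K s) (hx : x * eN K s v = x) :
    char K s (v : ZMod (6 * s)) x = co K s v v x := by
  conv_lhs => rw [← hx, ← sum_co_smul_pth, map_sum]
  rw [Finset.sum_eq_single_of_mem v (mem_window.2 (Win.refl v))]
  · rw [map_smul, pth_self, eN, char_ee, if_pos rfl, smul_eq_mul, mul_one]
  · intro n _ hn
    rw [map_smul, char_pth K s _ hn, smul_zero]

omit [NeZero s] in
theorem smul_one_eq_zero {χ : Alg K s →ₐ[K] K} {c : K} : c • CharMod.one χ = 0 ↔ c = 0 := by
  change c * 1 = 0 ↔ c = 0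
  rw [mul_one]

theorem aug_surjective : Function.Surjective (X.aug K s) := by
  intro y
  refine ⟨(show K from y) • ⟨fun k => eN K s (X.g 0 k), fun k => eN_mul_self K s _⟩, ?_⟩
  rw [aug_apply]
  change char K s (v : ZMod (6 * s)) ((show K from y) • eN K s (X.g 0 0)) • CharMod.one _ = y
  rw [X.g_zero, map_smul, eN, char_ee, if_pos rfl, smul_eq_mul, mul_one]
  exact CharMod.smul_one _ _

theorem range_diff_zero : LinearMap.range (X.diff K s 0) = LinearMap.ker (X.aug K s) := by
  have hv : X.g 0 X.zeroIdx = v := X.g_zero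
  refine le_antisymm ?_ fun x hx => ?_
  · rintro _ ⟨x, rfl⟩
    rw [LinearMap.mem_ker, aug_apply, smul_one_eq_zero, diff_apply, map_sum]
    refine Finset.sum_eq_zero fun k _ => ?_
    by_cases hc : X.c 0 k X.zeroIdx = 0
    · rw [hc, Int.cast_zero, zero_smul, map_zero]
    · rw [map_smul, map_mul, char_pth K s _ (X.win 0 k k.2 _ X.zeroIdx.2 hc).2, mul_zero,
        smul_zero]
  · have h₀ : co K s v v (x.1 X.zeroIdx) = 0 := by
      have hx' := x.2 X.zeroIdx
      rw [hv] at hx'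
      rw [← char_eq_co K s _ hx', ← smul_one_eq_zero K s]
      exact hx
    have : ∀ n, ∃ H : ℕ → ℤ, n ≠ v → Win n v →
        ∑ m ∈ Finset.range (X.len 1), H m * visible (X.g 0) (X.g 1) (X.c 0) n m 0 = 1 := by
      intro n
      by_cases h₁ : n = v
      · exact ⟨0, fun h => absurd h₁ h⟩
      by_cases h₂ : Win n v
      · obtain ⟨H, hH⟩ := X.exact₀ n h₁ h₂
        exact ⟨H, fun _ _ => hH⟩
      · exact ⟨0, fun _ h => absurd h h₂⟩
    choose H hH using this
    refine ⟨X.ofCoords K s 1 fun n m => co K s v n (x.1 X.zeroIdx) * ((H n m : ℤ) : K), ?_⟩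
    refine X.diff_ofCoords K s _ _ _ fun n l hn => ?_
    obtain rfl := X.eq_zeroIdx l
    rw [hv] at hn ⊢
    by_cases hnv : n = v
    · subst hnv
      simp [h₀]
    · simp only [mul_assoc]
      rw [← Finset.mul_sum]
      have := congrArg (fun z : ℤ => (z : K)) (hH n hnv hn)
      push_cast at this
      rw [show ((X.zeroIdx : Fin _) : ℕ) = 0 from rfl, this, mul_one]

/-- The resolution of a simple module attached to combinatorial data. -/
noncomputable def res : ProjRes (Alg K s) (CharMod (char K s (v : ZMod (6 * s)))) where
  Q t := X.term K s t
  proj _ := inferInstance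
  d t := X.diff K s t
  ε := X.aug K s
  surj := X.aug_surjective K s
  exact₀ := X.range_diff_zero K s
  exact t := X.range_diff K s t

noncomputable instance (t : ℕ) : Module K ((X.res K s).Q t) :=
  inferInstanceAs (Module K (X.term K s t))

instance (t : ℕ) : IsScalarTower K (Alg K s) ((X.res K s).Q t) :=
  inferInstanceAs (IsScalarTower K (Alg K s) (X.term K s t))

/-- The generators of the terms of the resolution. -/
noncomputable def basis (t : ℕ) (k : Fin (X.len t)) : X.term K s t :=
  ⟨Pi.single k (eN K s (X.g t k)), fun l => by
    by_cases h : l = k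
    · subst h
      simp [eN_mul_self]
    · simp [h]⟩

omit [NeZero s] in
theorem eq_sum_basis (t : ℕ) (x : X.term K s t) : x = ∑ k, x.1 k • X.basis K s t k := by
  refine Subtype.ext (funext fun l => ?_)
  rw [Submodule.coe_sum, Finset.sum_apply, Finset.sum_eq_single l]
  · simp [basis, x.2 l]
  · intro k _ hk
    simp [basis, hk.symm]
  · simp

theorem charHom_apply (i : ZMod (6 * s)) (t : ℕ) {ψ : X.term K s t →ₗ[K] K}
    (hψ : ψ ∈ charHom (char K s i) (X.term K s t)) (x : X.term K s t) :
    ψ x = ∑ k, char K s i (x.1 k) * ψ (X.basis K s t k) := by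
  conv_lhs => rw [X.eq_sum_basis K s t x, map_sum]
  exact Finset.sum_congr rfl fun k _ => hψ _ _

theorem charHom_basis (i : ZMod (6 * s)) (t : ℕ) {ψ : X.term K s t →ₗ[K] K}
    (hψ : ψ ∈ charHom (char K s i) (X.term K s t)) {k : Fin (X.len t)}
    (hk : (X.g t k : ZMod (6 * s)) ≠ i) : ψ (X.basis K s t k) = 0 := by
  have : X.basis K s t k = eN K s (X.g t k) • X.basis K s t k := by
    refine Subtype.ext (funext fun l => ?_)
    by_cases h : l = k
    · subst h
      simp [basis, eN_mul_self]
    · simp [basis, h]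
  rw [this, hψ, eN, char_ee, if_neg (Ne.symm hk), zero_mul]

theorem charHom_diff (i : ZMod (6 * s)) (t : ℕ) {ψ : X.term K s t →ₗ[K] K}
    (hψ : ψ ∈ charHom (char K s i) (X.term K s t)) (y : X.term K s (t + 1)) :
    ψ (X.diff K s t y) = 0 := by
  rw [X.charHom_apply K s i t hψ]
  refine Finset.sum_eq_zero fun l _ => ?_
  rw [diff_apply, map_sum, Finset.sum_eq_zero, zero_mul]
  intro k _
  by_cases hc : X.c t k l = 0
  · rw [hc, Int.cast_zero, zero_smul, map_zero]
  · rw [map_smul, map_mul, char_pth K s _ (X.win t k k.2 l l.2 hc).2, mul_zero, smul_zero]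

/-- Functionals on the terms of the resolution are determined by their values on generators. -/
noncomputable def charHomEquiv (i : ZMod (6 * s)) (t : ℕ) :
    charHom (char K s i) (X.term K s t) ≃ₗ[K]
      ({k : Fin (X.len t) // (X.g t k : ZMod (6 * s)) = i} → K) where
  toFun ψ k := ψ.1 (X.basis K s t k.1)
  map_add' _ _ := rfl
  map_smul' _ _ := rfl
  invFun f := ⟨
    { toFun := fun x => ∑ k, char K s i (x.1 k.1) * f k
      map_add' := fun x y => by simp [add_mul, Finset.sum_add_distrib]
      map_smul' := fun c x => by simp [mul_assoc, Finset.mul_sum] }, fun a x => by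
      simp [mul_assoc, Finset.mul_sum]⟩
  left_inv ψ := by
    refine Subtype.ext (LinearMap.ext fun x => ?_)
    change ∑ k : {k : Fin (X.len t) // (X.g t k : ZMod (6 * s)) = i},
      char K s i (x.1 k.1) * ψ.1 (X.basis K s t k.1) = ψ.1 x
    rw [X.charHom_apply K s i t ψ.2 x]
    rw [← Finset.sum_subtype (Finset.univ.filter fun k : Fin (X.len t) => (X.g t k : ZMod _) = i)
      (by simp) fun k => char K s i (x.1 k) * ψ.1 (X.basis K s t k)]
    refine Finset.sum_subset (Finset.filter_subset _ _) fun k _ hk => ?_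
    rw [X.charHom_basis K s i t ψ.2 fun h => hk (Finset.mem_filter.2 ⟨Finset.mem_univ k, h⟩),
      mul_zero]
  right_inv f := by
    funext k
    change ∑ l : {k : Fin (X.len t) // (X.g t k : ZMod (6 * s)) = i},
      char K s i ((X.basis K s t k.1).1 l.1) * f l = f k
    rw [Finset.sum_eq_single k]
    · simp [basis, eN, char_ee, k.2]
    · intro l _ hl
      have : l.1 ≠ k.1 := fun h => hl (Subtype.ext h)
      simp [basis, this]
    · simp

theorem finrank_charHom (i : ZMod (6 * s)) (t : ℕ) :
    Module.Finite K (charHom (char K s i) (X.term K s t)) ∧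
      Module.finrank K (charHom (char K s i) (X.term K s t)) =
        Fintype.card {k : Fin (X.len t) // (X.g t k : ZMod (6 * s)) = i} :=
  ⟨Module.Finite.equiv (X.charHomEquiv K s i t).symm, by
    rw [(X.charHomEquiv K s i t).finrank_eq, Module.finrank_fintype_fun_eq_card]⟩

end ResData
end Resolution

section Tables

/-- The involution of the vertices `0, …, 5` given by the shift of the resolutions by `11`. -/
def swapVertex (q c : ℕ) : ℕ :=
  if q % 2 = 0 ∨ c = 0 ∨ c = 5 then c else if c < 3 then c + 2 else c - 2

/-- The generators of the first eleven terms of the resolutions of the simple modules. -/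
def vertexTable : List (List (List ℕ)) :=
  [[[0], [1, 3], [5], [8, 10], [11, 12], [13, 15], [18], [20, 22], [23], [29], [30]],
    [[1], [2], [8], [11], [15], [18], [19, 22], [23], [26], [30], [33]],
    [[2], [5], [9], [12], [13, 16], [17], [20], [24], [27], [33], [34]],
    [[3], [4], [10], [11], [13], [18], [20, 21], [23], [28], [30], [31]],
    [[4], [5], [7], [12], [14, 15], [17], [22], [24], [25], [31], [32]],
    [[5], [6], [12], [13, 15], [17], [20, 22], [23, 24], [25, 27], [30], [32, 34], [35]]]

/-- The coefficients of the first eleven differentials; the missing ones are `[[1]]`. -/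
def coeffTable (c r : ℕ) : List (List ℤ) :=
  if c = 0 ∧ r = 0 ∨ c = 0 ∧ r = 2 ∨ c = 0 ∧ r = 6 ∨ c = 1 ∧ r = 5 ∨ c = 2 ∧ r = 3 ∨
    c = 3 ∧ r = 5 ∨ c = 4 ∧ r = 3 ∨ c = 5 ∧ (r = 2 ∨ r = 4 ∨ r = 8) then [[1], [1]]
  else if c = 0 ∧ r = 1 ∨ c = 0 ∧ r = 5 ∨ c = 0 ∧ r = 7 ∨ c = 1 ∧ r = 6 ∨ c = 2 ∧ r = 4 ∨
    c = 3 ∧ r = 6 ∨ c = 4 ∧ r = 4 ∨ c = 5 ∧ (r = 3 ∨ r = 7 ∨ r = 9) then [[-1, 1]]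
  else if c = 0 ∧ r = 3 ∨ c = 5 ∧ r = 5 then [[-1, 1], [1, 0]]
  else if c = 0 ∧ r = 4 ∨ c = 5 ∧ r = 6 then [[1, 1], [0, 1]]
  else [[1]]

/-- The generators of a term of the resolution of the simple module at `c < 6`. -/
def gens (c t : ℕ) : List ℕ :=
  (vertexTable.getD (swapVertex (t / 11) c) []).getD (t % 11) []

/-- The vertices of the generators. -/
def vtx (c t k : ℕ) : ℕ := (gens c t).getD k 0 + 36 * (t / 11)

/-- The coefficients of the differentials. -/
def coef (c t k l : ℕ) : ℤ :=
  ((coeffTable (swapVertex (t / 11) c) (t % 11)).getD k []).getD l 0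

/-- A partial inverse of a matrix of size at most two with entries in `{-1, 0, 1}`. -/
def pinv (D : ℕ → ℕ → ℤ) (j i : ℕ) : ℤ :=
  let d := D 0 0 * D 1 1 - D 0 1 * D 1 0
  if d ≠ 0 then (if i = j then d * D (1 - i) (1 - i) else - d * D j i)
  else if D 0 0 ≠ 0 then (if i = 0 ∧ j = 0 then D 0 0 else 0)
  else if D 0 1 ≠ 0 then (if i = 0 ∧ j = 1 then D 0 1 else 0)
  else if D 1 0 ≠ 0 then (if i = 1 ∧ j = 0 then D 1 0 else 0)
  else if i = 1 ∧ j = 1 then D 1 1 else 0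

/-- The visible part of a differential at the vertex `n`. -/
def vis (c t n k l : ℕ) : ℤ := visible (vtx c t) (vtx c (t + 1)) (coef c t) n k l

/-- The second half of a contracting homotopy at the vertex `n`. -/
def homotopy (c t n l k : ℕ) : ℤ :=
  ∑ j ∈ Finset.range 2, pinv (vis c t n) l j * ((if j = k then 1 else 0) -
    ∑ m ∈ Finset.range 2, pinv (vis c (t + 1) n) j m * vis c (t + 1) n m k)

set_option synthInstance.maxSize 1000 in
theorem win_check : ∀ c < 6, ∀ t < 11, ∀ k < (gens c (t + 1)).length, ∀ l < (gens c t).length,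
    coef c t k l ≠ 0 → Win (vtx c (t + 1) k) (vtx c t l) ∧ vtx c (t + 1) k ≠ vtx c t l := by
  decide +kernel

theorem comp_check : ∀ c < 6, ∀ t < 11, ∀ m < (gens c (t + 2)).length,
    ∀ l < (gens c t).length, Win (vtx c (t + 2) m) (vtx c t l) →
      ∑ k ∈ Finset.range (gens c (t + 1)).length, coef c (t + 1) m k * coef c t k l = 0 := by
  decide +kernel

theorem exact_zero_check : ∀ c < 6, ∀ n < 12, n ≠ c → Win n c →
    ∑ m ∈ Finset.range (gens c 1).length, pinv (vis c 0 n) 0 m * vis c 0 n m 0 = 1 := by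
  decide +kernel

set_option synthInstance.maxSize 1000 in
theorem exact_check : ∀ c < 6, ∀ t < 11, ∀ n < 50,
    ∀ j < (gens c (t + 1)).length, ∀ k < (gens c (t + 1)).length,
    Win n (vtx c (t + 1) j) → Win n (vtx c (t + 1) k) →
    ∑ m ∈ Finset.range (gens c (t + 2)).length, pinv (vis c (t + 1) n) j m * vis c (t + 1) n m k +
      ∑ l ∈ Finset.range (gens c t).length, vis c t n j l * homotopy c t n l k =
      if j = k then 1 else 0 := by
  decide +kernel

theorem vtx_le_check : ∀ c < 6, ∀ t < 13, ∀ k < (gens c t).length, vtx c t k < 44 := by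
  decide +kernel

theorem swapVertex_lt {c : ℕ} (hc : c < 6) (q : ℕ) : swapVertex q c < 6 := by
  unfold swapVertex
  split_ifs <;> omega

theorem swapVertex_mod (q c : ℕ) : swapVertex (q % 2) c = swapVertex q c := by
  rw [swapVertex, swapVertex, Nat.mod_mod]

theorem swapVertex_add {c : ℕ} (hc : c < 6) (q p : ℕ) :
    swapVertex (p + q) c = swapVertex p (swapVertex q c) := by
  have h : ∀ a < 2, ∀ b < 2, ∀ c < 6,
      swapVertex ((a + b) % 2) c = swapVertex a (swapVertex b c) := by decide
  have := h (p % 2) (Nat.mod_lt _ two_pos) (q % 2) (Nat.mod_lt _ two_pos) c hc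
  rwa [← Nat.add_mod, swapVertex_mod, swapVertex_mod, swapVertex_mod] at this

theorem gens_add {c : ℕ} (hc : c < 6) (t q : ℕ) :
    gens c (t + 11 * q) = gens (swapVertex q c) t := by
  simp only [gens, Nat.add_mul_mod_self_left, Nat.add_mul_div_left _ _ (Nat.succ_pos 10),
    swapVertex_add hc]

theorem coef_add {c : ℕ} (hc : c < 6) (t q : ℕ) :
    coef c (t + 11 * q) = coef (swapVertex q c) t := by
  funext k l
  simp only [coef, Nat.add_mul_mod_self_left, Nat.add_mul_div_left _ _ (Nat.succ_pos 10),
    swapVertex_add hc]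

theorem vtx_add {c : ℕ} (hc : c < 6) (t q k : ℕ) :
    vtx c (t + 11 * q) k = vtx (swapVertex q c) t k + 36 * q := by
  rw [vtx, vtx, gens_add hc, Nat.add_mul_div_left _ _ (Nat.succ_pos 10)]
  ring

/-- The vertices of the generators of the resolution of the simple module at `v`. -/
def shiftVtx (v t k : ℕ) : ℕ := vtx (v % 6) t k + 6 * (v / 6)

theorem shiftVtx_add (v t q k : ℕ) : shiftVtx v (t + 11 * q) k =
    vtx (swapVertex q (v % 6)) t k + 6 * (6 * q + v / 6) := by
  rw [shiftVtx, vtx_add (Nat.mod_lt _ (by norm_num))]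
  ring

theorem visible_add {g g' h h' : ℕ → ℕ} {a : ℕ} (hg : ∀ k, g k = h k + 6 * a)
    (hg' : ∀ k, g' k = h' k + 6 * a) (c : ℕ → ℕ → ℤ) (n : ℕ) :
    visible g g' c (n + 6 * a) = visible h h' c n := by
  funext k l
  simp only [visible, hg, hg', win_add_iff]

/-- The data of the minimal resolution of the simple module at `v`. -/
def resData (v : ℕ) : ResData v where
  len t := (gens (v % 6) t).length
  g := shiftVtx v
  c := coef (v % 6)
  len_zero := by
    have : ∀ c < 6, (gens c 0).length = 1 := by decide
    exact this _ (Nat.mod_lt _ (by norm_num))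
  g_zero := by
    have : ∀ c < 6, vtx c 0 0 = c := by decide
    rw [shiftVtx, this _ (Nat.mod_lt _ (by norm_num)), Nat.mod_add_div]
  win t := by
    have hv : v % 6 < 6 := Nat.mod_lt _ (by norm_num)
    obtain ⟨r, q, hr, rfl⟩ : ∃ r q, r < 11 ∧ t = r + 11 * q :=
      ⟨t % 11, t / 11, Nat.mod_lt _ (by norm_num), (Nat.mod_add_div t 11).symm⟩
    rw [add_right_comm r _ 1]
    simp only [gens_add hv, coef_add hv, shiftVtx_add, win_add_iff, ne_eq, Nat.add_right_cancel_iff]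
    exact win_check _ (swapVertex_lt hv q) r hr
  comp t := by
    have hv : v % 6 < 6 := Nat.mod_lt _ (by norm_num)
    obtain ⟨r, q, hr, rfl⟩ : ∃ r q, r < 11 ∧ t = r + 11 * q :=
      ⟨t % 11, t / 11, Nat.mod_lt _ (by norm_num), (Nat.mod_add_div t 11).symm⟩
    rw [add_right_comm r _ 1, add_right_comm r _ 2]
    simp only [gens_add hv, coef_add hv, shiftVtx_add, win_add_iff]
    exact comp_check _ (swapVertex_lt hv q) r hr
  exact₀ n hn hw := by
    have hv : v % 6 < 6 := Nat.mod_lt _ (by norm_num)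
    obtain ⟨n, rfl⟩ : ∃ n', n = n' + 6 * (v / 6) := ⟨n - 6 * (v / 6), by have := hw.1; omega⟩
    have hw' : Win n (v % 6) := by
      rwa [← win_add_iff n (v % 6) (v / 6), Nat.mod_add_div]
    have := exact_zero_check _ hv n (by have := hw'.2.1; omega) (by omega) hw'
    refine ⟨pinv (vis (v % 6) 0 n) 0, ?_⟩
    rw [visible_add (g := shiftVtx v 0) (g' := shiftVtx v 1) (fun _ => rfl) (fun _ => rfl)]
    exact this
  exact t n := by
    have hv : v % 6 < 6 := Nat.mod_lt _ (by norm_num)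
    obtain ⟨r, q, hr, rfl⟩ : ∃ r q, r < 11 ∧ t = r + 11 * q :=
      ⟨t % 11, t / 11, Nat.mod_lt _ (by norm_num), (Nat.mod_add_div t 11).symm⟩
    rw [add_right_comm r _ 1, add_right_comm r _ 2]
    simp only [gens_add hv, coef_add hv]
    have hc := swapVertex_lt hv q
    have hg := fun t k => shiftVtx_add v t q k
    generalize swapVertex q (v % 6) = c at *
    by_cases hn : n < 6 * (6 * q + v / 6)
    · refine ⟨0, 0, fun j _ k _ hj => absurd hj.1 ?_⟩
      rw [hg]
      omega
    obtain ⟨n, rfl⟩ : ∃ n', n = n' + 6 * (6 * q + v / 6) := ⟨n - 6 * (6 * q + v / 6), by omega⟩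
    rw [visible_add (hg (r + 1)) (hg (r + 2)), visible_add (hg r) (hg (r + 1))]
    simp only [hg, win_add_iff]
    by_cases hn' : n < 50
    · exact ⟨_, _, exact_check c hc r hr n hn'⟩
    · refine ⟨0, 0, fun j hj' k _ hj => absurd hj.2.1 ?_⟩
      have := vtx_le_check c hc (r + 1) (by omega) j hj'
      omega

end Tables

section Dimension

variable (K : Type u) [Field K] (s : ℕ) [NeZero s]

omit [NeZero s] in
theorem tmul_op_smul (a b r : Alg K s) :
    ((a ⊗ₜ[K] MulOpposite.op b : Env K s)) • r = a * r * b := by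
  rw [TensorProduct.Algebra.smul_def]
  simp [mul_assoc]

variable {K s} in
theorem finrank_hom_simp (res : ProjRes (Env K s) (Alg K s)) (hmin : res.Minimal) (t : ℕ)
    (i : ZMod (6 * s)) (v : ℕ) :
    Module.Finite K (res.Q t →ₗ[Env K s] Simp (char K s i) (char K s (v : ZMod (6 * s)))) ∧
      Module.finrank K (res.Q t →ₗ[Env K s] Simp (char K s i) (char K s (v : ZMod (6 * s)))) =
        ∑ k ∈ Finset.range (gens (v % 6) t).length,
          if (shiftVtx v t k : ZMod (6 * s)) = i then 1 else 0 := by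
  obtain ⟨e⟩ := nonempty_hom_simp_equiv (K := K) (R := Alg K s) (χ := char K s i) res hmin
    (tmul_op_smul K s) ((resData v).res K s)
    (fun t _ hψ y => (resData v).charHom_diff K s i t hψ y) t
  obtain ⟨h₁, h₂⟩ := (resData v).finrank_charHom K s i t
  refine ⟨@Module.Finite.equiv _ _ _ _ _ _ _ _ h₁ e.symm, e.finrank_eq.trans (h₂.trans ?_)⟩
  rw [Fintype.card_subtype, Finset.card_filter, Finset.sum_range]
  rfl

variable {K s} in
theorem finrank_hom (res : ProjRes (Env K s) (Alg K s)) (hmin : res.Minimal) (t : ℕ) :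
    Module.finrank K (res.Q t →ₗ[Env K s] Alg K s) =
      ∑ v ∈ Finset.range (6 * s), ∑ n ∈ window v, ∑ k ∈ Finset.range (gens (v % 6) t).length,
        if (n : ZMod (6 * s)) = shiftVtx v t k then 1 else 0 := by
  have := res.proj t
  have hS : ∀ i j : ZMod (6 * s),
      Module.Finite K (res.Q t →ₗ[Env K s] Simp (char K s i) (char K s j)) ∧
        Module.finrank K (res.Q t →ₗ[Env K s] Simp (char K s i) (char K s j)) =
          ∑ k ∈ Finset.range (gens (j.val % 6) t).length,
            if (shiftVtx j.val t k : ZMod (6 * s)) = i then 1 else 0 := fun i j => by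
    have := finrank_hom_simp res hmin t i j.val
    rwa [ZMod.natCast_zmod_val] at this
  have hC : ∀ i j : ZMod (6 * s), Module.finrank K (fixed K (ee K s i) (ee K s j) (Alg K s)) =
      ∑ n ∈ window j.val, if (n : ZMod (6 * s)) = i then 1 else 0 := by
    intro i j
    rw [finrank_corner K s i j.val, Finset.card_filter]
    intro x
    rw [mem_fixed, eN, ZMod.natCast_zmod_val]
    exact Eq.congr_left (tmul_op_smul K s _ _ _)
  rw [(finrank_hom_eq_sum (K := K) (R := Alg K s) (char K s) (ee K s) (hasEigenvectors K s)
    (char_ee K s) (fun i => by rw [ee_mul_ee, if_pos rfl]) (res.Q t) (fun i j => (hS i j).1)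
    _ (Alg K s) rfl).2]
  simp only [hC, (hS _ _).2]
  rw [Finset.sum_comm]
  have hv : ∀ j : ZMod (6 * s), (∑ i : ZMod (6 * s),
      (∑ n ∈ window j.val, if (n : ZMod (6 * s)) = i then 1 else 0) *
        ∑ k ∈ Finset.range (gens (j.val % 6) t).length,
          if (shiftVtx j.val t k : ZMod (6 * s)) = i then 1 else 0) =
      ∑ n ∈ window j.val, ∑ k ∈ Finset.range (gens (j.val % 6) t).length,
        if (n : ZMod (6 * s)) = shiftVtx j.val t k then 1 else 0 := by
    intro j
    simp only [Finset.sum_mul_sum]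
    rw [Finset.sum_comm]
    refine Finset.sum_congr rfl fun n _ => ?_
    rw [Finset.sum_comm]
    refine Finset.sum_congr rfl fun k _ => ?_
    simp only [ite_mul, one_mul, zero_mul, Finset.sum_ite_eq, Finset.mem_univ, if_true]
    exact if_congr eq_comm rfl rfl
  rw [Finset.sum_congr rfl fun j _ => hv j]
  refine Finset.sum_bij (fun j _ => j.val) (fun j _ => Finset.mem_range.2 j.val_lt)
    (fun i _ j _ h => ZMod.val_injective _ h) (fun v hv => ⟨v, Finset.mem_univ _, ?_⟩)
    fun _ _ => rfl
  exact ZMod.val_natCast_of_lt (Finset.mem_range.1 hv)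

/-- The number of pairs of a path and a generator contributing to the dimension; `a` and `b` say
whether the two possible positions contribute. -/
def pairCount (p r : ℕ) (a b : Bool) : ℕ :=
  ∑ c ∈ Finset.range 6, ∑ d ∈ Finset.range 7,
    ∑ k ∈ Finset.range (gens (swapVertex p c) r).length,
      if winB (c + d) c = true ∧ (c + d) % 6 = vtx (swapVertex p c) r k % 6 ∧
        (((c + d) / 6 + r / 2 = vtx (swapVertex p c) r k / 6 ∧ a = true) ∨
          ((c + d) / 6 + r / 2 = vtx (swapVertex p c) r k / 6 + 1 ∧ b = true)) then 1 else 0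

/-- The value of `pairCount`. -/
def dimCoeff (p r : ℕ) (a b : Bool) : ℕ :=
  if r = 0 then (if a || b then (if p = 0 then 6 else 2) else 0)
  else if r = 1 then (if a then (if p = 0 then 7 else 5) else 0)
  else if r = 2 ∨ r = 8 then
    (if a then (if p = 0 then 3 else 1) else if b then (if p = 0 then 1 else 3) else 0)
  else if r = 3 ∨ r = 5 ∨ r = 7 then (if a then 8 else 0)
  else if r = 4 then
    (if a then (if p = 0 then 2 else 6) else if b then (if p = 0 then 5 else 7) else 0)
  else if r = 6 then
    (if a then (if p = 0 then 7 else 5) else if b then (if p = 0 then 6 else 2) else 0)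
  else if r = 9 then (if a then (if p = 0 then 5 else 7) else 0)
  else (if a || b then (if p = 0 then 2 else 6) else 0)

theorem pairCount_eq : ∀ p < 2, ∀ r < 11, ∀ a b : Bool, (a && b) = false →
    pairCount p r a b = dimCoeff p r a b := by
  decide +kernel

set_option synthInstance.maxSize 2000 in
theorem position_check : ∀ p < 2, ∀ c < 6, ∀ r < 11,
    ∀ k < (gens (swapVertex p c) r).length, ∀ d < 7,
      winB (c + d) c = true ∧ (c + d) % 6 = vtx (swapVertex p c) r k % 6 →
      (c + d) / 6 + r / 2 = vtx (swapVertex p c) r k / 6 ∨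
        (c + d) / 6 + r / 2 = vtx (swapVertex p c) r k / 6 + 1 := by
  decide +kernel

omit [NeZero s] in
theorem homDim_eq (t : ℕ) : homDim s t = s * dimCoeff (t / 11 % 2) (t % 11)
    ((6 * (t / 11) + t % 11 / 2) % s == 0 % s) ((6 * (t / 11) + t % 11 / 2) % s == 1 % s) := by
  have : t % 11 < 11 := Nat.mod_lt _ (by norm_num)
  unfold homDim dimCoeff
  dsimp only
  generalize ((6 * (t / 11) + t % 11 / 2) % s == 0 % s) = a
  generalize ((6 * (t / 11) + t % 11 / 2) % s == 1 % s) = b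
  generalize t % 11 = r at *
  generalize t / 11 % 2 = p
  interval_cases r <;> cases a <;> cases b <;> by_cases hp : p = 0 <;> simp [hp, mul_comm]

omit [NeZero s] in
theorem sum_range_six_mul {F f : ℕ → ℕ} (h : ∀ b, ∀ c < 6, F (6 * b + c) = f c) :
    ∑ v ∈ Finset.range (6 * s), F v = s * ∑ c ∈ Finset.range 6, f c := by
  induction s with
  | zero => simp
  | succ b ih =>
    rw [mul_add_one, Finset.sum_range_add, ih, add_one_mul,
      Finset.sum_congr rfl fun c hc => h b c (Finset.mem_range.1 hc)]

theorem sum_window (v : ℕ) (f : ℕ → ℕ) : ∑ n ∈ window v, f n =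
    ∑ d ∈ Finset.range 7, if winB (v + d) v = true then f (v + d) else 0 := by
  rw [window, Finset.sum_filter, Finset.sum_range_add, Finset.sum_eq_zero, zero_add]
  · simp only [winB_iff]
  · intro n hn
    rw [if_neg fun h => absurd h.1 (not_le.2 (Finset.mem_range.1 hn))]

theorem winB_add (n v a : ℕ) : winB (n + 6 * a) (v + 6 * a) = winB n v := by
  rw [Bool.eq_iff_iff, winB_iff, winB_iff, win_add_iff]

omit [NeZero s] in
theorem natCast_eq_iff (n g q m a : ℕ) :
    ((n + 6 * a : ℕ) : ZMod (6 * s)) = ((g + 6 * (6 * q + a) : ℕ) : ZMod (6 * s)) ↔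
      n % 6 = g % 6 ∧ (n / 6 + m ≡ g / 6 + (6 * q + m) [MOD s]) := by
  rw [ZMod.natCast_eq_natCast_iff, mul_add, ← add_assoc]
  have h₁ : n + 6 * a ≡ g + 6 * (6 * q) + 6 * a [MOD 6 * s] ↔ n ≡ g + 6 * (6 * q) [MOD 6 * s] :=
    ⟨Nat.ModEq.add_right_cancel' _, Nat.ModEq.add_right _⟩
  have h₂ : n / 6 + m ≡ g / 6 + (6 * q + m) [MOD s] ↔ n / 6 ≡ g / 6 + 6 * q [MOD s] := by
    rw [← add_assoc]
    exact ⟨Nat.ModEq.add_right_cancel' _, Nat.ModEq.add_right _⟩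
  rw [h₁, h₂]
  constructor
  · intro h
    have h6 : n % 6 = g % 6 := by
      have := h.of_mul_right s
      unfold Nat.ModEq at this
      omega
    refine ⟨h6, ?_⟩
    have h' : n % 6 + 6 * (n / 6) ≡ n % 6 + 6 * (g / 6 + 6 * q) [MOD 6 * s] := by
      convert h using 1 <;> omega
    exact Nat.ModEq.mul_left_cancel' (by norm_num) (Nat.ModEq.add_left_cancel' _ h')
  · rintro ⟨h6, h⟩
    have := (Nat.ModEq.mul_left' 6 h).add_left (n % 6)
    convert this using 1 <;> omega

omit [NeZero s] in
theorem sum_window_eq {r q c : ℕ} (hr : r < 11) (hc : c < 6) (a : ℕ) :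
    ∑ n ∈ window (6 * a + c), ∑ k ∈ Finset.range (gens ((6 * a + c) % 6) (r + 11 * q)).length,
      (if (n : ZMod (6 * s)) = shiftVtx (6 * a + c) (r + 11 * q) k then 1 else 0) =
    ∑ d ∈ Finset.range 7, ∑ k ∈ Finset.range (gens (swapVertex (q % 2) c) r).length,
      if winB (c + d) c = true ∧ (c + d) % 6 = vtx (swapVertex (q % 2) c) r k % 6 ∧
        (((c + d) / 6 + r / 2 = vtx (swapVertex (q % 2) c) r k / 6 ∧
            ((6 * q + r / 2) % s == 0 % s) = true) ∨
          ((c + d) / 6 + r / 2 = vtx (swapVertex (q % 2) c) r k / 6 + 1 ∧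
            ((6 * q + r / 2) % s == 1 % s) = true)) then 1 else 0 := by
  have hm : (c + 6 * a) % 6 = c := by omega
  have hd : (c + 6 * a) / 6 = a := by omega
  rw [add_comm (6 * a) c, sum_window]
  refine Finset.sum_congr rfl fun d hd' => ?_
  rw [hm, gens_add hc, swapVertex_mod, add_right_comm, winB_add]
  split_ifs with hw
  · refine Finset.sum_congr rfl fun k hk => if_congr ?_ rfl rfl
    rw [shiftVtx_add, hm, hd, natCast_eq_iff s _ _ q (r / 2)]
    have := position_check (q % 2) (Nat.mod_lt _ two_pos) c hc r hr k
    rw [swapVertex_mod] at this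
    have := this (Finset.mem_range.1 hk) d (Finset.mem_range.1 hd')
    simp only [hw, true_and, beq_iff_eq]
    refine and_congr_right fun h6 => ?_
    rcases this ⟨hw, h6⟩ with h | h
    · rw [h]
      have : vtx (swapVertex q c) r k / 6 ≡ vtx (swapVertex q c) r k / 6 + (6 * q + r / 2) [MOD s] ↔
          (6 * q + r / 2) % s = 0 % s :=
        ⟨fun h => (Nat.ModEq.add_left_cancel' _ (h : _ + 0 ≡ _ [MOD s])).symm,
          fun h => Nat.ModEq.add_left _ (show 0 ≡ _ [MOD s] from h.symm)⟩
      rw [this]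
      simp
    · rw [h]
      have : vtx (swapVertex q c) r k / 6 + 1 ≡ vtx (swapVertex q c) r k / 6 + (6 * q + r / 2)
          [MOD s] ↔ (6 * q + r / 2) % s = 1 % s :=
        ⟨fun h => (Nat.ModEq.add_left_cancel' _ h).symm,
          fun h => Nat.ModEq.add_left _ (show 1 ≡ _ [MOD s] from h.symm)⟩
      rw [this]
      simp
  · simp [hw]

end Dimension

/-- Dimensions of the homomorphism groups `Hom_Λ(Q_t, R_s)` for the
minimal projective `Λ`-resolution `(Q_t)` of `R_s`, in the case `s > 1`
(writing `t = 11ℓ + r`, `m = ⌊r/2⌋`, `n = 6`). -/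
theorem hom_dims (K : Type u) [Field K] (s : ℕ) (hs : 1 < s)
    (res : ProjRes (Env K s) (Alg K s)) (hmin : res.Minimal) (t : ℕ) :
    Module.finrank K (res.Q t →ₗ[Env K s] Alg K s) = homDim s t := by
  have : NeZero s := ⟨by omega⟩
  rw [finrank_hom res hmin t, homDim_eq]
  obtain ⟨r, q, hr, rfl⟩ : ∃ r q, r < 11 ∧ t = r + 11 * q :=
    ⟨t % 11, t / 11, Nat.mod_lt _ (by norm_num), (Nat.mod_add_div t 11).symm⟩
  rw [show (r + 11 * q) % 11 = r by omega, show (r + 11 * q) / 11 = q by omega,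
    sum_range_six_mul s fun b c hc => sum_window_eq s hr hc b]
  rw [← pairCount_eq (q % 2) (Nat.mod_lt _ two_pos) r hr, pairCount]
  rw [Nat.zero_mod, Nat.mod_eq_of_lt hs, Bool.and_eq_false_iff, beq_eq_false_iff_ne,
    beq_eq_false_iff_ne]
  omega

end E6
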